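/- Assume (F), (W) and (P2). Suppose (ρ_L,ρ_R)∈[0,R]² satisfies one of the conditions: (C1) ρ_L<ρ_R, f(ρ_R)<f(ρ_L) and f(ρ_R)≤p(ρ_L+); (C2) ρ_L<ρ_R, f(ρ_L)≤f(ρ_R) and f(ρ_L)≤p(ρ_L+); (C3) ρ_R≤ρ_L≤ρ̄ and f(ρ_L)≤p(ρ_L+); (C4) ρ_R≤ρ̄<ρ_L and f(ρ̄)=p(ρ_L+); (C5) ρ̄<ρ_R≤ρ_L, f(ρ_R)≤p(ρ_L−) and f(ρ_L)<p(ρ_L+). Then there exists T>0 such that the constrained Riemann problem with non-local constraint admits an entropy weak solution on [0,T), and any two entropy weak solutions on [0,T) coincide a.e. on (0,T)×ℝ. -/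

import Mathlib

open MeasureTheory Set Filter

namespace CRP

noncomputable section

/-- Smooth compactly supported test functions on `ℝ²`. -/
def TestFn (φ : ℝ × ℝ → ℝ) : Prop :=
  ContDiff ℝ (⊤ : ℕ∞) φ ∧ HasCompactSupport φ

/-- Partial derivative of a test function in the first (time) variable. -/
def pdT (φ : ℝ × ℝ → ℝ) (z : ℝ × ℝ) : ℝ := fderiv ℝ φ z (1, 0)

/-- Partial derivative of a test function in the second (space) variable. -/
def pdX (φ : ℝ × ℝ → ℝ) (z : ℝ × ℝ) : ℝ := fderiv ℝ φ z (0, 1)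

/-- Assumption (F): `f : [0,R] → [0,∞)` is Lipschitz, `f 0 = 0 = f R`, and there is
`ρb ∈ (0,R)` with `f' ρ * (ρb - ρ) > 0` for a.e. `ρ ∈ [0,R]`. -/
def AF (R ρb : ℝ) (f : ℝ → ℝ) : Prop :=
  0 < R ∧ (∃ L : NNReal, LipschitzOnWith L f (Icc 0 R)) ∧
    (∀ x ∈ Icc (0:ℝ) R, 0 ≤ f x) ∧ f 0 = 0 ∧ f R = 0 ∧ ρb ∈ Ioo 0 R ∧
    (∀ᵐ x ∂(volume.restrict (Icc (0:ℝ) R)), deriv f x * (ρb - x) > 0)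

/-- Assumption (W): `w` is a nonnegative non-decreasing weight on `ℝ₋` with unit integral
and support in `[-i_w, 0]`. -/
def AW (w : ℝ → ℝ) : Prop :=
  (∀ x ≤ (0:ℝ), 0 ≤ w x) ∧ MonotoneOn w (Iic 0) ∧
    (∫ x in Iic (0:ℝ), w x) = 1 ∧ ∃ iw : ℝ, 0 < iw ∧ ∀ x ≤ -iw, w x = 0

/-- Assumption (P2): `p : [0,R] → (0, fmax]` is non-increasing and piecewise constant
with finitely many jumps (equivalently, it has finitely many values). -/
def AP2 (R fmax : ℝ) (p : ℝ → ℝ) : Prop :=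
  AntitoneOn p (Icc 0 R) ∧ (∀ ξ ∈ Icc (0:ℝ) R, p ξ ∈ Ioc 0 fmax) ∧ (p '' Icc 0 R).Finite

/-- The left limit `p(ξ−)` of a non-increasing piecewise constant `p` on `[0,R]`,
with the convention `p(0−) = p 0`. -/
def pminus (p : ℝ → ℝ) (ξ : ℝ) : ℝ := if ξ ≤ 0 then p 0 else sInf (p '' Ico 0 ξ)

/-- The right limit `p(ξ+)` of a non-increasing piecewise constant `p` on `[0,R]`,
with the convention `p(R+) = p R`. -/
def pplus (R : ℝ) (p : ℝ → ℝ) (ξ : ℝ) : ℝ := if R ≤ ξ then p R else sSup (p '' Ioc ξ R)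

/-- `γ` is the left measure-theoretic trace of `ρ` at `x = 0`. -/
def LeftTraceAt (ρ : ℝ → ℝ → ℝ) (γ : ℝ → ℝ) : Prop :=
  ∀ φ : ℝ × ℝ → ℝ, TestFn φ →
    Tendsto (fun ε : ℝ => (1 / ε) * ∫ t in Ioi (0:ℝ), ∫ x in Ioo (-ε) (0:ℝ),
        |ρ t x - γ t| * φ (t, x)) (nhdsWithin 0 (Ioi 0)) (nhds 0)

/-- `γ` is the right measure-theoretic trace of `ρ` at `x = 0`. -/
def RightTraceAt (ρ : ℝ → ℝ → ℝ) (γ : ℝ → ℝ) : Prop :=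
  ∀ φ : ℝ × ℝ → ℝ, TestFn φ →
    Tendsto (fun ε : ℝ => (1 / ε) * ∫ t in Ioi (0:ℝ), ∫ x in Ioo (0:ℝ) ε,
        |ρ t x - γ t| * φ (t, x)) (nhdsWithin 0 (Ioi 0)) (nhds 0)

/-- The constrained entropy inequality (i), with constraint level `q`, initial datum `ρ0`,
tested on all nonnegative test functions. -/
def EntIneq (R fmax : ℝ) (f q ρ0 : ℝ → ℝ) (ρ : ℝ → ℝ → ℝ) : Prop :=
  ∀ φ : ℝ × ℝ → ℝ, TestFn φ → (∀ z, 0 ≤ φ z) → ∀ k ∈ Icc (0:ℝ) R,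
    0 ≤ (∫ t in Ioi (0:ℝ), ∫ x : ℝ,
          (|ρ t x - k| * pdT φ (t, x) +
            Real.sign (ρ t x - k) * (f (ρ t x) - f k) * pdX φ (t, x))) +
        2 * (∫ t in Ioi (0:ℝ), (1 - q t / fmax) * f k * φ (t, 0)) +
        ∫ x : ℝ, |ρ0 x - k| * φ (0, x)

/-- The constrained entropy inequality (i) on the time interval `[0,T)`: only test
functions supported in `(-∞,T) × ℝ` are used. -/
def EntIneqOn (R fmax T : ℝ) (f q ρ0 : ℝ → ℝ) (ρ : ℝ → ℝ → ℝ) : Prop :=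
  ∀ φ : ℝ × ℝ → ℝ, TestFn φ → (∀ z, 0 ≤ φ z) →
    tsupport φ ⊆ Iio T ×ˢ (univ : Set ℝ) → ∀ k ∈ Icc (0:ℝ) R,
    0 ≤ (∫ t in Ioi (0:ℝ), ∫ x : ℝ,
          (|ρ t x - k| * pdT φ (t, x) +
            Real.sign (ρ t x - k) * (f (ρ t x) - f k) * pdX φ (t, x))) +
        2 * (∫ t in Ioi (0:ℝ), (1 - q t / fmax) * f k * φ (t, 0)) +
        ∫ x : ℝ, |ρ0 x - k| * φ (0, x)

/-- Basic regularity required of solutions: measurability, values in `[0,R]`, and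
continuity in time with values in `L¹loc` (on compact sets `[-r,r]`). -/
def RegSol (R : ℝ) (ρ : ℝ → ℝ → ℝ) : Prop :=
  Measurable (Function.uncurry ρ) ∧ (∀ t x, ρ t x ∈ Icc (0:ℝ) R) ∧
    ∀ r : ℝ, 0 < r → ∀ s : ℝ, 0 ≤ s →
      Tendsto (fun t => ∫ x in Icc (-r) r, |ρ t x - ρ s x|) (nhdsWithin s (Ici 0)) (nhds 0)

/-- `ρ`, with traces `γm`, `γp` at `x = 0`, satisfies the constrained entropy
inequalities with constraint level `q : (0,∞) → [0,fmax]` and initial datum `ρ0`. -/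
def CEI (R fmax : ℝ) (f q ρ0 : ℝ → ℝ) (ρ : ℝ → ℝ → ℝ) (γm γp : ℝ → ℝ) : Prop :=
  RegSol R ρ ∧ (∀ t, q t ∈ Icc (0:ℝ) fmax) ∧ EntIneq R fmax f q ρ0 ρ ∧
    LeftTraceAt ρ γm ∧ RightTraceAt ρ γp ∧
    (∀ᵐ t ∂(volume.restrict (Ioi (0:ℝ))), f (γm t) ≤ q t ∧ f (γp t) ≤ q t)

/-- Same as `CEI`, but on the time interval `[0,T)`. -/
def CEIOn (R fmax T : ℝ) (f q ρ0 : ℝ → ℝ) (ρ : ℝ → ℝ → ℝ) (γm γp : ℝ → ℝ) : Prop :=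
  RegSol R ρ ∧ (∀ t, q t ∈ Icc (0:ℝ) fmax) ∧ EntIneqOn R fmax T f q ρ0 ρ ∧
    LeftTraceAt ρ γm ∧ RightTraceAt ρ γp ∧
    (∀ᵐ t ∂(volume.restrict (Ioo (0:ℝ) T)), f (γm t) ≤ q t ∧ f (γp t) ≤ q t)

/-- The weighted average `ξ(t) = ∫_{ℝ₋} w x * ρ t x dx`. -/
def wAvg (w : ℝ → ℝ) (ρ : ℝ → ℝ → ℝ) (t : ℝ) : ℝ := ∫ x in Iic (0:ℝ), w x * ρ t x

/-- Entropy weak solution of the Cauchy problem with non-local point constraint given by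
the (possibly multivalued, filled-in) piecewise constant `p`: there is a constraint level
`q` with `q t ∈ P(ξ(t)) = [p(ξ(t)+), p(ξ(t)−)]` a.e. such that `ρ` satisfies the
constrained entropy inequalities with constraint level `q`. -/
def EWSol (R fmax : ℝ) (f w p ρ0 : ℝ → ℝ) (ρ : ℝ → ℝ → ℝ) (γm γp : ℝ → ℝ) : Prop :=
  ∃ q : ℝ → ℝ, CEI R fmax f q ρ0 ρ γm γp ∧
    ∀ᵐ t ∂(volume.restrict (Ioi (0:ℝ))),
      q t ∈ Icc (pplus R p (wAvg w ρ t)) (pminus p (wAvg w ρ t))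

/-- Entropy weak solution with non-local constraint on the time interval `[0,T)`. -/
def EWSolOn (R fmax T : ℝ) (f w p ρ0 : ℝ → ℝ) (ρ : ℝ → ℝ → ℝ) (γm γp : ℝ → ℝ) : Prop :=
  ∃ q : ℝ → ℝ, CEIOn R fmax T f q ρ0 ρ γm γp ∧
    ∀ᵐ t ∂(volume.restrict (Ioo (0:ℝ) T)),
      q t ∈ Icc (pplus R p (wAvg w ρ t)) (pminus p (wAvg w ρ t))

/-- The Riemann initial datum. -/
def riem (ρL ρR : ℝ) (x : ℝ) : ℝ := if x < 0 then ρL else ρR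

/-- `ρ1 = ρ2` a.e. on `(0,T) × ℝ`. -/
def aeEqOn (T : ℝ) (ρ1 ρ2 : ℝ → ℝ → ℝ) : Prop :=
  ∀ᵐ z ∂((volume : Measure (ℝ × ℝ)).restrict (Ioo (0:ℝ) T ×ˢ (univ : Set ℝ))),
    ρ1 z.1 z.2 = ρ2 z.1 z.2

section

lemma lt_of_ae_deriv_pos {g : ℝ → ℝ} {a b : ℝ} (hab : a < b) {K : NNReal}
    (hg : LipschitzOnWith K g (Icc a b)) (hd : ∀ᵐ x ∂(volume.restrict (Icc a b)), 0 < deriv g x) :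
    g a < g b := by
  have hac : AbsolutelyContinuousOnInterval g a b := by
    apply LipschitzOnWith.absolutelyContinuousOnInterval (K := K)
    rwa [uIcc_of_le hab.le]
  have h1 := hac.integral_deriv_eq_sub
  have hi := hac.intervalIntegrable_deriv
  have hd' : ∀ᵐ x ∂(volume.restrict (Ioc a b)), 0 < deriv g x :=
    ae_restrict_of_ae_restrict_of_subset Ioc_subset_Icc_self hd
  have : 0 < ∫ x in a..b, deriv g x := by
    rw [intervalIntegral.integral_of_le hab.le]
    rw [intervalIntegrable_iff_integrableOn_Ioc_of_le hab.le] at hi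
    rw [setIntegral_pos_iff_support_of_nonneg_ae (hd'.mono fun x hx => hx.le) hi]
    have hz : volume (Ioc a b) = volume (Function.support (fun x => deriv g x) ∩ Ioc a b) := by
      apply measure_congr
      rw [ae_restrict_iff' measurableSet_Ioc] at hd'
      filter_upwards [hd'] with x hx
      apply propext
      constructor
      · intro h; exact ⟨(hx h).ne', h⟩
      · intro h; exact h.2
    rw [← hz]; simp [hab]
  linarith

lemma AF.strictMonoOn {R ρb : ℝ} {f : ℝ → ℝ} (h : AF R ρb f) : StrictMonoOn f (Icc 0 ρb) := by
  obtain ⟨hR, ⟨L, hL⟩, h0, hf0, hfR, hb, hd⟩ := h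
  intro x hx y hy hxy
  have hsub : Icc x y ⊆ Icc 0 R := Icc_subset_Icc hx.1 (hy.2.trans hb.2.le)
  apply lt_of_ae_deriv_pos hxy (hL.mono hsub)
  have h1 := ae_restrict_of_ae_restrict_of_subset hsub hd
  rw [ae_restrict_iff' measurableSet_Icc] at h1 ⊢
  have h2 : ∀ᵐ z : ℝ, z ≠ ρb := by simp [ae_iff]
  filter_upwards [h1, h2] with z hz hzb hzm
  have h3 := hz hzm
  have h4 : 0 < ρb - z := by
    have : z ≤ ρb := hzm.2.trans hy.2
    have := lt_of_le_of_ne this hzb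
    linarith
  exact pos_of_mul_pos_left h3 h4.le

lemma AF.strictAntiOn {R ρb : ℝ} {f : ℝ → ℝ} (h : AF R ρb f) : StrictAntiOn f (Icc ρb R) := by
  obtain ⟨hR, ⟨L, hL⟩, h0, hf0, hfR, hb, hd⟩ := h
  intro x hx y hy hxy
  have hsub : Icc x y ⊆ Icc 0 R := Icc_subset_Icc (hb.1.le.trans hx.1) (hy.2)
  have : (-f) x < (-f) y := by
    apply lt_of_ae_deriv_pos hxy (hL.mono hsub).neg
    have h1 := ae_restrict_of_ae_restrict_of_subset hsub hd
    rw [ae_restrict_iff' measurableSet_Icc] at h1 ⊢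
    have h2 : ∀ᵐ z : ℝ, z ≠ ρb := by simp [ae_iff]
    filter_upwards [h1, h2] with z hz hzb hzm
    have h3 := hz hzm
    have h4 : 0 < z - ρb := by
      have : ρb ≤ z := hx.1.trans hzm.1
      have := lt_of_le_of_ne this hzb.symm
      linarith
    rw [deriv.neg]
    have : 0 < (-deriv f z) * (z - ρb) := by nlinarith
    exact pos_of_mul_pos_left this h4.le
  simpa using this

lemma AF.le_max {R ρb : ℝ} {f : ℝ → ℝ} (h : AF R ρb f) {x : ℝ} (hx : x ∈ Icc 0 R) :
    f x ≤ f ρb := by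
  have hb := h.2.2.2.2.2.1
  rcases le_total x ρb with h1 | h1
  · exact h.strictMonoOn.monotoneOn ⟨hx.1, h1⟩ ⟨hb.1.le, le_rfl⟩ h1
  · exact h.strictAntiOn.antitoneOn ⟨le_rfl, hb.2.le⟩ ⟨h1, hx.2⟩ h1

lemma AF.lip {R ρb : ℝ} {f : ℝ → ℝ} (h : AF R ρb f) :
    ∃ L : ℝ, 0 < L ∧ ∀ x ∈ Icc 0 R, ∀ y ∈ Icc 0 R, |f x - f y| ≤ L * |x - y| := by
  obtain ⟨hR, ⟨L, hL⟩, -⟩ := h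
  refine ⟨L + 1, by positivity, fun x hx y hy => ?_⟩
  have := hL.dist_le_mul x hx y hy
  rw [Real.dist_eq, Real.dist_eq] at this
  have h2 := abs_nonneg (x - y)
  linarith

/-- Hamilton-Jacobi structure of the potential. -/
structure HJ (R M L : ℝ) (f : ℝ → ℝ) (T : ℝ) (V : ℝ → ℝ → ℝ) : Prop where
  slope : ∀ t, 0 ≤ t → t ≤ T → ∀ x y, x ≤ y → 0 ≤ V t y - V t x ∧ V t y - V t x ≤ R * (y - x)
  time : ∀ s t, 0 ≤ s → s ≤ t → t ≤ T → ∀ x, -M * (t - s) ≤ V t x - V s x ∧ V t x - V s x ≤ 0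
  coneUp : ∀ t r x k A, 0 ≤ t - r → 0 < r → t ≤ T → L * r ≤ |x| → k ∈ Icc 0 R →
    (∀ y, |y - x| ≤ L * r → V (t - r) y - k * y ≤ A) → V t x - k * x + f k * r ≤ A
  coneDn : ∀ t r x k A, 0 ≤ t - r → 0 < r → t ≤ T → L * r ≤ |x| → k ∈ Icc 0 R →
    (∀ y, |y - x| ≤ L * r → A ≤ V (t - r) y - k * y) → A ≤ V t x - k * x + f k * r

lemma HJ.refl {R M L T : ℝ} {f : ℝ → ℝ} {V : ℝ → ℝ → ℝ} (h : HJ R M L f T V) :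
    HJ R M L (fun k => f (R - k)) T (fun t x => V t (-x) + R * x) where
  slope := by
    intro t h0 hT x y hxy
    have := h.slope t h0 hT (-y) (-x) (by linarith)
    constructor <;> nlinarith
  time := by
    intro s t h0 hst hT x
    have := h.time s t h0 hst hT (-x)
    constructor <;> linarith
  coneUp := by
    intro t r x k A h0 hr hT hx hk hA
    have := h.coneUp t r (-x) (R - k) A h0 hr hT (by simpa using hx) ⟨by linarith [hk.2], by linarith [hk.1]⟩ ?_
    · linarith
    · intro y hy
      have := hA (-y) (by rw [← abs_neg]; convert hy using 2; ring)
      simp only [neg_neg] at this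
      linarith
  coneDn := by
    intro t r x k A h0 hr hT hx hk hA
    have := h.coneDn t r (-x) (R - k) A h0 hr hT (by simpa using hx) ⟨by linarith [hk.2], by linarith [hk.1]⟩ ?_
    · linarith
    · intro y hy
      have := hA (-y) (by rw [← abs_neg]; convert hy using 2; ring)
      simp only [neg_neg] at this
      linarith

lemma HJ.cont {R M L T : ℝ} {f : ℝ → ℝ} {V : ℝ → ℝ → ℝ} (h : HJ R M L f T V) (hR : 0 ≤ R)
    (hM : 0 ≤ M) {s t : ℝ} (hs : s ∈ Icc 0 T) (ht : t ∈ Icc 0 T) (x y : ℝ) :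
    |V t x - V s y| ≤ M * |t - s| + R * |x - y| := by
  have h1 : |V t x - V s x| ≤ M * |t - s| := by
    rcases le_total s t with hst | hst
    · have := h.time s t hs.1 hst ht.2 x
      rw [abs_of_nonneg (sub_nonneg.2 hst), abs_le]; constructor <;> nlinarith
    · have := h.time t s ht.1 hst hs.2 x
      rw [abs_of_nonpos (sub_nonpos.2 hst), abs_le]; constructor <;> nlinarith
  have h2 : |V s x - V s y| ≤ R * |x - y| := by
    rcases le_total y x with hst | hst
    · have := h.slope s hs.1 hs.2 y x hst
      rw [abs_of_nonneg (sub_nonneg.2 hst), abs_le]; constructor <;> nlinarith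
    · have := h.slope s hs.1 hs.2 x y hst
      rw [abs_of_nonpos (sub_nonpos.2 hst), abs_le]; constructor <;> nlinarith
  calc |V t x - V s y| = |(V t x - V s x) + (V s x - V s y)| := by ring_nf
    _ ≤ _ := (abs_add_le _ _).trans (add_le_add h1 h2)

/-- Exact values outside the cone of dependence of the interface, left side. -/
lemma HJ.far {R M L T : ℝ} {f : ℝ → ℝ} {V : ℝ → ℝ → ℝ} (h : HJ R M L f T V)
    {ρL : ℝ} (hρ : ρL ∈ Icc 0 R) (hL : 0 < L)
    (h0 : ∀ x ≤ 0, V 0 x = ρL * x) {t x : ℝ} (ht : t ∈ Icc 0 T)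
    (hx : x ≤ -(L * t)) : V t x = ρL * x - f ρL * t := by
  rcases ht.1.eq_or_lt with h1 | h1
  · subst h1; rw [h0 x (by simpa using hx)]; ring
  have hx0 : x ≤ 0 := by nlinarith
  have hc : ∀ y, |y - x| ≤ L * t → V (t - t) y - ρL * y = 0 := by
    intro y hy
    rw [sub_self, h0 y (by linarith [(abs_le.1 hy).2])]; ring
  have a1 := h.coneUp t t x ρL 0 (by simp) h1 ht.2 (by rw [abs_of_nonpos hx0]; linarith) hρ
    (fun y hy => (hc y hy).le)
  have a2 := h.coneDn t t x ρL 0 (by simp) h1 ht.2 (by rw [abs_of_nonpos hx0]; linarith) hρ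
    (fun y hy => (hc y hy).ge)
  linarith

end

section

lemma HJ.crit_left {R M L T : ℝ} {f : ℝ → ℝ} {V : ℝ → ℝ → ℝ} (h : HJ R M L f T V)
    (hL : 0 < L) {ρb k : ℝ} (hb : ρb ≤ R) (hk0 : 0 ≤ k)
    (hmono : MonotoneOn f (Icc 0 ρb)) {lam v t0 : ℝ} (hlam : k ≤ ρb → lam < f k) (ht0 : t0 ≤ T)
    (hst : ∃ a > 0, ∃ t1, 0 ≤ t1 ∧ t1 < t0 ∧ ∀ t ∈ Icc t1 t0, ∀ x ∈ Icc (-a) 0,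
      V t x ≤ v + lam * (t0 - t) + k * x) :
    ∃ k' > ρb, ∃ a > 0, ∃ t1, 0 ≤ t1 ∧ t1 < t0 ∧ ∀ t ∈ Icc t1 t0, ∀ x ∈ Icc (-a) 0,
      V t x ≤ v + lam * (t0 - t) + k' * x := by
  by_cases hkb : ρb < k
  · exact ⟨k, hkb, hst⟩
  push Not at hkb
  have hlam' := hlam hkb
  set d := (f k - lam) / (2 * L) with hd
  have hdpos : 0 < d := by apply div_pos <;> linarith
  have claim : ∀ n : ℕ, ∃ k' ≥ k, (ρb < k' ∨ k + n * d ≤ k') ∧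
      ∃ a > 0, ∃ t1, 0 ≤ t1 ∧ t1 < t0 ∧ ∀ t ∈ Icc t1 t0, ∀ x ∈ Icc (-a) 0,
      V t x ≤ v + lam * (t0 - t) + k' * x := by
    intro n
    induction n with
    | zero => exact ⟨k, le_rfl, Or.inr (by simp), hst⟩
    | succ n ih =>
      obtain ⟨k', hk', hor, a, ha, t1, ht1, ht10, hV⟩ := ih
      by_cases hkb' : ρb < k'
      · exact ⟨k', hk', Or.inl hkb', a, ha, t1, ht1, ht10, hV⟩
      have hor' : k + n * d ≤ k' := hor.resolve_left hkb'
      push Not at hkb'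
      have hfk : f k ≤ f k' := hmono ⟨hk0, hkb⟩ ⟨hk0.trans hk', hkb'⟩ hk'
      refine ⟨k' + d, by linarith, Or.inr (by push_cast; linarith), min (a / 2) (L * (t0 - t1)),
        lt_min (by linarith) (mul_pos hL (by linarith)), (t0 + t1) / 2, by linarith, by linarith, ?_⟩
      intro t ht x hx
      rcases hx.2.eq_or_lt with hx0 | hx0
      · have := hV t ⟨by linarith [ht.1], ht.2⟩ x ⟨by linarith, hx.2⟩
        subst hx0; simpa using this
      have hx1 : -(a/2) ≤ x := by linarith [hx.1, min_le_left (a / 2) (L * (t0 - t1))]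
      have hx2 : -(L * (t0 - t1)) ≤ x := by linarith [hx.1, min_le_right (a / 2) (L * (t0 - t1))]
      have hr : 0 < -x / (2 * L) := by apply div_pos <;> linarith
      have hLr : L * (-x / (2 * L)) = -x / 2 := by field_simp
      have hr2 : -x / (2 * L) ≤ (t0 - t1) / 2 := by
        rw [div_le_div_iff₀ (by linarith) (by norm_num)]; nlinarith
      have := h.coneUp t (-x / (2 * L)) x k' (v + lam * (t0 - (t - -x / (2 * L))))
        (by linarith [ht.1]) hr (ht.2.trans ht0)
        (by rw [hLr, abs_of_neg hx0]; linarith) ⟨hk0.trans hk', hkb'.trans hb⟩ (by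
          intro y hy
          rw [hLr, abs_le] at hy
          have := hV (t - -x / (2 * L)) ⟨by linarith [ht.1], by linarith [ht.2]⟩ y
            ⟨by linarith [hy.1], by linarith [hy.2]⟩
          linarith)
      have e1 : (f k' - lam) * (-x / (2*L)) ≥ d * (-x) := by
        have : d * (-x) = (f k - lam) * (-x / (2*L)) := by rw [hd]; field_simp
        rw [this]
        apply mul_le_mul_of_nonneg_right _ hr.le
        linarith
      linarith
  obtain ⟨n, hn⟩ := exists_nat_gt ((ρb - k) / d)
  obtain ⟨k', hk', hor, hst'⟩ := claim n
  refine ⟨k', ?_, hst'⟩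
  rcases hor with h1 | h1
  · exact h1
  · rw [div_lt_iff₀ hdpos] at hn
    linarith

/-- Junction principle. -/
def JP (ρb c T : ℝ) (V : ℝ → ℝ → ℝ) : Prop :=
  ∀ t0 lam km kp a t1, 0 ≤ t1 → t1 < t0 → t0 ≤ T → 0 < a → kp < ρb → ρb < km → lam < c →
    (∀ t ∈ Icc t1 t0, ∀ x ∈ Icc (-a) 0, V t x ≤ V t0 0 + lam * (t0 - t) + km * x) →
    (∀ t ∈ Icc t1 t0, ∀ x ∈ Icc 0 a, V t x ≤ V t0 0 + lam * (t0 - t) + kp * x) → False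

lemma HJ.contT {R M L T : ℝ} {f : ℝ → ℝ} {V : ℝ → ℝ → ℝ} (h : HJ R M L f T V) (hR : 0 ≤ R)
    (hM : 0 ≤ M) : ContinuousOn (fun z : ℝ × ℝ => V z.1 z.2) (Icc 0 T ×ˢ univ) := by
  intro z hz
  rw [Metric.continuousWithinAt_iff]
  intro ε hε
  refine ⟨ε / (M + R + 1), by positivity, ?_⟩
  intro y hy hd
  have := h.cont hR hM hz.1 hy.1 y.2 z.2
  rw [Real.dist_eq]
  rw [Prod.dist_eq, max_lt_iff, Real.dist_eq, Real.dist_eq, lt_div_iff₀ (by positivity),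
    lt_div_iff₀ (by positivity)] at hd
  have n1 := abs_nonneg (y.1 - z.1)
  have n2 := abs_nonneg (y.2 - z.2)
  have m1 : M * |y.1 - z.1| * (M + R + 1) ≤ M * ε := by nlinarith
  have m2 : R * |y.2 - z.2| * (M + R + 1) ≤ R * ε := by nlinarith
  have m3 : (M * |y.1 - z.1| + R * |y.2 - z.2|) * (M+R+1) < ε * (M + R + 1) := by nlinarith
  have := lt_of_mul_lt_mul_right m3 (by positivity)
  linarith

lemma HJ.interface {R M L T : ℝ} {f : ℝ → ℝ} {V : ℝ → ℝ → ℝ} (h : HJ R M L f T V)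
    (hR : 0 ≤ R) (hM : 0 ≤ M)
    (hL : 0 < L) {ρb c kL kR F : ℝ} (hb0 : 0 ≤ ρb) (hb : ρb ≤ R) (hkL : 0 ≤ kL) (hkL' : kL ≤ ρb)
    (hkR : ρb ≤ kR) (hkR' : kR ≤ R)
    (hmono : MonotoneOn f (Icc 0 ρb)) (hanti : AntitoneOn f (Icc ρb R))
    (hJ : JP ρb c T V)
    (hl : ∀ t, 0 ≤ t → t ≤ T → ∀ x ≤ 0, V t x ≤ V t 0 + kL * x)
    (hr : ∀ t, 0 ≤ t → t ≤ T → ∀ x, 0 ≤ x → V t x ≤ V t 0 + kR * x)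
    (h1 : F ≤ f kL) (h2 : F ≤ f kR) (h3 : F ≤ c) {s t : ℝ} (hs : 0 ≤ s) (hst : s ≤ t) (ht : t ≤ T) :
    V t 0 - V s 0 ≤ -F * (t - s) := by
  by_contra hcon
  push Not at hcon
  have hst' : s < t := by
    rcases hst.eq_or_lt with h | h
    · subst h; simp at hcon
    · exact h
  obtain ⟨lam, hl1, hl2⟩ : ∃ lam, lam < F ∧ -lam * (t - s) < V t 0 - V s 0 := by
    have : -F < (V t 0 - V s 0) / (t - s) := by rw [lt_div_iff₀ (by linarith)]; exact hcon
    obtain ⟨m, hm1, hm2⟩ := exists_between this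
    rw [lt_div_iff₀ (by linarith)] at hm2
    exact ⟨-m, by linarith, by simpa using hm2⟩
  have hc : ContinuousOn (fun τ => V τ 0 + lam * τ) (Icc s t) := by
    apply ContinuousOn.add _ (by fun_prop)
    exact (h.contT hR hM).comp (f := fun τ : ℝ => (τ, (0:ℝ))) (by fun_prop)
      (fun τ hτ => ⟨⟨hs.trans hτ.1, hτ.2.trans ht⟩, mem_univ _⟩)
  obtain ⟨t0, ht0, hmax⟩ := isCompact_Icc.exists_isMaxOn (nonempty_Icc.2 hst) hc
  have hs0 : s < t0 := by
    rcases ht0.1.eq_or_lt with h | h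
    · have := hmax (right_mem_Icc.2 hst)
      simp only [mem_ofPred_eq] at this
      subst h; linarith
    · exact h
  have hbd : ∀ τ ∈ Icc s t0, V τ 0 ≤ V t0 0 + lam * (t0 - τ) := by
    intro τ hτ
    have := hmax (⟨hτ.1, hτ.2.trans ht0.2⟩ : τ ∈ Icc s t)
    simp only [mem_ofPred_eq] at this
    linarith
  have ht0T : t0 ≤ T := ht0.2.trans ht
  obtain ⟨km, hkm, a, ha, t1, ht1, ht10, hV⟩ := h.crit_left hL hb hkL hmono (lam := lam)
    (v := V t0 0) (t0 := t0) (fun _ => by linarith) ht0T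
    ⟨1, one_pos, s, hs, hs0, fun τ hτ x hx => by
      have := hl τ (hs.trans hτ.1) (hτ.2.trans ht0T) x hx.2
      have := hbd τ hτ
      linarith⟩
  obtain ⟨km2, hkm2, a2, ha2, t2, ht2, ht20, hV2⟩ := h.refl.crit_left hL (ρb := R - ρb) (k := R - kR)
    (by linarith) (by linarith)
    (by
      intro x hx y hy hxy
      exact hanti ⟨by linarith [hy.2], by linarith [hy.1]⟩ ⟨by linarith [hx.2], by linarith [hx.1]⟩
        (by linarith)) (lam := lam)
    (v := V t0 0) (t0 := t0) (fun _ => by simp only [sub_sub_cancel]; linarith) ht0T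
    ⟨1, one_pos, s, hs, hs0, fun τ hτ x hx => by
      have := hr τ (hs.trans hτ.1) (hτ.2.trans ht0T) (-x) (by linarith [hx.2])
      have := hbd τ hτ
      linarith⟩
  refine hJ t0 lam km (R - km2) (min a a2) (max t1 t2) (le_max_of_le_left ht1) (max_lt ht10 ht20) ht0T
    (lt_min ha ha2) (by linarith) hkm (by linarith) ?_ ?_
  · intro τ hτ x hx
    exact hV τ ⟨(le_max_left _ _).trans hτ.1, hτ.2⟩ x ⟨by linarith [hx.1, min_le_left a a2], hx.2⟩
  · intro τ hτ x hx
    have := hV2 τ ⟨(le_max_right _ _).trans hτ.1, hτ.2⟩ (-x)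
      ⟨by linarith [hx.2, min_le_right a a2], by linarith [hx.1]⟩
    simp only [neg_neg] at this
    linarith

/-- Used in case (C5): lower bound on the left from the interface monotonicity. -/
lemma HJ.lower_left {R M L T : ℝ} {f : ℝ → ℝ} {V : ℝ → ℝ → ℝ} (h : HJ R M L f T V)
    (hR : 0 ≤ R) (hM : 0 ≤ M) (hL : 0 < L) {ρL c t0 : ℝ} (hρ : ρL ∈ Icc 0 R)
    (h0 : ∀ x ≤ 0, V 0 x = ρL * x) (ht0 : t0 ∈ Icc 0 T) (hc : f ρL ≤ c)
    (hI : ∀ s ∈ Icc 0 t0, V t0 0 + c * (t0 - s) ≤ V s 0) :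
    ∀ s ∈ Icc 0 t0, ∀ x ≤ 0, V t0 0 + c * (t0 - s) + ρL * x ≤ V s x := by
  -- strict version
  set C := V t0 0 + c * t0 with hC
  have hC0 : C ≤ 0 := by
    have := hI 0 ⟨le_rfl, ht0.1⟩
    rw [h0 0 le_rfl] at this
    simp at this; linarith
  have key : ∀ η > 0, ∀ s ∈ Icc 0 t0, ∀ x ≤ 0, 0 ≤ V s x - ρL * x + c * s - C + η * s := by
    intro η hη
    have hfar : ∀ s ∈ Icc 0 t0, ∀ x ≤ -(L * s), 0 ≤ V s x - ρL * x + c * s - C + η * s := by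
      intro s hs x hx
      rw [h.far hρ hL h0 ⟨hs.1, hs.2.trans ht0.2⟩ hx]
      have := mul_le_mul_of_nonneg_right hc hs.1
      have := mul_nonneg hη.le hs.1
      linarith
    set K : Set (ℝ × ℝ) := Icc 0 t0 ×ˢ Icc (-(L * t0)) 0 with hK
    have hKc : IsCompact K := isCompact_Icc.prod isCompact_Icc
    have hcont : ContinuousOn (fun z : ℝ × ℝ => V z.1 z.2 - ρL * z.2 + c * z.1 - C + η * z.1) K := by
      have hsub : K ⊆ Icc 0 T ×ˢ univ := fun z hz => ⟨⟨hz.1.1, hz.1.2.trans ht0.2⟩, mem_univ _⟩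
      have := (h.contT hR hM).mono hsub
      fun_prop
    obtain ⟨z, hz, hmin⟩ := hKc.exists_isMinOn
      ⟨(0, 0), ⟨le_rfl, ht0.1⟩, by simpa using mul_nonneg hL.le ht0.1, le_rfl⟩ hcont
    obtain ⟨s, x⟩ := z
    have hpos : 0 ≤ V s x - ρL * x + c * s - C + η * s := by
      by_contra hneg
      push Not at hneg
      have hx1 : -(L * s) < x := by
        by_contra hh; push Not at hh
        linarith [hfar s hz.1 x hh]
      have hs0 : 0 < s := by
        rcases hz.1.1.eq_or_lt with hh | hh
        · simp only at hh; subst hh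
          have := hz.2.2
          simp at this hx1; linarith
        · exact hh
      have hx0 : x < 0 := by
        rcases hz.2.2.eq_or_lt with hh | hh
        · simp only at hh; subst hh
          have := hI s hz.1
          have := mul_pos hη hs0
          simp at hneg; linarith
        · exact hh
      set r := -x / L with hr
      have hLr : L * r = -x := by rw [hr]; field_simp
      have hr0 : 0 < r := by apply div_pos <;> linarith
      have hrs : r ≤ s := by nlinarith
      have := h.coneDn s r x ρL (V s x - ρL * x + c * s + η * s - (c + η) * (s - r))
        (by linarith) hr0 (hz.1.2.trans ht0.2) (by rw [hLr, abs_of_neg hx0]) hρ (by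
          intro y hy
          have hy0 : y ≤ 0 := by have := (abs_le.1 hy).2; linarith
          have hsr : s - r ∈ Icc 0 t0 := ⟨by linarith, by linarith [hz.1.2]⟩
          rcases le_total y (-(L * t0)) with hh | hh
          · have := hfar (s - r) hsr y (by nlinarith [hsr.2])
            linarith
          · have := hmin (⟨hsr, hh, hy0⟩ : ((s - r, y) : ℝ × ℝ) ∈ K)
            simp only [mem_ofPred_eq] at this
            linarith)
      nlinarith
    intro s' hs' x' hx'
    rcases le_total x' (-(L * t0)) with hh | hh
    · exact hfar s' hs' x' (by nlinarith [hs'.2])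
    · have := hmin (⟨hs', hh, hx'⟩ : ((s', x') : ℝ × ℝ) ∈ K)
      simp only [mem_ofPred_eq] at this
      linarith
  intro s hs x hx
  by_contra hneg
  push Not at hneg
  have hη : 0 < (V t0 0 + c * (t0 - s) + ρL * x - V s x) / (s + 1) := by
    apply div_pos <;> linarith [hs.1]
  have := key _ hη s hs x hx
  have h3 : (V t0 0 + c * (t0 - s) + ρL * x - V s x) / (s + 1) * s < V t0 0 + c * (t0 - s) + ρL * x - V s x := by
    rw [div_mul_eq_mul_div, div_lt_iff₀ (by linarith [hs.1])]
    nlinarith [hs.1]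
  linarith

set_option maxHeartbeats 2000000 in
lemma HJ.comp_left {R M L T : ℝ} {f : ℝ → ℝ} {V W : ℝ → ℝ → ℝ} (h : HJ R M L f T V)
    (h' : HJ R M L f T W)
    (hR : 0 ≤ R) (hM : 0 ≤ M) (hL : 0 < L) {ρL : ℝ} (hρ : ρL ∈ Icc 0 R)
    (h0 : ∀ x ≤ 0, V 0 x = ρL * x) (h0' : ∀ x ≤ 0, W 0 x = ρL * x)
    (hI : ∀ t ∈ Icc 0 T, V t 0 = W t 0) :
    ∀ t ∈ Icc 0 T, ∀ x ≤ 0, V t x ≤ W t x := by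
  intro t1 ht1 x1 hx1
  by_contra hneg
  push Not at hneg
  have hT : 0 ≤ T := ht1.1.trans ht1.2
  -- equality on the parabolic boundary
  have hbd : ∀ t ∈ Icc 0 T, ∀ x ≤ 0, (t = 0 ∨ x = 0 ∨ x ≤ -(L * t)) → V t x = W t x := by
    intro t ht x hx hor
    rcases hor with hh | hh | hh
    · subst hh; rw [h0 x hx, h0' x hx]
    · subst hh; exact hI t ht
    · rw [h.far hρ hL h0 ht hh, h'.far hρ hL h0' ht hh]
  set η := (V t1 x1 - W t1 x1) / (2 * (T + 1)) with hη
  have hηpos : 0 < η := by apply div_pos <;> linarith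
  set σ := V t1 x1 - W t1 x1 - η * t1 with hσ
  have hσpos : 0 < σ := by
    have : η * t1 ≤ (V t1 x1 - W t1 x1) / 2 := by
      rw [hη, div_mul_eq_mul_div, div_le_div_iff₀ (by linarith) (by norm_num)]
      nlinarith [ht1.2]
    rw [hσ]; linarith
  set A := L * T + 1 - x1 with hA
  set ε := σ / (M ^ 2 + R ^ 2 + 1) with hε
  have hεpos : 0 < ε := by positivity
  have hεσ : (M ^ 2 + R ^ 2) * ε < σ := by
    rw [hε, mul_div_assoc', div_lt_iff₀ (by positivity)]
    nlinarith
  -- quadratic estimate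
  have hquad : ∀ a b : ℝ, M * |a| + R * |b| - (a ^ 2 + b ^ 2) / (2 * ε) ≤ (M ^ 2 + R ^ 2) * ε := by
    intro a b
    have e1 : M * |a| - a ^ 2 / (2 * ε) ≤ M ^ 2 * ε := by
      rw [sub_le_iff_le_add, ← sub_le_iff_le_add', le_div_iff₀ (by positivity)]
      nlinarith [sq_nonneg (|a| - M * ε), sq_abs a, mul_pos hεpos hεpos, sq_nonneg (M * ε)]
    have e2 : R * |b| - b ^ 2 / (2 * ε) ≤ R ^ 2 * ε := by
      rw [sub_le_iff_le_add, ← sub_le_iff_le_add', le_div_iff₀ (by positivity)]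
      nlinarith [sq_nonneg (|b| - R * ε), sq_abs b, mul_pos hεpos hεpos, sq_nonneg (R * ε)]
    rw [add_div]; linarith
  set K : Set (ℝ × ℝ) := Icc 0 T ×ˢ Icc (-A) 0 with hK
  have hKc : IsCompact (K ×ˢ K) := (isCompact_Icc.prod isCompact_Icc).prod (isCompact_Icc.prod isCompact_Icc)
  have hsub : K ⊆ Icc 0 T ×ˢ univ := fun z hz => ⟨hz.1, mem_univ _⟩
  set Φ : (ℝ × ℝ) × (ℝ × ℝ) → ℝ := fun z => V z.1.1 z.1.2 - W z.2.1 z.2.2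
    - ((z.1.1 - z.2.1) ^ 2 + (z.1.2 - z.2.2) ^ 2) / (2 * ε) - η * z.1.1 with hΦ
  have hcont : ContinuousOn Φ (K ×ˢ K) := by
    have c1 : ContinuousOn (fun z : (ℝ × ℝ) × (ℝ × ℝ) => V z.1.1 z.1.2) (K ×ˢ K) :=
      ((h.contT hR hM).mono hsub).comp (f := Prod.fst) (by fun_prop) (fun z hz => hz.1)
    have c2 : ContinuousOn (fun z : (ℝ × ℝ) × (ℝ × ℝ) => W z.2.1 z.2.2) (K ×ˢ K) :=
      ((h'.contT hR hM).mono hsub).comp (f := Prod.snd) (by fun_prop) (fun z hz => hz.2)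
    apply ContinuousOn.sub (ContinuousOn.sub (c1.sub c2) (by fun_prop)) (by fun_prop)
  have hLT : 0 ≤ L * T := mul_nonneg hL.le hT
  have hz1 : ((t1, x1) : ℝ × ℝ) ∈ K := ⟨ht1, by simp only [mem_Icc]; constructor <;> linarith⟩
  obtain ⟨⟨⟨t, x⟩, ⟨s, y⟩⟩, hz, hmax⟩ := hKc.exists_isMaxOn ⟨((t1, x1), (t1, x1)), hz1, hz1⟩ hcont
  have hmax' : ∀ a b a' b', a ∈ Icc 0 T → b ∈ Icc (-A) 0 → a' ∈ Icc 0 T → b' ∈ Icc (-A) 0 →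
      V a b - W a' b' - ((a - a') ^ 2 + (b - b') ^ 2) / (2 * ε) - η * a ≤
      V t x - W s y - ((t - s) ^ 2 + (x - y) ^ 2) / (2 * ε) - η * t := by
    intro a b a' b' ha hb ha' hb'
    exact hmax (show ((a, b), (a', b')) ∈ K ×ˢ K from ⟨⟨ha, hb⟩, ⟨ha', hb'⟩⟩)
  have ht : t ∈ Icc 0 T := hz.1.1
  have hx : x ∈ Icc (-A) 0 := hz.1.2
  have hs : s ∈ Icc 0 T := hz.2.1
  have hy : y ∈ Icc (-A) 0 := hz.2.2
  have hσle : σ ≤ V t x - W s y - ((t - s) ^ 2 + (x - y) ^ 2) / (2 * ε) - η * t := by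
    have := hmax' t1 x1 t1 x1 ht1 hz1.2 ht1 hz1.2
    simpa [hσ] using this
  have hηt : 0 ≤ η * t := mul_nonneg hηpos.le ht.1
  have hin1 : ¬ (t = 0 ∨ x = 0 ∨ x ≤ -(L * t)) := by
    intro hh
    have e := hbd t ht x hx.2 hh
    have := (abs_le.1 (h'.cont hR hM hs ht x y)).2
    have := hquad (t - s) (x - y)
    linarith
  have hin2 : ¬ (s = 0 ∨ y = 0 ∨ y ≤ -(L * s)) := by
    intro hh
    have e := hbd s hs y hy.2 hh
    have := (abs_le.1 (h.cont hR hM hs ht x y)).2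
    have := hquad (t - s) (x - y)
    linarith
  push Not at hin1 hin2
  have htp : 0 < t := lt_of_le_of_ne ht.1 (Ne.symm hin1.1)
  have hxn : x < 0 := lt_of_le_of_ne hx.2 hin1.2.1
  have hsp : 0 < s := lt_of_le_of_ne hs.1 (Ne.symm hin2.1)
  have hyn : y < 0 := lt_of_le_of_ne hy.2 hin2.2.1
  have hAT : L * T + 1 ≤ A := by rw [hA]; linarith
  have hxA : -A + 1 ≤ x := by nlinarith [hin1.2.2, ht.2]
  have hyA : -A + 1 ≤ y := by nlinarith [hin2.2.2, hs.2]
  set p := (x - y) / ε with hp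
  set b := (t - s) / ε with hb
  have hpe : p * ε = x - y := by rw [hp]; field_simp
  have hbe : b * ε = t - s := by rw [hb]; field_simp
  -- expansion of the penalization
  have hexp1 : ∀ a c : ℝ, ((t + a - s) ^ 2 + (x + c - y) ^ 2) / (2 * ε) =
      ((t - s) ^ 2 + (x - y) ^ 2) / (2 * ε) + b * a + p * c + (a ^ 2 + c ^ 2) / (2 * ε) := by
    intro a c; rw [hp, hb]; field_simp; ring
  have hexp2 : ∀ a c : ℝ, ((t - (s + a)) ^ 2 + (x - (y + c)) ^ 2) / (2 * ε) =
      ((t - s) ^ 2 + (x - y) ^ 2) / (2 * ε) - b * a - p * c + (a ^ 2 + c ^ 2) / (2 * ε) := by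
    intro a c; rw [hp, hb]; field_simp; ring
  have hV : ∀ a c, t + a ∈ Icc 0 T → x + c ∈ Icc (-A) 0 →
      V (t + a) (x + c) ≤ V t x + b * a + p * c + (a ^ 2 + c ^ 2) / (2 * ε) + η * a := by
    intro a c ha hc
    have := hmax' (t + a) (x + c) s y ha hc hs hy
    rw [hexp1] at this
    linarith
  have hW : ∀ a c, s + a ∈ Icc 0 T → y + c ∈ Icc (-A) 0 →
      W s y + b * a + p * c - (a ^ 2 + c ^ 2) / (2 * ε) ≤ W (s + a) (y + c) := by
    intro a c ha hc
    have := hmax' t x (s + a) (y + c) ht hx ha hc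
    rw [hexp2] at this
    linarith
  -- a limiting principle
  have hlim : ∀ (u C r0 : ℝ), 0 < r0 → (∀ r, 0 < r → r ≤ r0 → u * r ≤ C * r ^ 2) → u ≤ 0 := by
    intro u C r0 hr0 hu
    by_contra hpos
    push Not at hpos
    have hC : 0 < |C| + 1 := by positivity
    have hr1 : 0 < min r0 (u / (2 * (|C| + 1))) := lt_min hr0 (by positivity)
    have := hu _ hr1 (min_le_left _ _)
    set r := min r0 (u / (2 * (|C| + 1)))
    have hr2 : r * (2 * (|C| + 1)) ≤ u := by
      rw [← le_div_iff₀ (by positivity)]; exact min_le_right _ _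
    have : u ≤ C * r := by
      have : u * r ≤ (C * r) * r := by linarith [sq r]
      exact le_of_mul_le_mul_right this hr1
    nlinarith [le_abs_self C]
  have hpR : p ≤ R := by
    have := hlim (p - R) (1 / (2 * ε)) 1 one_pos (by
      intro r hr hr1
      have e1 := hV 0 (-r) (by simpa using ht) ⟨by linarith, by linarith⟩
      have e2 := (h.slope t ht.1 ht.2 (x + -r) x (by linarith)).2
      simp only [add_zero] at e1
      have : (0 ^ 2 + (-r) ^ 2) / (2 * ε) = 1 / (2 * ε) * r ^ 2 := by ring
      rw [this] at e1
      linarith)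
    linarith
  have hp0 : 0 ≤ p := by
    have := hlim (-p) (1 / (2 * ε)) (-x) (by linarith) (by
      intro r hr hr1
      have e1 := hV 0 r (by simpa using ht) ⟨by linarith, by linarith⟩
      have e2 := (h.slope t ht.1 ht.2 x (x + r) (by linarith)).1
      simp only [add_zero] at e1
      have : (0 ^ 2 + (r) ^ 2) / (2 * ε) = 1 / (2 * ε) * r ^ 2 := by ring
      rw [this] at e1
      linarith)
    linarith
  have hbnd : ∀ r c : ℝ, |c| ≤ L * r → ((-r) ^ 2 + c ^ 2) / (2 * ε) ≤ (1 + L ^ 2) / (2 * ε) * r ^ 2 := by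
    intro r c hc
    have : c ^ 2 ≤ (L * r) ^ 2 := by
      rw [← sq_abs c]; exact pow_le_pow_left₀ (abs_nonneg _) hc 2
    rw [div_mul_eq_mul_div]
    apply div_le_div_of_nonneg_right _ (by positivity)
    nlinarith
  have hsubsol : f p + b + η ≤ 0 := by
    apply hlim _ ((1 + L ^ 2) / (2 * ε)) (min t (min (-x / L) (1 / L)))
      (lt_min htp (lt_min (div_pos (by linarith) hL) (by positivity)))
    intro r hr hr1
    have r1 : r ≤ t := hr1.trans (min_le_left _ _)
    have r2 : r * L ≤ -x := by
      rw [← le_div_iff₀ hL]; exact hr1.trans ((min_le_right _ _).trans (min_le_left _ _))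
    have r3 : r * L ≤ 1 := by
      rw [← le_div_iff₀ hL]; exact hr1.trans ((min_le_right _ _).trans (min_le_right _ _))
    have := h.coneUp t r x p (V t x - b * r - p * x - η * r + (1 + L ^ 2) / (2 * ε) * r ^ 2)
      (by linarith) hr ht.2 (by rw [abs_of_neg hxn]; linarith) ⟨hp0, hpR⟩ (by
        intro y' hy'
        have b1 := hbnd r (y' - x) hy'
        rw [abs_le] at hy'
        have := hV (-r) (y' - x) ⟨by linarith, by linarith [ht.2]⟩ ⟨by linarith, by linarith⟩
        rw [← sub_eq_add_neg, show x + (y' - x) = y' by ring] at this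
        linarith)
    linarith
  have hsupsol : -(f p + b) ≤ 0 := by
    apply hlim _ ((1 + L ^ 2) / (2 * ε)) (min s (min (-y / L) (1 / L)))
      (lt_min hsp (lt_min (div_pos (by linarith) hL) (by positivity)))
    intro r hr hr1
    have r1 : r ≤ s := hr1.trans (min_le_left _ _)
    have r2 : r * L ≤ -y := by
      rw [← le_div_iff₀ hL]; exact hr1.trans ((min_le_right _ _).trans (min_le_left _ _))
    have r3 : r * L ≤ 1 := by
      rw [← le_div_iff₀ hL]; exact hr1.trans ((min_le_right _ _).trans (min_le_right _ _))
    have := h'.coneDn s r y p (W s y - b * r - p * y - (1 + L ^ 2) / (2 * ε) * r ^ 2)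
      (by linarith) hr hs.2 (by rw [abs_of_neg hyn]; linarith) ⟨hp0, hpR⟩ (by
        intro y' hy'
        have b1 := hbnd r (y' - y) hy'
        rw [abs_le] at hy'
        have := hW (-r) (y' - y) ⟨by linarith, by linarith [hs.2]⟩ ⟨by linarith, by linarith⟩
        rw [← sub_eq_add_neg, show y + (y' - y) = y' by ring] at this
        linarith)
    linarith
  linarith

/-- Uniqueness of the potential once the interface values agree. -/
lemma HJ.unique {R M L T : ℝ} {f : ℝ → ℝ} {V W : ℝ → ℝ → ℝ} (h : HJ R M L f T V)
    (h' : HJ R M L f T W)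
    (hR : 0 ≤ R) (hM : 0 ≤ M) (hL : 0 < L) {ρL ρR : ℝ} (hρ : ρL ∈ Icc 0 R) (hρ' : ρR ∈ Icc 0 R)
    (h0 : ∀ x ≤ 0, V 0 x = ρL * x) (h0' : ∀ x ≤ 0, W 0 x = ρL * x)
    (h1 : ∀ x, 0 ≤ x → V 0 x = ρR * x) (h1' : ∀ x, 0 ≤ x → W 0 x = ρR * x)
    (hI : ∀ t ∈ Icc 0 T, V t 0 = W t 0) :
    ∀ t ∈ Icc 0 T, ∀ x, V t x = W t x := by
  intro t ht x
  rcases le_total x 0 with hx | hx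
  · exact le_antisymm (h.comp_left h' hR hM hL hρ h0 h0' hI t ht x hx)
      (h'.comp_left h hR hM hL hρ h0' h0 (fun t ht => (hI t ht).symm) t ht x hx)
  · have hρ'' : R - ρR ∈ Icc 0 R := ⟨by linarith [hρ'.2], by linarith [hρ'.1]⟩
    have i1 : ∀ x ≤ 0, V 0 (-x) + R * x = (R - ρR) * x := fun x hx => by
      rw [h1 (-x) (by linarith)]; ring
    have i2 : ∀ x ≤ 0, W 0 (-x) + R * x = (R - ρR) * x := fun x hx => by
      rw [h1' (-x) (by linarith)]; ring
    have i3 : ∀ t ∈ Icc 0 T, V t (-0) + R * 0 = W t (-0) + R * 0 := fun t ht => by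
      simp [hI t ht]
    have := h.refl.comp_left h'.refl hR hM hL hρ'' i1 i2 i3 t ht (-x) (by linarith)
    have := h'.refl.comp_left h.refl hR hM hL hρ'' i2 i1 (fun t ht => (i3 t ht).symm) t ht (-x) (by linarith)
    simp only [neg_neg] at *
    linarith

end

section

/-- The mollifying bump. -/
def bmp (n : ℕ) : ContDiffBump (0 : ℝ × ℝ) where
  rIn := 1 / (n + 1) / 2
  rOut := 1 / (n + 1)
  rIn_pos := by positivity
  rIn_lt_rOut := by
    have : (0:ℝ) < 1 / (n + 1) := by positivity
    linarith

def eta (n : ℕ) : ℝ × ℝ → ℝ := (bmp n).normed volume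

def mo (n : ℕ) (g : ℝ × ℝ → ℝ) (z : ℝ × ℝ) : ℝ := ∫ w, g w * eta n (z - w)

lemma eta_contDiff (n : ℕ) : ContDiff ℝ (⊤ : ℕ∞) (eta n) := (bmp n).contDiff_normed
lemma eta_supp (n : ℕ) : HasCompactSupport (eta n) := (bmp n).hasCompactSupport_normed
lemma eta_nonneg (n : ℕ) (z : ℝ × ℝ) : 0 ≤ eta n z := (bmp n).nonneg_normed z
lemma eta_cont (n : ℕ) : Continuous (eta n) := (eta_contDiff n).continuous
lemma eta_diff (n : ℕ) : Differentiable ℝ (eta n) := (eta_contDiff n).differentiable (by simp)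
lemma eta_zero (n : ℕ) {z : ℝ × ℝ} (h : 1 / ((n:ℝ) + 1) ≤ ‖z‖) : eta n z = 0 := by
  by_contra h0
  have : z ∈ Function.support (eta n) := h0
  unfold eta at this
  rw [ContDiffBump.support_normed_eq] at this
  simp [bmp] at this
  simp at h
  linarith

lemma eta_int (n : ℕ) : ∫ w, eta n w = 1 := (bmp n).integral_normed
lemma eta_int' (n : ℕ) (z : ℝ × ℝ) : ∫ w, eta n (z - w) = 1 := by
  rw [integral_sub_left_eq_self (fun w => eta n w), eta_int]

lemma mo_eq_conv (n : ℕ) (g : ℝ × ℝ → ℝ) :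
    mo n g = (convolution g (eta n) (ContinuousLinearMap.lsmul ℝ ℝ) volume) := by
  ext z; simp [mo, convolution_def]

lemma mo_eq_conv' (n : ℕ) (g : ℝ × ℝ → ℝ) :
    mo n g = (convolution ((bmp n).normed volume) g (ContinuousLinearMap.lsmul ℝ ℝ) volume) := by
  ext z; rw [convolution_eq_swap]; simp only [mo, ContinuousLinearMap.lsmul_apply, smul_eq_mul, eta, mul_comm]

lemma mo_contDiff (n : ℕ) {g : ℝ × ℝ → ℝ} (hg : LocallyIntegrable g) :
    ContDiff ℝ (⊤ : ℕ∞) (mo n g) := by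
  rw [mo_eq_conv]
  exact (eta_supp n).contDiff_convolution_right _ hg (eta_contDiff n)

lemma mo_fderiv (n : ℕ) {g : ℝ × ℝ → ℝ} (hg : LocallyIntegrable g) (z v : ℝ × ℝ) :
    fderiv ℝ (mo n g) z v = ∫ w, g w * fderiv ℝ (eta n) (z - w) v := by
  have h1 := (eta_supp n).hasFDerivAt_convolution_right (ContinuousLinearMap.lsmul ℝ ℝ) hg
    ((eta_contDiff n).of_le (by simp)) z
  rw [mo_eq_conv, h1.fderiv, convolution_precompR_apply _ hg]
  · simp [convolution_def]
  · exact (eta_supp n).fderiv ℝ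
  · exact (eta_contDiff n).continuous_fderiv (by simp)

lemma mo_ae {g : ℝ × ℝ → ℝ} (hg : LocallyIntegrable g) :
    ∀ᵐ z, Tendsto (fun n => mo n g z) atTop (nhds (g z)) := by
  simp_rw [mo_eq_conv']
  apply ContDiffBump.ae_convolution_tendsto_right_of_locallyIntegrable (K := 2) _ _ hg
  · simp only [bmp]
    exact tendsto_one_div_add_atTop_nhds_zero_nat
  · filter_upwards with n
    simp [bmp]; field_simp; rfl

lemma mo_close (n : ℕ) {g : ℝ × ℝ → ℝ} (hg : Measurable g) {z : ℝ × ℝ} {ε : ℝ}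
    (h : ∀ w, ‖w - z‖ < 1 / ((n:ℝ) + 1) → |g w - g z| ≤ ε) : |mo n g z - g z| ≤ ε := by
  rw [mo_eq_conv', ← Real.dist_eq]
  apply ContDiffBump.dist_normed_convolution_le hg.aestronglyMeasurable
  intro x hx
  rw [Real.dist_eq]
  exact h x (by simpa [bmp, dist_eq_norm] using hx)

lemma mo_integrable (n : ℕ) {g : ℝ × ℝ → ℝ} (hg : Measurable g) {C : ℝ} (hC : ∀ z, |g z| ≤ C)
    (z : ℝ × ℝ) : Integrable (fun w => g w * eta n (z - w)) := by
  apply Integrable.bdd_mul (c := C)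
  · have : Integrable (eta n) := (eta_cont n).integrable_of_hasCompactSupport (eta_supp n)
    exact this.comp_sub_left z
  · exact hg.aestronglyMeasurable
  · filter_upwards with w; exact hC w

lemma mo_le (n : ℕ) {g : ℝ × ℝ → ℝ} (hg : Measurable g) {C b : ℝ} (hC : ∀ z, |g z| ≤ C)
    (hb : ∀ w, g w ≤ b) (z : ℝ × ℝ) : mo n g z ≤ b := by
  have h1 : mo n g z ≤ ∫ w, b * eta n (z - w) := by
    apply integral_mono (mo_integrable n hg hC z)
    · have : Integrable (eta n) := (eta_cont n).integrable_of_hasCompactSupport (eta_supp n)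
      exact (this.comp_sub_left z).const_mul b
    · intro w
      exact mul_le_mul_of_nonneg_right (hb w) (eta_nonneg _ _)
  rwa [integral_const_mul, eta_int', mul_one] at h1

lemma mo_neg (n : ℕ) (g : ℝ × ℝ → ℝ) (z : ℝ × ℝ) : mo n (fun w => - g w) z = - mo n g z := by
  simp [mo, integral_neg]

lemma mo_ge (n : ℕ) {g : ℝ × ℝ → ℝ} (hg : Measurable g) {C b : ℝ} (hC : ∀ z, |g z| ≤ C)
    (hb : ∀ w, b ≤ g w) (z : ℝ × ℝ) : b ≤ mo n g z := by
  have := mo_le n hg.neg (C := C) (b := -b) (by simpa using hC) (by intro w; simpa using hb w) z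
  have h2 := mo_neg n g z
  simp only [Pi.neg_def] at this
  linarith

lemma loc_int_of_bdd {g : ℝ × ℝ → ℝ} (hg : Measurable g) {C : ℝ} (hC : ∀ z, |g z| ≤ C) :
    LocallyIntegrable g := by
  rw [locallyIntegrable_iff]
  intro k hk
  exact Measure.integrableOn_of_bounded hk.measure_lt_top.ne hg.aestronglyMeasurable (M := C)
    (by filter_upwards with z; exact hC z)

lemma integrable_of_bdd_supp {ψ : ℝ × ℝ → ℝ} (hm : Measurable ψ) {C : ℝ} (hC : ∀ z, |ψ z| ≤ C)
    {K : Set (ℝ × ℝ)} (hK : IsCompact K) (h0 : ∀ z, z ∉ K → ψ z = 0) : Integrable ψ := by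
  have h1 : IntegrableOn ψ K := Measure.integrableOn_of_bounded hK.measure_lt_top.ne hm.aestronglyMeasurable (M := C)
    (by filter_upwards with z; exact hC z)
  apply (integrableOn_iff_integrable_of_support_subset _).1 h1
  intro z hz
  by_contra h; exact hz (h0 z h)

lemma measurable_pdT (φ : ℝ × ℝ → ℝ) : Measurable (pdT φ) := measurable_fderiv_apply_const ℝ φ _
lemma measurable_pdX (φ : ℝ × ℝ → ℝ) : Measurable (pdX φ) := measurable_fderiv_apply_const ℝ φ _

lemma abs_pdT_le {φ : ℝ × ℝ → ℝ} {C : NNReal} (h : LipschitzWith C φ) (z) : |pdT φ z| ≤ C := by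
  have h1 := norm_fderiv_le_of_lipschitz ℝ h (x₀ := z)
  have h2 := (fderiv ℝ φ z).le_opNorm (1, 0)
  simp only [pdT, Real.norm_eq_abs] at *
  simp [Prod.norm_def] at h2
  linarith
lemma abs_pdX_le {φ : ℝ × ℝ → ℝ} {C : NNReal} (h : LipschitzWith C φ) (z) : |pdX φ z| ≤ C := by
  have h1 := norm_fderiv_le_of_lipschitz ℝ h (x₀ := z)
  have h2 := (fderiv ℝ φ z).le_opNorm (0, 1)
  simp only [pdX, Real.norm_eq_abs] at *
  simp [Prod.norm_def] at h2
  linarith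

lemma mo_lip_fderiv (n : ℕ) {φ : ℝ × ℝ → ℝ} {C : NNReal} (h : LipschitzWith C φ) (z v : ℝ × ℝ) :
    fderiv ℝ (mo n φ) z v = mo n (fun w => lineDeriv ℝ φ w v) z := by
  rw [mo_fderiv n h.continuous.locallyIntegrable, mo]
  have hsub : HasCompactSupport (fun w => eta n (z - w)) :=
    (eta_supp n).comp_homeomorph (Homeomorph.subLeft z)
  have hcd : ContDiff ℝ (⊤ : ℕ∞) (fun w => eta n (z - w)) :=
    (eta_contDiff n).comp (contDiff_const.sub contDiff_id)
  obtain ⟨D, hD⟩ := ContDiff.lipschitzWith_of_hasCompactSupport hsub hcd (by simp)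
  rw [h.integral_lineDeriv_mul_eq hD hsub v]
  congr 1; ext w
  rw [((hcd.differentiable (by simp)) w).lineDeriv_eq_fderiv, mul_comm]
  congr 1
  have : HasFDerivAt (fun w => eta n (z - w)) ((fderiv ℝ (eta n) (z - w)).comp (-(ContinuousLinearMap.id ℝ (ℝ × ℝ)))) w := by
    apply HasFDerivAt.comp
    · exact (eta_diff n _).hasFDerivAt
    · exact (hasFDerivAt_id w).const_sub z
  rw [this.fderiv]; simp

lemma ae_pd_eq {φ : ℝ × ℝ → ℝ} {C : NNReal} (h : LipschitzWith C φ) :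
    ∀ᵐ z, lineDeriv ℝ φ z (1, 0) = pdT φ z ∧ lineDeriv ℝ φ z (0, 1) = pdX φ z := by
  filter_upwards [h.ae_differentiableAt (μ := volume)] with z hz
  exact ⟨hz.lineDeriv_eq_fderiv, hz.lineDeriv_eq_fderiv⟩

lemma mo_congr {g g' : ℝ × ℝ → ℝ} (n : ℕ) (h : g =ᵐ[volume] g') (z : ℝ × ℝ) : mo n g z = mo n g' z := by
  apply integral_congr_ae
  filter_upwards [h] with w hw; rw [hw]

lemma mo_pdT (n : ℕ) {φ : ℝ × ℝ → ℝ} {C : NNReal} (h : LipschitzWith C φ) (z : ℝ × ℝ) :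
    pdT (mo n φ) z = mo n (pdT φ) z := by
  rw [pdT, mo_lip_fderiv n h]
  exact mo_congr n ((ae_pd_eq h).mono fun w hw => hw.1) z
lemma mo_pdX (n : ℕ) {φ : ℝ × ℝ → ℝ} {C : NNReal} (h : LipschitzWith C φ) (z : ℝ × ℝ) :
    pdX (mo n φ) z = mo n (pdX φ) z := by
  rw [pdX, mo_lip_fderiv n h]
  exact mo_congr n ((ae_pd_eq h).mono fun w hw => hw.2) z

lemma mo_zero (n : ℕ) {g : ℝ × ℝ → ℝ} {z : ℝ × ℝ}
    (h : ∀ w, ‖z - w‖ < 1 / ((n:ℝ) + 1) → g w = 0) : mo n g z = 0 := by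
  rw [mo]
  convert integral_zero (ℝ × ℝ) ℝ using 2 with w
  ext w
  by_cases hw : ‖z - w‖ < 1 / ((n:ℝ) + 1)
  · rw [h w hw, zero_mul]
  · rw [eta_zero n (not_lt.1 hw), mul_zero]

end

section

lemma measurable_sign : Measurable Real.sign := by
  unfold Real.sign
  exact Measurable.ite measurableSet_Iio measurable_const
    (Measurable.ite measurableSet_Ioi measurable_const measurable_const)

lemma abs_sign_le (x : ℝ) : |Real.sign x| ≤ 1 := by
  rcases Real.sign_apply_eq x with h | h | h <;> rw [h] <;> simp

lemma measurable_comp_f {R : ℝ} {f : ℝ → ℝ} (hf : ContinuousOn f (Icc 0 R)) (hR : 0 ≤ R)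
    {α : Type*} [MeasurableSpace α] {r : α → ℝ} (hr : Measurable r) (hm : ∀ z, r z ∈ Icc 0 R) :
    Measurable (fun z => f (r z)) := by
  have h1 : Continuous (IccExtend hR (domRestrict (Icc 0 R) f)) :=
    (continuousOn_iff_continuous_domRestrict.1 hf).Icc_extend'
  have : (fun z => f (r z)) = fun z => IccExtend hR (domRestrict (Icc 0 R) f) (r z) := by
    ext z; rw [IccExtend_of_mem _ _ (hm z)]; rfl
  rw [this]; exact h1.measurable.comp hr

lemma AF.contOn {R ρb : ℝ} {f : ℝ → ℝ} (h : AF R ρb f) : ContinuousOn f (Icc 0 R) := by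
  obtain ⟨_, ⟨L, hL⟩, _⟩ := h
  exact hL.continuousOn

/-- entropy density -/
def eD (r : ℝ × ℝ → ℝ) (k : ℝ) (z : ℝ × ℝ) : ℝ := |r z - k|
/-- entropy flux (zero for nonpositive times) -/
def eF (f : ℝ → ℝ) (r : ℝ × ℝ → ℝ) (k : ℝ) (z : ℝ × ℝ) : ℝ :=
  if 0 < z.1 then Real.sign (r z - k) * (f (r z) - f k) else 0
/-- flux (zero for nonpositive times) -/
def fl (f : ℝ → ℝ) (r : ℝ × ℝ → ℝ) (z : ℝ × ℝ) : ℝ := if 0 < z.1 then f (r z) else 0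

structure Sol (R ρb : ℝ) (f : ℝ → ℝ) (c T ρL ρR : ℝ) (r : ℝ × ℝ → ℝ) : Prop where
  meas : Measurable r
  mem : ∀ z, r z ∈ Icc 0 R
  ini : ∀ z, z.1 ≤ 0 → r z = riem ρL ρR z.2
  ent : ∀ (φ : ℝ × ℝ → ℝ) (C : NNReal), LipschitzWith C φ → HasCompactSupport φ → (∀ z, 0 ≤ φ z) →
    tsupport φ ⊆ Iio T ×ˢ univ → ∀ k ∈ Icc 0 R,
    0 ≤ (∫ z, (eD r k z * pdT φ z + eF f r k z * pdX φ z)) +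
      2 * ((1 - c / f ρb) * f k * ∫ t in Ioi 0, φ (t, 0))

lemma measurable_eD {r : ℝ × ℝ → ℝ} (hr : Measurable r) (k : ℝ) : Measurable (eD r k) := by
  unfold eD; fun_prop

lemma measurable_eF {R ρb : ℝ} {f : ℝ → ℝ} (hF : AF R ρb f) {r : ℝ × ℝ → ℝ} (hr : Measurable r)
    (hm : ∀ z, r z ∈ Icc 0 R) (k : ℝ) : Measurable (eF f r k) := by
  unfold eF
  refine Measurable.ite (measurableSet_lt measurable_const measurable_fst) ?_ measurable_const
  have h1 := measurable_comp_f hF.contOn hF.1.le hr hm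
  have h2 : Measurable fun z => Real.sign (r z - k) := measurable_sign.comp (hr.sub_const k)
  exact h2.mul (h1.sub_const _)

lemma measurable_fl {R ρb : ℝ} {f : ℝ → ℝ} (hF : AF R ρb f) {r : ℝ × ℝ → ℝ} (hr : Measurable r)
    (hm : ∀ z, r z ∈ Icc 0 R) : Measurable (fl f r) := by
  unfold fl
  exact Measurable.ite (measurableSet_lt measurable_const measurable_fst)
    (measurable_comp_f hF.contOn hF.1.le hr hm) measurable_const

lemma eD_le {R : ℝ} {r : ℝ × ℝ → ℝ} (hm : ∀ z, r z ∈ Icc 0 R) {k : ℝ} (hk : k ∈ Icc 0 R) (z) :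
    |eD r k z| ≤ R := by
  unfold eD; rw [abs_abs, abs_le]; have := hm z; simp only [mem_Icc] at *; constructor <;> linarith

lemma fl_le {R ρb : ℝ} {f : ℝ → ℝ} (hF : AF R ρb f) {r : ℝ × ℝ → ℝ}
    (hm : ∀ z, r z ∈ Icc 0 R) (z) : |fl f r z| ≤ f ρb := by
  have hb : ρb ∈ Icc 0 R := Ioo_subset_Icc_self hF.2.2.2.2.2.1
  have h3 := hF.2.2.1
  unfold fl; split_ifs
  · rw [abs_of_nonneg (h3 _ (hm z))]; exact hF.le_max (hm z)
  · simpa using h3 _ hb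

lemma eF_le {R ρb : ℝ} {f : ℝ → ℝ} (hF : AF R ρb f) {r : ℝ × ℝ → ℝ}
    (hm : ∀ z, r z ∈ Icc 0 R) {k : ℝ} (hk : k ∈ Icc 0 R) (z) : |eF f r k z| ≤ f ρb := by
  have hb : ρb ∈ Icc 0 R := Ioo_subset_Icc_self hF.2.2.2.2.2.1
  have h3 := hF.2.2.1
  unfold eF; split_ifs
  · rw [abs_mul]
    have h1 := abs_sign_le (r z - k)
    have h2 : |f (r z) - f k| ≤ f ρb := by
      have a1 := hF.le_max (hm z)
      have a2 := hF.le_max hk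
      have a3 := h3 _ (hm z)
      have a4 := h3 _ hk
      rw [abs_le]; constructor <;> linarith
    calc _ ≤ 1 * f ρb := mul_le_mul h1 h2 (abs_nonneg _) zero_le_one
      _ = _ := one_mul _
  · simpa using h3 _ hb

lemma lip_of_test {φ : ℝ × ℝ → ℝ} (h : TestFn φ) : ∃ C : NNReal, LipschitzWith C φ :=
  ContDiff.lipschitzWith_of_hasCompactSupport h.2 h.1 (by simp)

lemma pd_zero {φ : ℝ × ℝ → ℝ} {z} (h : z ∉ tsupport φ) : pdT φ z = 0 ∧ pdX φ z = 0 := by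
  have : fderiv ℝ φ z = 0 := by
    by_contra h0
    exact h (support_fderiv_subset ℝ h0)
  simp [pdT, pdX, this]

lemma int_pd {φ : ℝ × ℝ → ℝ} {C : NNReal} (h : LipschitzWith C φ) (hs : HasCompactSupport φ)
    {g : ℝ × ℝ → ℝ} (hg : Measurable g) {B : ℝ} (hB : ∀ z, |g z| ≤ B) :
    Integrable (fun z => g z * pdT φ z) ∧ Integrable (fun z => g z * pdX φ z) := by
  have hC : (0:ℝ) ≤ C := C.2
  have hB0 : 0 ≤ B := (abs_nonneg _).trans (hB 0)
  constructor
  · apply integrable_of_bdd_supp (hg.mul (measurable_pdT φ)) (C := B * C) _ hs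
    · intro z hz; simp [Pi.mul_apply, (pd_zero hz).1]
    · intro z; rw [Pi.mul_apply, abs_mul]; exact mul_le_mul (hB z) (abs_pdT_le h z) (abs_nonneg _) hB0
  · apply integrable_of_bdd_supp (hg.mul (measurable_pdX φ)) (C := B * C) _ hs
    · intro z hz; simp [Pi.mul_apply, (pd_zero hz).2]
    · intro z; rw [Pi.mul_apply, abs_mul]; exact mul_le_mul (hB z) (abs_pdX_le h z) (abs_nonneg _) hB0

/-- slices of a test function -/
lemma slice_hasDerivAt {φ : ℝ × ℝ → ℝ} (h : Differentiable ℝ φ) (t x : ℝ) :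
    HasDerivAt (fun s => φ (s, x)) (pdT φ (t, x)) t := by
  have h1 : HasDerivAt (fun s : ℝ => (s, x)) ((1:ℝ), (0:ℝ)) t :=
    (hasDerivAt_id t).prodMk (hasDerivAt_const t x)
  exact (h (t, x)).hasFDerivAt.comp_hasDerivAt t h1

lemma slice_hasDerivAtX {φ : ℝ × ℝ → ℝ} (h : Differentiable ℝ φ) (t x : ℝ) :
    HasDerivAt (fun y => φ (t, y)) (pdX φ (t, x)) x := by
  have h1 : HasDerivAt (fun y : ℝ => (t, y)) ((0:ℝ), (1:ℝ)) x :=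
    (hasDerivAt_const x t).prodMk (hasDerivAt_id x)
  exact (h (t, x)).hasFDerivAt.comp_hasDerivAt x h1

lemma slice_supp {φ : ℝ × ℝ → ℝ} (h : HasCompactSupport φ) (x : ℝ) :
    HasCompactSupport (fun s => φ (s, x)) := by
  apply HasCompactSupport.intro (h.isCompact.image continuous_fst)
  intro s hs
  by_contra h0
  exact hs ⟨(s, x), subset_tsupport _ h0, rfl⟩

lemma slice_suppX {φ : ℝ × ℝ → ℝ} (h : HasCompactSupport φ) (t : ℝ) :
    HasCompactSupport (fun x => φ (t, x)) := by
  apply HasCompactSupport.intro (h.isCompact.image continuous_snd)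
  intro s hs
  by_contra h0
  exact hs ⟨(t, s), subset_tsupport _ h0, rfl⟩

lemma slice_int {φ : ℝ × ℝ → ℝ} (h : TestFn φ) (x : ℝ) :
    ∫ t in Iic 0, pdT φ (t, x) = φ (0, x) := by
  have hd : Differentiable ℝ φ := h.1.differentiable (by simp)
  have h1 : (fun t => pdT φ (t, x)) = deriv (fun s => φ (s, x)) := by
    ext t; exact (slice_hasDerivAt hd t x).deriv.symm
  rw [h1]
  apply HasCompactSupport.integral_Iic_deriv_eq _ (slice_supp h.2 x)
  exact (h.1.comp (contDiff_id.prodMk contDiff_const)).of_le (by simp)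

lemma int_t0 {φ : ℝ × ℝ → ℝ} (hc : Continuous φ) (h : HasCompactSupport φ) :
    IntegrableOn (fun t => φ (t, 0)) (Ioi 0) :=
  ((hc.comp (by fun_prop : Continuous fun t : ℝ => (t, (0:ℝ)))).integrable_of_hasCompactSupport
    (slice_supp h 0)).integrableOn

/-- past part -/
lemma past_int {φ : ℝ × ℝ → ℝ} (h : TestFn φ) {u : ℝ → ℝ} (hu : Measurable u) {B : ℝ}
    (hB : ∀ x, |u x| ≤ B) :
    ∫ z in (Ioi 0 ×ˢ univ)ᶜ, u z.2 * pdT φ z = ∫ x, u x * φ (0, x) := by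
  obtain ⟨C, hC⟩ := lip_of_test h
  have hI := (int_pd hC h.2 (g := fun z => u z.2) (hu.comp measurable_snd) (fun z => hB z.2)).1
  have hset : (Ioi (0:ℝ) ×ˢ (univ : Set ℝ))ᶜ = Iic 0 ×ˢ univ := by
    ext z; simp
  rw [hset, Measure.volume_eq_prod, setIntegral_prod]
  · have := integral_integral_swap (μ := volume.restrict (Iic (0:ℝ))) (ν := volume.restrict univ)
      (f := fun t x => u x * pdT φ (t, x)) (by
        rw [Measure.prod_restrict]; exact hI.integrableOn)
    rw [this]
    simp only [Measure.restrict_univ]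
    congr 1; ext x
    rw [integral_const_mul, slice_int h]
  · exact hI.integrableOn

lemma tsupport_mo (n : ℕ) (φ : ℝ × ℝ → ℝ) :
    tsupport (mo n φ) ⊆ Metric.cthickening (1 / ((n:ℝ) + 1)) (tsupport φ) := by
  apply closure_minimal _ Metric.isClosed_cthickening
  intro z hz
  by_contra h
  apply hz
  apply mo_zero
  intro w hw
  by_contra h0
  apply h
  apply Metric.mem_cthickening_of_dist_le z w _ _ (subset_tsupport _ h0)
  rw [dist_eq_norm]; exact hw.le

lemma mo_test (n : ℕ) {φ : ℝ × ℝ → ℝ} (hc : Continuous φ) (hs : HasCompactSupport φ) : TestFn (mo n φ) :=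
  ⟨mo_contDiff n hc.locallyIntegrable,
    (hs.isCompact.cthickening).of_isClosed_subset (isClosed_tsupport _) (tsupport_mo n φ)⟩

lemma lip_loc_int {φ : ℝ × ℝ → ℝ} {C : NNReal} (h : LipschitzWith C φ) :
    LocallyIntegrable (pdT φ) ∧ LocallyIntegrable (pdX φ) :=
  ⟨loc_int_of_bdd (measurable_pdT φ) (abs_pdT_le h), loc_int_of_bdd (measurable_pdX φ) (abs_pdX_le h)⟩

lemma one_div_le_one' (n : ℕ) : 1 / ((n:ℝ) + 1) ≤ 1 := by
  rw [div_le_one (by positivity)]; linarith [(n.cast_nonneg : (0:ℝ) ≤ n)]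

lemma abs_mo_le (n : ℕ) {g : ℝ × ℝ → ℝ} (hg : Measurable g) {C : ℝ} (hC : ∀ z, |g z| ≤ C) (z) :
    |mo n g z| ≤ C := by
  rw [abs_le]
  exact ⟨mo_ge n hg hC (fun w => (abs_le.1 (hC w)).1) z, mo_le n hg hC (fun w => (abs_le.1 (hC w)).2) z⟩

lemma mo_tendsto {φ : ℝ × ℝ → ℝ} {C : NNReal} (h : LipschitzWith C φ) (z) :
    Tendsto (fun n => mo n φ z) atTop (nhds (φ z)) := by
  have hb : ∀ n : ℕ, |mo n φ z - φ z| ≤ C * (1 / ((n:ℝ) + 1)) := by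
    intro n
    apply mo_close n h.continuous.measurable
    intro w hw
    have := h.dist_le_mul w z
    rw [Real.dist_eq, dist_eq_norm] at this
    exact this.trans (mul_le_mul_of_nonneg_left hw.le C.2)
  rw [tendsto_iff_norm_sub_tendsto_zero]
  apply squeeze_zero (fun _ => norm_nonneg _) hb
  have := (tendsto_one_div_add_atTop_nhds_zero_nat (𝕜 := ℝ)).const_mul (C:ℝ)
  simpa using this

lemma mo_int_tendsto {φ : ℝ × ℝ → ℝ} (hm : Measurable φ) {B C : ℝ} (hC : ∀ z, |φ z| ≤ C)
    {K : Set (ℝ × ℝ)} (hK : IsCompact K) (hz : ∀ n z, z ∉ K → mo n φ z = 0)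
    {g : ℝ × ℝ → ℝ} (hg : Measurable g) (hB : ∀ z, |g z| ≤ B) :
    Tendsto (fun n => ∫ z, g z * mo n φ z) atTop (nhds (∫ z, g z * φ z)) := by
  have hB0 : 0 ≤ B := (abs_nonneg _).trans (hB 0)
  have hC0 : 0 ≤ C := (abs_nonneg _).trans (hC 0)
  apply tendsto_integral_of_dominated_convergence (K.indicator (fun _ => B * C))
  · intro n
    exact (hg.aestronglyMeasurable).mul
      (mo_contDiff n (loc_int_of_bdd hm hC)).continuous.aestronglyMeasurable
  · rw [integrable_indicator_iff hK.measurableSet]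
    exact integrableOn_const hK.measure_lt_top.ne
  · intro n
    filter_upwards with z
    by_cases h : z ∈ K
    · rw [indicator_of_mem h, norm_mul]
      exact mul_le_mul (hB z) (abs_mo_le n hm hC z) (abs_nonneg _) hB0
    · rw [indicator_of_notMem h, hz n z h]; simp
  · filter_upwards [mo_ae (loc_int_of_bdd hm hC)] with z hz
    exact hz.const_mul _

lemma ent_lip {g1 g2 : ℝ × ℝ → ℝ} (h1 : Measurable g1) (h2 : Measurable g2) {B K T : ℝ}
    (hB1 : ∀ z, |g1 z| ≤ B) (hB2 : ∀ z, |g2 z| ≤ B)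
    (H : ∀ φ, TestFn φ → (∀ z, 0 ≤ φ z) → tsupport φ ⊆ Iio T ×ˢ univ →
      0 ≤ (∫ z, (g1 z * pdT φ z + g2 z * pdX φ z)) + K * ∫ t in Ioi 0, φ (t, 0))
    {φ : ℝ × ℝ → ℝ} {C : NNReal} (hφ : LipschitzWith C φ) (hs : HasCompactSupport φ)
    (h0 : ∀ z, 0 ≤ φ z) (hT : tsupport φ ⊆ Iio T ×ˢ univ) :
    0 ≤ (∫ z, (g1 z * pdT φ z + g2 z * pdX φ z)) + K * ∫ t in Ioi 0, φ (t, 0) := by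
  obtain ⟨D, hD⟩ : ∃ D, ∀ z, |φ z| ≤ D := hφ.continuous.bounded_above_of_compact_support hs
  have hD0 : 0 ≤ D := (abs_nonneg _).trans (hD 0)
  obtain ⟨δ, hδ, hδ'⟩ := hs.isCompact.exists_cthickening_subset_open (isOpen_Iio.prod isOpen_univ) hT
  set Q := Metric.cthickening 1 (tsupport φ) with hQ
  have hQc : IsCompact Q := hs.isCompact.cthickening
  have hz : ∀ (n : ℕ) z, z ∉ Q → ∀ w, ‖z - w‖ < 1 / ((n:ℝ) + 1) → w ∉ tsupport φ := by
    intro n z hz w hw hw'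
    apply hz
    apply Metric.mem_cthickening_of_dist_le z w _ _ hw'
    rw [dist_eq_norm]; linarith [one_div_le_one' n]
  have e1 : Tendsto (fun n : ℕ => ∫ z, g1 z * pdT (mo n φ) z) atTop (nhds (∫ z, g1 z * pdT φ z)) := by
    simp_rw [mo_pdT _ hφ]
    apply mo_int_tendsto (measurable_pdT φ) (abs_pdT_le hφ) hQc _ h1 hB1
    exact fun n z hzz => mo_zero n fun w hw => (pd_zero (hz n z hzz w hw)).1
  have e2 : Tendsto (fun n : ℕ => ∫ z, g2 z * pdX (mo n φ) z) atTop (nhds (∫ z, g2 z * pdX φ z)) := by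
    simp_rw [mo_pdX _ hφ]
    apply mo_int_tendsto (measurable_pdX φ) (abs_pdX_le hφ) hQc _ h2 hB2
    exact fun n z hzz => mo_zero n fun w hw => (pd_zero (hz n z hzz w hw)).2
  have e3 : Tendsto (fun n : ℕ => ∫ t in Ioi 0, mo n φ (t, 0)) atTop (nhds (∫ t in Ioi 0, φ (t, 0))) := by
    have hIc : IsCompact (Prod.fst '' Q) := hQc.image continuous_fst
    apply tendsto_integral_of_dominated_convergence ((Prod.fst '' Q).indicator (fun _ => D))
    · intro n
      exact (((mo_test n hφ.continuous hs).1.continuous).comp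
        (by fun_prop : Continuous fun t : ℝ => (t, (0:ℝ)))).aestronglyMeasurable
    · apply Integrable.integrableOn
      rw [integrable_indicator_iff hIc.measurableSet]
      exact integrableOn_const hIc.measure_lt_top.ne
    · intro n
      filter_upwards with t
      by_cases h : t ∈ Prod.fst '' Q
      · rw [indicator_of_mem h]
        exact abs_mo_le n hφ.continuous.measurable hD _
      · rw [indicator_of_notMem h, mo_zero]
        · simp
        · intro w hw
          by_contra h0
          exact hz n (t, 0) (fun hq => h ⟨_, hq, rfl⟩) w hw (subset_tsupport _ h0)
    · filter_upwards with t
      exact mo_tendsto hφ _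
  have hsplit : ∀ ψ : ℝ × ℝ → ℝ, ∀ C' : NNReal, LipschitzWith C' ψ → HasCompactSupport ψ →
      ∫ z, (g1 z * pdT ψ z + g2 z * pdX ψ z) = (∫ z, g1 z * pdT ψ z) + ∫ z, g2 z * pdX ψ z :=
    fun ψ C' hψ hsψ => integral_add (int_pd hψ hsψ h1 hB1).1 (int_pd hψ hsψ h2 hB2).2
  rw [hsplit φ C hφ hs]
  apply ge_of_tendsto ((e1.add e2).add (e3.const_mul K))
  have hlim : ∀ᶠ n : ℕ in atTop, 1 / ((n:ℝ) + 1) < δ :=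
    (tendsto_one_div_add_atTop_nhds_zero_nat (𝕜 := ℝ)).eventually (gt_mem_nhds hδ)
  filter_upwards [hlim] with n hn
  have ht := mo_test n hφ.continuous hs
  obtain ⟨C', hC'⟩ := lip_of_test ht
  rw [← hsplit _ C' hC' ht.2]
  apply H _ ht
  · exact fun z => mo_ge n hφ.continuous.measurable hD h0 z
  · exact (tsupport_mo n φ).trans ((Metric.cthickening_mono hn.le _).trans hδ')

/-- extension by the initial datum -/
def extI (ρL ρR : ℝ) (ρ : ℝ → ℝ → ℝ) (z : ℝ × ℝ) : ℝ := if 0 < z.1 then ρ z.1 z.2 else riem ρL ρR z.2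

lemma measurable_riem (ρL ρR : ℝ) : Measurable (riem ρL ρR) := by
  unfold riem
  exact Measurable.ite measurableSet_Iio measurable_const measurable_const

lemma riem_mem {R ρL ρR : ℝ} (hL : ρL ∈ Icc 0 R) (hR : ρR ∈ Icc 0 R) (x) : riem ρL ρR x ∈ Icc 0 R := by
  unfold riem; split_ifs <;> assumption

lemma AF.fpos {R ρb : ℝ} {f : ℝ → ℝ} (hF : AF R ρb f) : 0 < f ρb := by
  have hb := hF.2.2.2.2.2.1
  have := hF.strictMonoOn ⟨le_rfl, hb.1.le⟩ ⟨hb.1.le, le_rfl⟩ hb.1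
  rwa [hF.2.2.2.1] at this

lemma CEIOn.sol {R ρb : ℝ} {f q : ℝ → ℝ} {c T ρL ρR : ℝ} {ρ : ℝ → ℝ → ℝ} {γm γp : ℝ → ℝ}
    (hF : AF R ρb f) (hL : ρL ∈ Icc 0 R) (hR : ρR ∈ Icc 0 R)
    (h : CEIOn R (f ρb) T f q (riem ρL ρR) ρ γm γp)
    (hq : ∀ᵐ t ∂(volume.restrict (Ioo (0:ℝ) T)), c ≤ q t) :
    Sol R ρb f c T ρL ρR (extI ρL ρR ρ) := by
  obtain ⟨⟨hm, hr, -⟩, hqr, hE, -⟩ := h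
  set r := extI ρL ρR ρ with hrdef
  have hrm : Measurable r :=
    Measurable.ite (measurableSet_lt measurable_const measurable_fst) hm
      ((measurable_riem ρL ρR).comp measurable_snd)
  have hmem : ∀ z, r z ∈ Icc 0 R := by
    intro z; rw [hrdef]; unfold extI; split_ifs
    · exact hr _ _
    · exact riem_mem hL hR _
  refine ⟨hrm, hmem, ?_, ?_⟩
  · intro z hz; rw [hrdef]; unfold extI; rw [if_neg (not_lt.2 hz)]
  intro φ C hφ hs h0 hT k hk
  have hfk := hF.2.2.1 k hk
  have hfp := hF.fpos
  have hB1 : ∀ z, |eD r k z| ≤ R + f ρb := fun z => (eD_le hmem hk z).trans (by linarith)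
  have hB2 : ∀ z, |eF f r k z| ≤ R + f ρb := fun z => (eF_le hF hmem hk z).trans (by linarith [hF.1])
  rw [← mul_assoc]
  refine ent_lip (measurable_eD hrm k) (measurable_eF hF hrm hmem k) hB1 hB2 ?_ hφ hs h0 hT
  clear hφ hs h0 hT
  intro φ hφ h0 hT
  have h1 := hE φ hφ h0 hT k hk
  obtain ⟨C', hC'⟩ := lip_of_test hφ
  have i1 := (int_pd hC' hφ.2 (measurable_eD hrm k) hB1).1
  have i2 := (int_pd hC' hφ.2 (measurable_eF hF hrm hmem k) hB2).2
  have hI : Integrable (fun z => eD r k z * pdT φ z + eF f r k z * pdX φ z) := i1.add i2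
  have hS : MeasurableSet (Ioi (0:ℝ) ×ˢ (univ : Set ℝ)) := measurableSet_Ioi.prod MeasurableSet.univ
  have e1 : ∫ z, (eD r k z * pdT φ z + eF f r k z * pdX φ z) =
      (∫ t in Ioi (0:ℝ), ∫ x : ℝ,
          (|ρ t x - k| * pdT φ (t, x) +
            Real.sign (ρ t x - k) * (f (ρ t x) - f k) * pdX φ (t, x))) +
        ∫ x : ℝ, |riem ρL ρR x - k| * φ (0, x) := by
    rw [← integral_add_compl hS hI]
    congr 1
    · rw [Measure.volume_eq_prod, setIntegral_prod]
      · apply setIntegral_congr_fun measurableSet_Ioi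
        intro t ht
        rw [Measure.restrict_univ]
        apply integral_congr_ae
        filter_upwards with x
        simp only [eD, eF, hrdef, extI, if_pos (mem_Ioi.1 ht)]
      · exact hI.integrableOn
    · rw [← past_int hφ (u := fun x => |riem ρL ρR x - k|) (B := R)]
      · apply setIntegral_congr_fun hS.compl
        intro z hz
        have : ¬ 0 < z.1 := by simpa using hz
        simp only [eD, eF, hrdef, extI, if_neg this]; ring
      · exact ((measurable_riem ρL ρR).sub_const k).abs
      · intro x
        have := riem_mem hL hR x
        simp only [mem_Icc] at *
        rw [abs_abs, abs_le]; constructor <;> linarith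
  have hint := int_t0 hφ.1.continuous hφ.2
  have e2 : (∫ t in Ioi (0:ℝ), (1 - q t / f ρb) * f k * φ (t, 0)) ≤
      (1 - c / f ρb) * f k * ∫ t in Ioi 0, φ (t, 0) := by
    rw [← integral_const_mul]
    apply integral_mono_of_nonneg
    · filter_upwards with t
      have := (hqr t).2
      have h2 : q t / f ρb ≤ 1 := by rwa [div_le_one hfp]
      exact mul_nonneg (mul_nonneg (by linarith) hfk) (h0 _)
    · exact hint.const_mul _
    · have hq' := (ae_restrict_iff' measurableSet_Ioo).1 hq
      filter_upwards [ae_restrict_mem measurableSet_Ioi, ae_restrict_of_ae hq'] with t ht hqt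
      by_cases htT : t < T
      · have := hqt ⟨ht, htT⟩
        apply mul_le_mul_of_nonneg_right _ (h0 _)
        apply mul_le_mul_of_nonneg_right _ hfk
        have := div_le_div_of_nonneg_right this hfp.le
        linarith
      · have : φ (t, 0) = 0 := by
          by_contra hne
          exact htT (hT (subset_tsupport _ hne)).1
        simp [this]
  rw [e1]
  linarith

/-- weak equation -/
lemma lip_int_zero {φ : ℝ × ℝ → ℝ} {C : NNReal} (h : LipschitzWith C φ) (hs : HasCompactSupport φ) :
    ∫ z, pdT φ z = 0 ∧ ∫ z, pdX φ z = 0 := by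
  have : ∀ v, ∫ z, lineDeriv ℝ φ z v = 0 := by
    intro v
    have h2 := (LipschitzWith.const (1:ℝ) : LipschitzWith 0 fun _ : ℝ × ℝ => (1:ℝ)).integral_lineDeriv_mul_eq (μ := volume) h hs v
    have h3 : ∀ x, lineDeriv ℝ (fun _ : ℝ × ℝ => (1:ℝ)) x v = 0 := fun x => by simp [lineDeriv]
    simp only [h3, zero_mul, mul_one, integral_zero] at h2
    have h4 : ∀ x, lineDeriv ℝ φ x (-v) = - lineDeriv ℝ φ x v := fun x => lineDeriv_neg
    simp only [h4, integral_neg] at h2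
    linarith
  have h1 := ae_pd_eq h
  constructor
  · rw [← this (1,0)]; exact integral_congr_ae (h1.mono fun z hz => hz.1.symm)
  · rw [← this (0,1)]; exact integral_congr_ae (h1.mono fun z hz => hz.2.symm)

lemma Sol.weak {R ρb : ℝ} {f : ℝ → ℝ} {c T ρL ρR : ℝ} {r : ℝ × ℝ → ℝ} (hF : AF R ρb f)
    (h : Sol R ρb f c T ρL ρR r) {φ : ℝ × ℝ → ℝ} {C : NNReal} (hφ : LipschitzWith C φ)
    (hs : HasCompactSupport φ) (h0 : ∀ z, 0 ≤ φ z) (hT : tsupport φ ⊆ Iio T ×ˢ univ) :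
    ∫ z, (r z * pdT φ z + fl f r z * pdX φ z) = 0 := by
  have hr0 : (0:ℝ) ∈ Icc 0 R := ⟨le_rfl, hF.1.le⟩
  have hrR : R ∈ Icc 0 R := ⟨hF.1.le, le_rfl⟩
  have f0 := hF.2.2.2.1
  have fR := hF.2.2.2.2.1
  have h1 := h.ent φ C hφ hs h0 hT 0 hr0
  have h2 := h.ent φ C hφ hs h0 hT R hrR
  rw [f0] at h1; rw [fR] at h2
  have e1 : ∀ z, eD r 0 z * pdT φ z + eF f r 0 z * pdX φ z = r z * pdT φ z + fl f r z * pdX φ z := by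
    intro z
    have hz := (h.mem z).1
    have a1 : eD r 0 z = r z := by simp [eD, abs_of_nonneg hz]
    have a2 : eF f r 0 z = fl f r z := by
      unfold eF fl; split_ifs
      · rcases hz.lt_or_eq with h' | h'
        · rw [Real.sign_of_pos (by linarith), f0]; ring
        · rw [← h']; simp [f0]
      · rfl
    rw [a1, a2]
  have e2 : ∀ z, eD r R z * pdT φ z + eF f r R z * pdX φ z = R * pdT φ z - (r z * pdT φ z + fl f r z * pdX φ z) := by
    intro z
    have hz := (h.mem z).2
    have a1 : eD r R z = R - r z := by rw [eD, abs_of_nonpos (by linarith)]; ring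
    have a2 : eF f r R z = - fl f r z := by
      unfold eF fl; split_ifs
      · rcases hz.lt_or_eq with h' | h'
        · rw [Real.sign_of_neg (by linarith), fR]; ring
        · rw [h']; simp [fR]
      · simp
    rw [a1, a2]; ring
  have hrb : ∀ z, |r z| ≤ R := fun z => by rw [abs_of_nonneg (h.mem z).1]; exact (h.mem z).2
  have i1 := (int_pd hφ hs h.meas hrb).1
  have i2 := (int_pd hφ hs (measurable_fl hF h.meas h.mem) (fl_le hF h.mem)).2
  have i3 := (int_pd hφ hs (g := fun _ => R) measurable_const (B := |R|) (fun _ => le_rfl)).1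
  simp only [e1] at h1
  simp only [e2] at h2
  have i4 : Integrable (fun z => r z * pdT φ z + fl f r z * pdX φ z) := i1.add i2
  rw [integral_sub i3 i4, integral_const_mul, (lip_int_zero hφ hs).1] at h2
  simp at h1 h2
  linarith
end

section

lemma lip_subseq (u : ℕ → ℝ × ℝ → ℝ) (C : NNReal) (hu : ∀ n, LipschitzWith C (u n)) (h0 : ∀ n, u n 0 = 0) :
    ∃ σ : ℕ → ℕ, StrictMono σ ∧ ∃ V, LipschitzWith C V ∧
      ∀ z, Tendsto (fun n => u (σ n) z) atTop (nhds (V z)) := by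
  have hb : ∀ n z, |u n z| ≤ C * ‖z‖ := by
    intro n z
    have := (hu n).dist_le_mul z 0
    rwa [h0, Real.dist_eq, sub_zero, dist_zero_right] at this
  let e : ℚ × ℚ → ℝ × ℝ := fun q => ((q.1 : ℝ), (q.2 : ℝ))
  have he : DenseRange e := Rat.denseRange_cast.prodMap Rat.denseRange_cast
  let K : Set (ℚ × ℚ → ℝ) := pi univ fun q => Icc (-(C * ‖e q‖)) (C * ‖e q‖)
  have hK : IsCompact K := isCompact_univ_pi fun q => isCompact_Icc
  obtain ⟨a, -, σ, hσ, ha⟩ := hK.tendsto_subseq (x := fun n q => u n (e q)) (by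
    intro n q _; exact abs_le.1 (hb n _))
  rw [tendsto_pi_nhds] at ha
  refine ⟨σ, hσ, ?_⟩
  have hc : ∀ z, ∃ v, Tendsto (fun n => u (σ n) z) atTop (nhds v) := by
    intro z
    apply cauchySeq_tendsto_of_complete
    rw [Metric.cauchySeq_iff']
    intro ε hε
    obtain ⟨_, hy, ⟨q, rfl⟩⟩ := Metric.dense_iff.1 he z (ε / (3 * (C + 1))) (by positivity)
    rw [Metric.mem_ball] at hy
    have hq := (ha q).cauchySeq
    rw [Metric.cauchySeq_iff'] at hq
    obtain ⟨N, hN⟩ := hq (ε/3) (by positivity)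
    refine ⟨N, fun n hn => ?_⟩
    have h1 := hN n hn
    simp only [Function.comp] at h1
    have hd : C * dist (e q) z ≤ ε / 3 := by
      have : (C:ℝ) * dist (e q) z ≤ (C + 1) * (ε / (3 * (C + 1))) :=
        mul_le_mul (by linarith) hy.le dist_nonneg (by positivity)
      have e2 : ((C:ℝ) + 1) * (ε / (3 * (C + 1))) = ε / 3 := by field_simp
      linarith
    have hd0 : 0 < ε / 3 := by positivity
    have h2 := (hu (σ n)).dist_le_mul (e q) z
    have h3 := (hu (σ N)).dist_le_mul (e q) z
    have hlt : ((C:ℝ)) * dist (e q) z < ε / 3 := by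
      have : (C:ℝ) * dist (e q) z ≤ C * (ε / (3 * (C + 1))) :=
        mul_le_mul_of_nonneg_left hy.le C.2
      have e2 : ((C:ℝ) + 1) * (ε / (3 * (C + 1))) = ε / 3 := by field_simp
      have : 0 < ε / (3 * ((C:ℝ) + 1)) := by positivity
      linarith
    calc dist (u (σ n) z) (u (σ N) z) ≤ dist (u (σ n) z) (u (σ n) (e q)) +
        dist (u (σ n) (e q)) (u (σ N) (e q)) + dist (u (σ N) (e q)) (u (σ N) z) := dist_triangle4 _ _ _ _
      _ < ε := by rw [dist_comm (u (σ n) z)]; linarith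
  choose V hV using hc
  refine ⟨V, ?_, hV⟩
  apply LipschitzWith.of_dist_le_mul
  intro x y
  exact le_of_tendsto' ((hV x).dist (hV y)) fun n => (hu (σ n)).dist_le_mul x y

lemma lip_ibp {V φ : ℝ × ℝ → ℝ} {C D : NNReal} (hV : LipschitzWith C V) (hφ : LipschitzWith D φ)
    (hs : HasCompactSupport φ) :
    (∫ z, pdX V z * φ z = - ∫ z, V z * pdX φ z) ∧ (∫ z, pdT V z * φ z = - ∫ z, V z * pdT φ z) := by
  have h1 := ae_pd_eq hV
  have h2 := ae_pd_eq hφ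
  have key : ∀ v, ∫ z, lineDeriv ℝ V z v * φ z = - ∫ z, V z * lineDeriv ℝ φ z v := by
    intro v
    rw [hV.integral_lineDeriv_mul_eq hφ hs v, ← integral_neg]
    congr 1; ext z; rw [lineDeriv_neg]; ring
  constructor
  · have e1 : ∫ z, pdX V z * φ z = ∫ z, lineDeriv ℝ V z (0,1) * φ z :=
      integral_congr_ae (h1.mono fun z hz => by simp only [hz.2])
    have e2 : ∫ z, V z * pdX φ z = ∫ z, V z * lineDeriv ℝ φ z (0,1) :=
      integral_congr_ae (h2.mono fun z hz => by simp only [hz.2])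
    rw [e1, e2, key]
  · have e1 : ∫ z, pdT V z * φ z = ∫ z, lineDeriv ℝ V z (1,0) * φ z :=
      integral_congr_ae (h1.mono fun z hz => by simp only [hz.1])
    have e2 : ∫ z, V z * pdT φ z = ∫ z, V z * lineDeriv ℝ φ z (1,0) :=
      integral_congr_ae (h2.mono fun z hz => by simp only [hz.1])
    rw [e1, e2, key]

lemma Sol.cons {R ρb : ℝ} {f : ℝ → ℝ} {c T ρL ρR : ℝ} {r : ℝ × ℝ → ℝ} (hF : AF R ρb f)
    (h : Sol R ρb f c T ρL ρR r) (n : ℕ) {z : ℝ × ℝ} (hz : z.1 + 1 / ((n:ℝ) + 1) < T) :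
    pdT (mo n r) z + pdX (mo n (fl f r)) z = 0 := by
  have hrb : ∀ z, |r z| ≤ R := fun z => by rw [abs_of_nonneg (h.mem z).1]; exact (h.mem z).2
  have hfm := measurable_fl hF h.meas h.mem
  rw [pdT, pdX, mo_fderiv n (loc_int_of_bdd h.meas hrb), mo_fderiv n (loc_int_of_bdd hfm (fl_le hF h.mem))]
  have hsub : HasCompactSupport (fun w => eta n (z - w)) :=
    (eta_supp n).comp_homeomorph (Homeomorph.subLeft z)
  have hcd : ContDiff ℝ (⊤ : ℕ∞) (fun w => eta n (z - w)) :=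
    (eta_contDiff n).comp (contDiff_const.sub contDiff_id)
  obtain ⟨D, hD⟩ := lip_of_test ⟨hcd, hsub⟩
  have hder : ∀ w v, fderiv ℝ (fun w => eta n (z - w)) w v = - fderiv ℝ (eta n) (z - w) v := by
    intro w v
    have : HasFDerivAt (fun w => eta n (z - w)) ((fderiv ℝ (eta n) (z - w)).comp (-(ContinuousLinearMap.id ℝ (ℝ × ℝ)))) w := by
      apply HasFDerivAt.comp
      · exact (eta_diff n _).hasFDerivAt
      · exact (hasFDerivAt_id w).const_sub z
    rw [this.fderiv]; simp
  have hw := h.weak hF hD hsub (fun w => eta_nonneg _ _) (by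
    have : tsupport (fun w => eta n (z - w)) ⊆ Metric.closedBall z (1 / ((n:ℝ) + 1)) := by
      apply closure_minimal _ Metric.isClosed_closedBall
      intro w hw
      by_contra h0
      apply hw
      apply eta_zero
      rw [Metric.mem_closedBall, dist_eq_norm, norm_sub_rev] at h0
      exact (not_le.1 h0).le
    intro w hw
    have := this hw
    rw [Metric.mem_closedBall, Prod.dist_eq] at this
    have h1 := (le_max_left _ _).trans this
    rw [Real.dist_eq] at h1
    refine ⟨?_, trivial⟩
    have := (abs_le.1 h1).2
    simp only [mem_Iio]; linarith)
  have i1 := (int_pd hD hsub h.meas hrb).1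
  have i2 := (int_pd hD hsub hfm (fl_le hF h.mem)).2
  rw [integral_add i1 i2] at hw
  simp only [pdT, pdX, hder, mul_neg, integral_neg] at hw
  linarith

lemma exists_Vn {R ρb : ℝ} {f : ℝ → ℝ} {c T ρL ρR : ℝ} {r : ℝ × ℝ → ℝ} (hF : AF R ρb f)
    (h : Sol R ρb f c T ρL ρR r) (n : ℕ) {T' : ℝ} (hT : T' + 1 / ((n:ℝ) + 1) < T) (hT0 : 0 < T') :
    ∃ U : ℝ × ℝ → ℝ, LipschitzWith (R + f ρb).toNNReal U ∧ U 0 = 0 ∧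
      ∀ z, z.1 < T' → pdX U z = mo n r z ∧ pdT U z = - mo n (fl f r) z := by
  have hrb : ∀ z, |r z| ≤ R := fun z => by rw [abs_of_nonneg (h.mem z).1]; exact (h.mem z).2
  have hfm := measurable_fl hF h.meas h.mem
  have hdr : Differentiable ℝ (mo n r) :=
    (mo_contDiff n (loc_int_of_bdd h.meas hrb)).differentiable (by simp)
  have hdn : Differentiable ℝ (mo n (fl f r)) :=
    (mo_contDiff n (loc_int_of_bdd hfm (fl_le hF h.mem))).differentiable (by simp)
  let S : Set (ℝ × ℝ) := {z | z.1 < T - 1 / ((n:ℝ) + 1)}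
  have hSo : IsOpen S := isOpen_lt continuous_fst continuous_const
  have hSc : Convex ℝ S := by
    have : S = Iio (T - 1 / ((n:ℝ) + 1)) ×ˢ univ := by ext z; simp [S]
    rw [this]; exact (convex_Iio _).prod convex_univ
  let ω : ℝ × ℝ → (ℝ × ℝ →L[ℝ] ℝ) := fun z =>
    mo n r z • ContinuousLinearMap.snd ℝ ℝ ℝ - mo n (fl f r) z • ContinuousLinearMap.fst ℝ ℝ ℝ
  have hω : ∀ z, HasFDerivAt ω ((fderiv ℝ (mo n r) z).smulRight (ContinuousLinearMap.snd ℝ ℝ ℝ) -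
      (fderiv ℝ (mo n (fl f r)) z).smulRight (ContinuousLinearMap.fst ℝ ℝ ℝ)) z := fun z =>
    ((hdr z).hasFDerivAt.smul_const (ContinuousLinearMap.snd ℝ ℝ ℝ)).sub
      ((hdn z).hasFDerivAt.smul_const (ContinuousLinearMap.fst ℝ ℝ ℝ))
  have hlin : ∀ (A : ℝ × ℝ →L[ℝ] ℝ) (v : ℝ × ℝ), A v = v.1 * A (1, 0) + v.2 * A (0, 1) := by
    intro A v
    have : v = v.1 • ((1:ℝ), (0:ℝ)) + v.2 • ((0:ℝ), (1:ℝ)) := by ext <;> simp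
    conv_lhs => rw [this]
    rw [map_add, map_smul, map_smul]; rfl
  obtain ⟨W, hW⟩ := hSc.exists_forall_hasFDerivAt_of_fderiv_symmetric hSo
    (fun z _ => (hω z).differentiableAt.differentiableWithinAt) (ω := ω) (by
      intro z hz x y
      have hc := h.cons hF n (z := z) (by simp only [S, mem_ofPred_eq] at hz; linarith)
      rw [(hω z).fderiv]
      simp only [ContinuousLinearMap.sub_apply, ContinuousLinearMap.smulRight_apply,
        ContinuousLinearMap.smul_apply, ContinuousLinearMap.coe_snd', ContinuousLinearMap.coe_fst', smul_eq_mul]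
      rw [hlin (fderiv ℝ (mo n r) z) x, hlin (fderiv ℝ (mo n r) z) y,
        hlin (fderiv ℝ (mo n (fl f r)) z) x, hlin (fderiv ℝ (mo n (fl f r)) z) y]
      change fderiv ℝ (mo n r) z (1, 0) + fderiv ℝ (mo n (fl f r)) z (0, 1) = 0 at hc
      have e : fderiv ℝ (mo n r) z (1, 0) = - fderiv ℝ (mo n (fl f r)) z (0, 1) := by linarith
      rw [e]; ring)
  have hbd : ∀ z, ‖ω z‖ ≤ R + f ρb := by
    intro z
    refine (norm_sub_le _ _).trans (add_le_add ?_ ?_)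
    · rw [norm_smul]
      have := abs_mo_le n h.meas hrb z
      calc _ ≤ R * 1 := mul_le_mul this (ContinuousLinearMap.norm_snd_le ℝ ℝ ℝ) (norm_nonneg _) hF.1.le
        _ = R := mul_one _
    · rw [norm_smul]
      have := abs_mo_le n hfm (fl_le hF h.mem) z
      calc _ ≤ f ρb * 1 := mul_le_mul this (ContinuousLinearMap.norm_fst_le ℝ ℝ ℝ) (norm_nonneg _) hF.fpos.le
        _ = f ρb := mul_one _
  have hLip : LipschitzOnWith (R + f ρb).toNNReal W S := by
    apply Convex.lipschitzOnWith_of_nnnorm_hasFDerivWithin_le (f' := ω) (fun z hz => (hW z hz).hasFDerivWithinAt) _ hSc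
    intro z _
    rw [← NNReal.coe_le_coe, coe_nnnorm, Real.coe_toNNReal _ (by linarith [hF.1, hF.fpos])]
    exact hbd z
  let cl : ℝ × ℝ → ℝ × ℝ := fun z => (min z.1 T', z.2)
  have hcl : LipschitzWith 1 cl := by
    have := ((LipschitzWith.prod_fst (α := ℝ) (β := ℝ)).min_const T').prodMk (LipschitzWith.prod_snd (α := ℝ) (β := ℝ))
    simpa using this
  have hmaps : MapsTo cl univ S := by
    intro z _
    simp only [cl, S, mem_ofPred_eq]
    exact (min_le_right _ _).trans_lt (by linarith)
  have h1 : LipschitzWith (R + f ρb).toNNReal (W ∘ cl) := by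
    have := hLip.comp (hcl.lipschitzOnWith (s := univ)) hmaps
    rw [lipschitzOnWith_univ, mul_one] at this
    exact this
  refine ⟨fun z => (W ∘ cl) z - W 0, ?_, ?_, ?_⟩
  · apply LipschitzWith.of_dist_le_mul
    intro x y
    simpa [Real.dist_eq] using h1.dist_le_mul x y
  · have : cl 0 = 0 := by ext <;> simp [cl, hT0.le]
    simp [this]
  · intro z hz
    have hzS : z ∈ S := by simp only [S, mem_ofPred_eq]; linarith
    have hev : (fun z => (W ∘ cl) z - W 0) =ᶠ[nhds z] fun z => W z - W 0 := by
      have : ∀ᶠ y : ℝ × ℝ in nhds z, y.1 < T' := continuous_fst.continuousAt.eventually (gt_mem_nhds hz)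
      filter_upwards [this] with y hy
      have : cl y = y := by ext <;> simp [cl, hy.le]
      simp [this]
    have hd := ((hW z hzS).sub_const (W 0)).congr_of_eventuallyEq hev
    rw [pdX, pdT, hd.fderiv]
    simp [ω]

lemma exists_pot {R ρb : ℝ} {f : ℝ → ℝ} {c T ρL ρR : ℝ} {r : ℝ × ℝ → ℝ} (hF : AF R ρb f)
    (h : Sol R ρb f c T ρL ρR r) {T' : ℝ} (hT : T' < T) (hT0 : 0 < T') :
    ∃ V : ℝ × ℝ → ℝ, LipschitzWith (R + f ρb).toNNReal V ∧ V 0 = 0 ∧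
      ∀ᵐ z : ℝ × ℝ, z.1 < T' → pdX V z = r z ∧ pdT V z = - fl f r z := by
  have hrb : ∀ z, |r z| ≤ R := fun z => by rw [abs_of_nonneg (h.mem z).1]; exact (h.mem z).2
  have hfm := measurable_fl hF h.meas h.mem
  obtain ⟨N, hN⟩ : ∃ N : ℕ, ∀ n ≥ N, T' + 1 / ((n:ℝ) + 1) < T := by
    have hlim : ∀ᶠ n : ℕ in atTop, 1 / ((n:ℝ) + 1) < T - T' :=
      (tendsto_one_div_add_atTop_nhds_zero_nat (𝕜 := ℝ)).eventually (gt_mem_nhds (by linarith))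
    obtain ⟨N, hN⟩ := eventually_atTop.1 hlim
    exact ⟨N, fun n hn => by linarith [hN n hn]⟩
  choose U hU1 hU2 hU3 using fun n : ℕ => exists_Vn hF h (n + N) (hN _ (Nat.le_add_left N n)) hT0
  obtain ⟨σ, hσ, V, hV, hVl⟩ := lip_subseq U _ hU1 hU2
  have hσ' : Tendsto (fun n => σ n + N) atTop atTop := tendsto_atTop_mono (fun n => Nat.le_add_right _ _) hσ.tendsto_atTop
  refine ⟨V, hV, ?_, ?_⟩
  · exact tendsto_nhds_unique (hVl 0) (by simp [hU2])
  have hO : IsOpen {z : ℝ × ℝ | z.1 < T'} := isOpen_lt continuous_fst continuous_const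
  have hUb : ∀ n z, |U n z| ≤ (R + f ρb).toNNReal * ‖z‖ := by
    intro n z
    have := (hU1 n).dist_le_mul z 0
    rwa [hU2, Real.dist_eq, sub_zero, dist_zero_right] at this
  -- weak limits
  have key : ∀ (g : ℝ × ℝ → ℝ) (P : (ℝ × ℝ → ℝ) → ℝ × ℝ → ℝ), Measurable g → (∃ B, ∀ z, |g z| ≤ B) →
      (∀ φ, Measurable (P φ)) → (∀ φ (C : NNReal), LipschitzWith C φ → ∀ z, |P φ z| ≤ C) →
      (∀ φ z, z ∉ tsupport φ → P φ z = 0) →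
      (∀ (W φ : ℝ × ℝ → ℝ) (C D : NNReal), LipschitzWith C W → LipschitzWith D φ → HasCompactSupport φ →
        ∫ z, P W z * φ z = - ∫ z, W z * P φ z) →
      (∀ n z, z.1 < T' → P (U n) z = mo (n + N) g z) →
      ∀ᵐ z : ℝ × ℝ, z.1 < T' → P V z = g z := by
    intro g P hg ⟨B, hB⟩ hPm hPb hP0 hP hUn
    have := hO.ae_eq_zero_of_integral_contDiff_smul_eq_zero (f := fun z => P V z - g z) (μ := volume)
      (((loc_int_of_bdd (hPm V) (hPb V _ hV)).sub (loc_int_of_bdd hg hB)).locallyIntegrableOn _) ?_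
    · filter_upwards [this] with z hz hzT
      have := hz hzT; linarith
    intro φ hφ hs hsub
    obtain ⟨D, hD⟩ := lip_of_test ⟨hφ, hs⟩
    obtain ⟨E, hE⟩ : ∃ E, ∀ z, |φ z| ≤ E := hφ.continuous.bounded_above_of_compact_support hs
    have hE0 : 0 ≤ E := (abs_nonneg _).trans (hE 0)
    have hB0 : 0 ≤ B := (abs_nonneg _).trans (hB 0)
    have c1 : Tendsto (fun n => ∫ z, U (σ n) z * P φ z) atTop (nhds (∫ z, V z * P φ z)) := by
      obtain ⟨G, hG⟩ := hs.isCompact.exists_bound_of_continuousOn (f := fun z : ℝ × ℝ => z) continuousOn_id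
      apply tendsto_integral_of_dominated_convergence ((tsupport φ).indicator (fun _ => (R + f ρb).toNNReal * G * D))
      · intro n
        exact (hU1 _).continuous.aestronglyMeasurable.mul (hPm φ).aestronglyMeasurable
      · rw [integrable_indicator_iff hs.isCompact.measurableSet]
        exact integrableOn_const hs.isCompact.measure_lt_top.ne
      · intro n
        filter_upwards with z
        by_cases hz : z ∈ tsupport φ
        · rw [indicator_of_mem hz, norm_mul]
          apply mul_le_mul _ (hPb φ D hD z) (abs_nonneg _)
          · exact mul_nonneg (NNReal.coe_nonneg _) ((norm_nonneg _).trans (hG z hz))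
          · exact (hUb _ z).trans (mul_le_mul_of_nonneg_left (hG z hz) (NNReal.coe_nonneg _))
        · rw [indicator_of_notMem hz, hP0 φ z hz]; simp
      · filter_upwards with z
        exact (hVl z).mul_const _
    have c2 : Tendsto (fun n => ∫ z, mo (σ n + N) g z * φ z) atTop (nhds (∫ z, g z * φ z)) := by
      apply tendsto_integral_of_dominated_convergence ((tsupport φ).indicator (fun _ => B * E))
      · intro n
        exact (mo_contDiff _ (loc_int_of_bdd hg hB)).continuous.aestronglyMeasurable.mul
          hφ.continuous.aestronglyMeasurable
      · rw [integrable_indicator_iff hs.isCompact.measurableSet]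
        exact integrableOn_const hs.isCompact.measure_lt_top.ne
      · intro n
        filter_upwards with z
        by_cases hz : z ∈ tsupport φ
        · rw [indicator_of_mem hz, norm_mul]
          exact mul_le_mul (abs_mo_le _ hg hB z) (hE z) (norm_nonneg _) hB0
        · rw [indicator_of_notMem hz, image_eq_zero_of_notMem_tsupport hz]; simp
      · filter_upwards [mo_ae (loc_int_of_bdd hg hB)] with z hz
        exact (hz.comp hσ').mul_const _
    have c3 : ∀ n, ∫ z, mo (σ n + N) g z * φ z = - ∫ z, U (σ n) z * P φ z := by
      intro n
      rw [← hP (U (σ n)) φ _ D (hU1 _) hD hs]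
      congr 1; ext z
      by_cases hz : z ∈ tsupport φ
      · rw [hUn _ z (hsub hz)]
      · rw [image_eq_zero_of_notMem_tsupport hz]; simp
    have c4 := tendsto_nhds_unique c2 (by simp_rw [c3]; exact c1.neg)
    rw [← hP V φ _ D hV hD hs] at c4
    simp only [smul_eq_mul, mul_sub]
    have iφ : Integrable φ := hφ.continuous.integrable_of_hasCompactSupport hs
    rw [integral_sub]
    · simp_rw [mul_comm (φ _)]; linarith
    · simp_rw [mul_comm (φ _)]
      exact iφ.bdd_mul (hPm V).aestronglyMeasurable (by filter_upwards with z; exact hPb V _ hV z)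
    · simp_rw [mul_comm (φ _)]
      exact iφ.bdd_mul hg.aestronglyMeasurable (by filter_upwards with z; exact hB z)
  have k1 := key r pdX h.meas ⟨R, hrb⟩ measurable_pdX (fun φ C hφ z => abs_pdX_le hφ z)
    (fun φ z hz => (pd_zero hz).2) (fun W φ C D hW hφ hs => (lip_ibp hW hφ hs).1) (fun n z hz => (hU3 n z hz).1)
  have k2 := key (fun z => - fl f r z) pdT hfm.neg ⟨f ρb, fun z => by rw [abs_neg]; exact fl_le hF h.mem z⟩
    measurable_pdT (fun φ C hφ z => abs_pdT_le hφ z)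
    (fun φ z hz => (pd_zero hz).1) (fun W φ C D hW hφ hs => (lip_ibp hW hφ hs).2)
    (fun n z hz => by rw [(hU3 n z hz).2, mo_neg])
  filter_upwards [k1, k2] with z h1 h2 hz
  exact ⟨h1 hz, h2 hz⟩

end

section

lemma mo_le_loc (n : ℕ) {g : ℝ × ℝ → ℝ} (hg : Measurable g) {C b : ℝ} (hC : ∀ z, |g z| ≤ C) {Ω : Set (ℝ × ℝ)}
    (hb : ∀ᵐ w, w ∈ Ω → g w ≤ b) {z : ℝ × ℝ} (hz : ∀ w, ‖z - w‖ < 1 / ((n:ℝ) + 1) → w ∈ Ω) : mo n g z ≤ b := by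
  have h1 : mo n g z ≤ ∫ w, b * eta n (z - w) := by
    apply integral_mono_ae (mo_integrable n hg hC z)
    · have : Integrable (eta n) := (eta_cont n).integrable_of_hasCompactSupport (eta_supp n)
      exact (this.comp_sub_left z).const_mul b
    · filter_upwards [hb] with w hw
      by_cases h : ‖z - w‖ < 1 / ((n:ℝ) + 1)
      · exact mul_le_mul_of_nonneg_right (hw (hz w h)) (eta_nonneg _ _)
      · simp [eta_zero n (not_lt.1 h)]
  rwa [integral_const_mul, eta_int', mul_one] at h1

lemma dir_le {Z : ℝ × ℝ → ℝ} {C : NNReal} (hZ : LipschitzWith C Z) {Ω : Set (ℝ × ℝ)} (hΩ : IsOpen Ω)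
    (v : ℝ × ℝ) {B : ℝ} (hB : ∀ᵐ z, z ∈ Ω → fderiv ℝ Z z v ≤ B) {z0 : ℝ × ℝ} {s : ℝ} (hs : 0 ≤ s)
    (hseg : ∀ u ∈ Icc 0 s, z0 + u • v ∈ Ω) : Z (z0 + s • v) - Z z0 ≤ B * s := by
  have hcont : Continuous fun u : ℝ => z0 + u • v := by fun_prop
  have hK : IsCompact ((fun u : ℝ => z0 + u • v) '' Icc 0 s) := isCompact_Icc.image hcont
  obtain ⟨δ, hδ, hδ'⟩ := hK.exists_cthickening_subset_open hΩ (by rintro _ ⟨u, hu, rfl⟩; exact hseg u hu)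
  have hlim : ∀ᶠ n : ℕ in atTop, 1 / ((n:ℝ) + 1) < δ :=
    (tendsto_one_div_add_atTop_nhds_zero_nat (𝕜 := ℝ)).eventually (gt_mem_nhds hδ)
  have hL := (mo_tendsto hZ (z0 + s • v)).sub (mo_tendsto hZ z0)
  apply le_of_tendsto hL
  filter_upwards [hlim] with n hn
  have hd : Differentiable ℝ (mo n Z) := (mo_contDiff n hZ.continuous.locallyIntegrable).differentiable (by simp)
  have hder : ∀ u, HasDerivAt (fun u : ℝ => mo n Z (z0 + u • v)) (fderiv ℝ (mo n Z) (z0 + u • v) v) u := by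
    intro u
    have h1 : HasDerivAt (fun u : ℝ => z0 + u • v) v u := by
      simpa using ((hasDerivAt_id u).smul_const v).const_add z0
    exact (hd _).hasFDerivAt.comp_hasDerivAt u h1
  have hle : ∀ u ∈ Icc 0 s, fderiv ℝ (mo n Z) (z0 + u • v) v ≤ B := by
    intro u hu
    rw [mo_lip_fderiv n hZ, mo_congr n (g' := fun w => fderiv ℝ Z w v)
      (hZ.ae_differentiableAt.mono fun w hw => hw.lineDeriv_eq_fderiv)]
    apply mo_le_loc n (measurable_fderiv_apply_const ℝ Z v) (C := C * ‖v‖) _ hB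
    · intro w hw
      apply hδ'
      apply Metric.mem_cthickening_of_dist_le w _ _ _ (mem_image_of_mem _ hu)
      rw [dist_eq_norm, norm_sub_rev]
      exact (hw.trans hn).le
    · intro w
      have h1 := norm_fderiv_le_of_lipschitz ℝ hZ (x₀ := w)
      exact ((fderiv ℝ Z w).le_opNorm v).trans (mul_le_mul_of_nonneg_right h1 (norm_nonneg _))
  have := (convex_Icc (0:ℝ) s).image_sub_le_mul_sub_of_deriv_le (f := fun u : ℝ => mo n Z (z0 + u • v)) (C := B)
    (fun u _ => (hder u).continuousAt.continuousWithinAt)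
    (fun u _ => (hder u).differentiableAt.differentiableWithinAt)
    (fun u hu => by rw [(hder u).deriv]; exact hle u (interior_subset hu))
    0 ⟨le_rfl, hs⟩ s ⟨hs, le_rfl⟩ hs
  simpa using this

lemma fderiv_neg_apply' (Z : ℝ × ℝ → ℝ) (z v) : fderiv ℝ (fun z => - Z z) z v = - fderiv ℝ Z z v := by
  rw [fderiv_fun_neg]; rfl

lemma dir_ge {Z : ℝ × ℝ → ℝ} {C : NNReal} (hZ : LipschitzWith C Z) {Ω : Set (ℝ × ℝ)} (hΩ : IsOpen Ω)
    (v : ℝ × ℝ) {B : ℝ} (hB : ∀ᵐ z, z ∈ Ω → B ≤ fderiv ℝ Z z v) {z0 : ℝ × ℝ} {s : ℝ} (hs : 0 ≤ s)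
    (hseg : ∀ u ∈ Icc 0 s, z0 + u • v ∈ Ω) : B * s ≤ Z (z0 + s • v) - Z z0 := by
  have := dir_le hZ.neg hΩ v (B := -B) (by
    filter_upwards [hB] with z hz h
    have h1 := hz h
    have h2 := fderiv_neg_apply' Z z v
    simp only [Pi.neg_def]
    linarith) hs hseg
  simp only [Pi.neg_apply] at this
  linarith

lemma dirX_le {Z : ℝ × ℝ → ℝ} {C : NNReal} (hZ : LipschitzWith C Z) {Ω : Set (ℝ × ℝ)} (hΩ : IsOpen Ω)
    {B : ℝ} (hB : ∀ᵐ z, z ∈ Ω → pdX Z z ≤ B) {t a b : ℝ} (hab : a ≤ b)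
    (hseg : ∀ u ∈ Icc a b, (t, u) ∈ Ω) : Z (t, b) - Z (t, a) ≤ B * (b - a) := by
  have := dir_le hZ hΩ (0, 1) hB (z0 := (t, a)) (s := b - a) (by linarith) (by
    intro u hu
    have := hseg (a + u) ⟨by linarith [hu.1], by linarith [hu.2]⟩
    simpa using this)
  simpa using this
lemma dirX_ge {Z : ℝ × ℝ → ℝ} {C : NNReal} (hZ : LipschitzWith C Z) {Ω : Set (ℝ × ℝ)} (hΩ : IsOpen Ω)
    {B : ℝ} (hB : ∀ᵐ z, z ∈ Ω → B ≤ pdX Z z) {t a b : ℝ} (hab : a ≤ b)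
    (hseg : ∀ u ∈ Icc a b, (t, u) ∈ Ω) : B * (b - a) ≤ Z (t, b) - Z (t, a) := by
  have := dir_ge hZ hΩ (0, 1) hB (z0 := (t, a)) (s := b - a) (by linarith) (by
    intro u hu
    have := hseg (a + u) ⟨by linarith [hu.1], by linarith [hu.2]⟩
    simpa using this)
  simpa using this
lemma dirT_le {Z : ℝ × ℝ → ℝ} {C : NNReal} (hZ : LipschitzWith C Z) {Ω : Set (ℝ × ℝ)} (hΩ : IsOpen Ω)
    {B : ℝ} (hB : ∀ᵐ z, z ∈ Ω → pdT Z z ≤ B) {x a b : ℝ} (hab : a ≤ b)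
    (hseg : ∀ u ∈ Icc a b, (u, x) ∈ Ω) : Z (b, x) - Z (a, x) ≤ B * (b - a) := by
  have := dir_le hZ hΩ (1, 0) hB (z0 := (a, x)) (s := b - a) (by linarith) (by
    intro u hu
    have := hseg (a + u) ⟨by linarith [hu.1], by linarith [hu.2]⟩
    simpa using this)
  simpa using this
lemma dirT_ge {Z : ℝ × ℝ → ℝ} {C : NNReal} (hZ : LipschitzWith C Z) {Ω : Set (ℝ × ℝ)} (hΩ : IsOpen Ω)
    {B : ℝ} (hB : ∀ᵐ z, z ∈ Ω → B ≤ pdT Z z) {x a b : ℝ} (hab : a ≤ b)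
    (hseg : ∀ u ∈ Icc a b, (u, x) ∈ Ω) : B * (b - a) ≤ Z (b, x) - Z (a, x) := by
  have := dir_ge hZ hΩ (1, 0) hB (z0 := (a, x)) (s := b - a) (by linarith) (by
    intro u hu
    have := hseg (a + u) ⟨by linarith [hu.1], by linarith [hu.2]⟩
    simpa using this)
  simpa using this

/-- `V` is a potential for `r` up to time `T`. -/
structure Pot (R ρb : ℝ) (f : ℝ → ℝ) (T : ℝ) (r V : ℝ × ℝ → ℝ) : Prop where
  lip : LipschitzWith (R + f ρb).toNNReal V
  zero : V 0 = 0
  ae : ∀ᵐ z : ℝ × ℝ, z.1 < T → pdX V z = r z ∧ pdT V z = - fl f r z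

variable {R ρb : ℝ} {f : ℝ → ℝ} {c T T' ρL ρR : ℝ} {r V : ℝ × ℝ → ℝ}

lemma fl_mem (hF : AF R ρb f) (hm : ∀ z, r z ∈ Icc 0 R) (z) : fl f r z ∈ Icc 0 (f ρb) := by
  have := fl_le hF hm z
  refine ⟨?_, (abs_le.1 this).2⟩
  unfold fl; split_ifs
  · exact hF.2.2.1 _ (hm z)
  · exact le_rfl

lemma isOpen_lt_T (T : ℝ) : IsOpen {z : ℝ × ℝ | z.1 < T} := isOpen_lt continuous_fst continuous_const

lemma Pot.slope (h : Sol R ρb f c T ρL ρR r) (hV : Pot R ρb f T' r V) {t : ℝ} (ht : t < T') {x y : ℝ}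
    (hxy : x ≤ y) : 0 ≤ V (t, y) - V (t, x) ∧ V (t, y) - V (t, x) ≤ R * (y - x) := by
  constructor
  · have := dirX_ge hV.lip (isOpen_lt_T T') (B := 0) (by
      filter_upwards [hV.ae] with z hz hzT
      rw [(hz hzT).1]; exact (h.mem z).1) hxy (t := t) (fun _ _ => ht)
    linarith
  · exact dirX_le hV.lip (isOpen_lt_T T') (B := R) (by
      filter_upwards [hV.ae] with z hz hzT
      rw [(hz hzT).1]; exact (h.mem z).2) hxy (t := t) (fun _ _ => ht)

lemma Pot.time (hF : AF R ρb f) (h : Sol R ρb f c T ρL ρR r) (hV : Pot R ρb f T' r V) {s t : ℝ} (hst : s ≤ t)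
    (ht : t < T') (x : ℝ) : -(f ρb) * (t - s) ≤ V (t, x) - V (s, x) ∧ V (t, x) - V (s, x) ≤ 0 := by
  constructor
  · exact dirT_ge hV.lip (isOpen_lt_T T') (B := -(f ρb)) (by
      filter_upwards [hV.ae] with z hz hzT
      rw [(hz hzT).2]; linarith [(fl_mem hF h.mem z).2]) hst (fun u hu => hu.2.trans_lt ht)
  · have := dirT_le hV.lip (isOpen_lt_T T') (B := 0) (by
      filter_upwards [hV.ae] with z hz hzT
      rw [(hz hzT).2]; linarith [(fl_mem hF h.mem z).1]) hst (x := x) (fun u hu => hu.2.trans_lt ht)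
    linarith

lemma Pot.neg_time (h : Sol R ρb f c T ρL ρR r) (hV : Pot R ρb f T' r V) (hT : 0 < T') {s t : ℝ} (hst : s ≤ t)
    (ht : t < 0) (x : ℝ) : V (t, x) = V (s, x) := by
  have hz0 : ∀ᵐ z : ℝ × ℝ, z ∈ {z : ℝ × ℝ | z.1 < 0} → pdT V z = 0 := by
    filter_upwards [hV.ae] with z hz hzT
    have hz0 : z.1 < 0 := hzT
    rw [(hz (by linarith)).2, fl, if_neg (by linarith)]; simp
  have h1 := dirT_le hV.lip (isOpen_lt_T 0) (B := 0) (hz0.mono fun z hz h => (hz h).le) hst (x := x)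
    (fun u hu => hu.2.trans_lt ht)
  have h2 := dirT_ge hV.lip (isOpen_lt_T 0) (B := 0) (hz0.mono fun z hz h => (hz h).ge) hst (x := x)
    (fun u hu => hu.2.trans_lt ht)
  linarith

lemma Pot.cont (hV : Pot R ρb f T' r V) : Continuous V := hV.lip.continuous

/-- limit from below in time -/
lemma le_of_lt_time {G : ℝ → ℝ} (hG : Continuous G) {t0 a : ℝ} (h : ∀ t < t0, G t ≤ a) : G t0 ≤ a := by
  have h1 : Tendsto G (nhdsWithin t0 (Iio t0)) (nhds (G t0)) := hG.continuousAt.tendsto.mono_left nhdsWithin_le_nhds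
  exact le_of_tendsto h1 (by filter_upwards [self_mem_nhdsWithin] with t ht; exact h t ht)

/-- limit from above -/
lemma le_of_gt_time {G : ℝ → ℝ} (hG : Continuous G) {t0 a : ℝ} (h : ∀ t > t0, G t ≤ a) : G t0 ≤ a := by
  have h1 : Tendsto G (nhdsWithin t0 (Ioi t0)) (nhds (G t0)) := hG.continuousAt.tendsto.mono_left nhdsWithin_le_nhds
  exact le_of_tendsto h1 (by filter_upwards [self_mem_nhdsWithin] with t ht; exact h t ht)

lemma Pot.initL (h : Sol R ρb f c T ρL ρR r) (hV : Pot R ρb f T' r V) (hT : 0 < T') {x : ℝ} (hx : x ≤ 0) :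
    V (0, x) = ρL * x := by
  have hΩ : IsOpen {z : ℝ × ℝ | z.1 < 0 ∧ z.2 < 0} :=
    (isOpen_lt continuous_fst continuous_const).inter (isOpen_lt continuous_snd continuous_const)
  have hae : ∀ᵐ z : ℝ × ℝ, z ∈ {z : ℝ × ℝ | z.1 < 0 ∧ z.2 < 0} → pdX V z = ρL := by
    filter_upwards [hV.ae] with z hz hzT
    obtain ⟨h1, h2⟩ := hzT
    rw [(hz (by linarith)).1, h.ini z h1.le, riem, if_pos h2]
  have key : ∀ t < 0, ∀ y < 0, ∀ x ≤ y, V (t, y) - V (t, x) = ρL * (y - x) := by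
    intro t ht y hy x hxy
    apply le_antisymm
    · exact dirX_le hV.lip hΩ (hae.mono fun z hz h => (hz h).le) hxy (fun u hu => ⟨ht, hu.2.trans_lt hy⟩)
    · exact dirX_ge hV.lip hΩ (hae.mono fun z hz h => (hz h).ge) hxy (fun u hu => ⟨ht, hu.2.trans_lt hy⟩)
  rcases hx.lt_or_eq with hx | rfl
  · have hc := hV.cont
    have hcl : IsClosed {p : ℝ × ℝ | V (p.1, p.2) - V (p.1, x) = ρL * (p.2 - x)} :=
      isClosed_eq (by fun_prop) (by fun_prop)
    have hmem : ((0:ℝ), (0:ℝ)) ∈ closure (Iio (0:ℝ) ×ˢ Ioo x 0) := by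
      rw [closure_prod_eq, closure_Iio, closure_Ioo hx.ne]
      exact ⟨mem_Iic.2 le_rfl, right_mem_Icc.2 hx.le⟩
    have hsub : (Iio (0:ℝ) ×ˢ Ioo x 0) ⊆ {p : ℝ × ℝ | V (p.1, p.2) - V (p.1, x) = ρL * (p.2 - x)} := by
      rintro p ⟨h1, h2⟩
      exact key p.1 h1 p.2 h2.2 x h2.1.le
    have := closure_minimal hsub hcl hmem
    simp only [mem_ofPred_eq] at this
    have h0 : V ((0:ℝ), (0:ℝ)) = 0 := hV.zero
    linarith
  · rw [mul_zero]; exact hV.zero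

lemma Pot.initR (h : Sol R ρb f c T ρL ρR r) (hV : Pot R ρb f T' r V) (hT : 0 < T') {x : ℝ} (hx : 0 ≤ x) :
    V (0, x) = ρR * x := by
  have hΩ : IsOpen {z : ℝ × ℝ | z.1 < 0 ∧ 0 < z.2} :=
    (isOpen_lt continuous_fst continuous_const).inter (isOpen_lt continuous_const continuous_snd)
  have hae : ∀ᵐ z : ℝ × ℝ, z ∈ {z : ℝ × ℝ | z.1 < 0 ∧ 0 < z.2} → pdX V z = ρR := by
    filter_upwards [hV.ae] with z hz hzT
    obtain ⟨h1, h2⟩ := hzT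
    rw [(hz (by linarith)).1, h.ini z h1.le, riem, if_neg (by linarith)]
  have key : ∀ t < 0, ∀ y > 0, ∀ x ≥ y, V (t, x) - V (t, y) = ρR * (x - y) := by
    intro t ht y hy x hxy
    apply le_antisymm
    · exact dirX_le hV.lip hΩ (hae.mono fun z hz h => (hz h).le) hxy (fun u hu => ⟨ht, lt_of_lt_of_le hy hu.1⟩)
    · exact dirX_ge hV.lip hΩ (hae.mono fun z hz h => (hz h).ge) hxy (fun u hu => ⟨ht, lt_of_lt_of_le hy hu.1⟩)
  rcases hx.lt_or_eq with hx | rfl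
  · have hc := hV.cont
    have hcl : IsClosed {p : ℝ × ℝ | V (p.1, x) - V (p.1, p.2) = ρR * (x - p.2)} :=
      isClosed_eq (by fun_prop) (by fun_prop)
    have hmem : ((0:ℝ), (0:ℝ)) ∈ closure (Iio (0:ℝ) ×ˢ Ioo 0 x) := by
      rw [closure_prod_eq, closure_Iio, closure_Ioo hx.ne]
      exact ⟨mem_Iic.2 le_rfl, left_mem_Icc.2 hx.le⟩
    have hsub : (Iio (0:ℝ) ×ˢ Ioo 0 x) ⊆ {p : ℝ × ℝ | V (p.1, x) - V (p.1, p.2) = ρR * (x - p.2)} := by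
      rintro p ⟨h1, h2⟩
      exact key p.1 h1 p.2 h2.1 x h2.2.le
    have := closure_minimal hsub hcl hmem
    simp only [mem_ofPred_eq] at this
    have h0 : V ((0:ℝ), (0:ℝ)) = 0 := hV.zero
    linarith
  · rw [mul_zero]; exact hV.zero
end

section

variable {R ρb : ℝ} {f : ℝ → ℝ} {c T T' ρL ρR : ℝ} {r V : ℝ × ℝ → ℝ}

def sq (z : ℝ) : ℝ := (max z 0) ^ 2

lemma sq_nonneg' (z : ℝ) : 0 ≤ sq z := by unfold sq; positivity
lemma sq_zero {z : ℝ} (h : z ≤ 0) : sq z = 0 := by simp [sq, h]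
lemma sq_pos {z : ℝ} (h : 0 < z) : 0 < sq z := by
  unfold sq; rw [max_eq_left h.le]; positivity
lemma sq_hasDeriv (z : ℝ) : HasDerivAt sq (2 * max z 0) z := by
  rcases lt_trichotomy z 0 with h | h | h
  · have : sq =ᶠ[nhds z] fun _ => 0 := by
      filter_upwards [Iio_mem_nhds h] with y hy
      exact sq_zero (le_of_lt hy)
    rw [max_eq_right h.le, mul_zero]
    exact (hasDerivAt_const z (0:ℝ)).congr_of_eventuallyEq this
  · subst h
    rw [max_self, mul_zero, hasDerivAt_iff_isLittleO]
    simp only [sq_zero le_rfl, sub_zero, smul_zero]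
    refine Asymptotics.IsBigO.trans_isLittleO (g := fun x : ℝ => x ^ 2) ?_ ?_
    · apply Asymptotics.IsBigO.of_bound 1
      filter_upwards with x
      rw [one_mul, Real.norm_of_nonneg (sq_nonneg' _), Real.norm_of_nonneg (by positivity)]
      unfold sq
      rcases le_total x 0 with hx | hx
      · simp [hx]; positivity
      · simp [hx]
    · exact Asymptotics.isLittleO_pow_id one_lt_two
  · have : sq =ᶠ[nhds z] fun y => y ^ 2 := by
      filter_upwards [Ioi_mem_nhds h] with y hy
      unfold sq; rw [max_eq_left (le_of_lt hy)]
    rw [max_eq_left h.le]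
    have h2 := (hasDerivAt_pow 2 z).congr_of_eventuallyEq this
    simpa using h2

lemma sq_locLip : LocallyLipschitz sq := by
  have h1 : ContDiff ℝ 1 sq := by
    rw [contDiff_one_iff_deriv]
    refine ⟨fun z => (sq_hasDeriv z).differentiableAt, ?_⟩
    have : deriv sq = fun z => 2 * max z 0 := funext fun z => (sq_hasDeriv z).deriv
    rw [this]; fun_prop
  exact h1.locallyLipschitz

lemma st_locLip : LocallyLipschitz Real.smoothTransition :=
  (Real.smoothTransition.contDiff (n := 1)).locallyLipschitz

lemma test_mk {φ : ℝ × ℝ → ℝ} (h : LocallyLipschitz φ) {a b d e : ℝ} (hz : ∀ z, φ z ≠ 0 → z ∈ Icc a b ×ˢ Icc d e)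
    (hb : b < T) : ∃ C, LipschitzWith C φ ∧ HasCompactSupport φ ∧ tsupport φ ⊆ Iio T ×ˢ univ := by
  have hK : IsCompact (Icc a b ×ˢ Icc d e) := isCompact_Icc.prod isCompact_Icc
  have hs : HasCompactSupport φ := HasCompactSupport.intro hK (fun z hz' => by
    by_contra hne; exact hz' (hz z hne))
  have hts : tsupport φ ⊆ Icc a b ×ˢ Icc d e := closure_minimal hz hK.isClosed
  obtain ⟨ρ, hρ⟩ := hK.isBounded.subset_closedBall (0 : ℝ × ℝ)
  obtain ⟨D, hD⟩ := hs.exists_bound_of_continuous h.continuous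
  have hD0 : 0 ≤ D := (norm_nonneg _).trans (hD 0)
  obtain ⟨C1, hC1⟩ := (h.locallyLipschitzOn (s := Metric.closedBall 0 (ρ+1))).exists_lipschitzOnWith_of_compact
    (isCompact_closedBall _ _)
  refine ⟨max C1 D.toNNReal, ?_, hs, fun z hz => ⟨lt_of_le_of_lt (hts hz).1.2 hb, mem_univ _⟩⟩
  have key : ∀ x y, φ x ≠ 0 → dist (φ x) (φ y) ≤ ((max C1 D.toNNReal : NNReal) : ℝ) * dist x y := by
    intro x y hx
    have hxb := hρ (hz x hx)
    rw [mem_closedBall_zero_iff] at hxb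
    by_cases hy : ‖y‖ ≤ ρ + 1
    · have := hC1.dist_le_mul x (by rw [mem_closedBall_zero_iff]; linarith) y (by rwa [mem_closedBall_zero_iff])
      exact this.trans (mul_le_mul_of_nonneg_right (by exact_mod_cast le_max_left _ _) dist_nonneg)
    · push Not at hy
      have hy0 : φ y = 0 := by
        by_contra hne
        have := hρ (hz y hne)
        rw [mem_closedBall_zero_iff] at this; linarith
      have hd : 1 ≤ dist x y := by
        rw [dist_eq_norm, norm_sub_rev]
        have := norm_sub_norm_le y x; linarith
      rw [hy0, dist_zero_right]
      have h3 : D ≤ ((max C1 D.toNNReal : NNReal) : ℝ) := by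
        rw [NNReal.coe_max, Real.coe_toNNReal _ hD0]; exact le_max_right _ _
      calc ‖φ x‖ ≤ D := hD x
        _ ≤ _ := h3
        _ = _ * 1 := (mul_one _).symm
        _ ≤ _ := mul_le_mul_of_nonneg_left hd (NNReal.coe_nonneg _)
  apply LipschitzWith.of_dist_le_mul
  intro x y
  by_cases hx : φ x = 0
  · by_cases hy : φ y = 0
    · rw [hx, hy, dist_self]; positivity
    · rw [dist_comm, dist_comm x y]; exact key y x hy
  · exact key x y hx

lemma ae_zero_of {E g : ℝ × ℝ → ℝ} (hE : Integrable E) (h0 : 0 ≤ ∫ z, E z) (hg : ∀ z, 0 ≤ g z)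
    (hle : ∀ᵐ z, E z ≤ - g z) : ∀ᵐ z, g z = 0 := by
  have h1 : 0 ≤ᵐ[volume] fun z => - E z := by
    filter_upwards [hle] with z hz
    have := hg z
    show 0 ≤ - E z
    linarith
  have h2 : ∫ z, - E z = 0 := le_antisymm (by rw [integral_neg]; linarith) (integral_nonneg_of_ae h1)
  rw [integral_eq_zero_iff_of_nonneg_ae h1 hE.neg] at h2
  filter_upwards [h2, hle] with z a b
  have a' : - E z = 0 := a
  linarith [hg z]

lemma le_of_Ioo_time {G : ℝ → ℝ} (hG : Continuous G) {t1 t0 a : ℝ} (h01 : t1 < t0) (h : ∀ t ∈ Ioo t1 t0, G t ≤ a) :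
    G t0 ≤ a := by
  have h1 : Tendsto G (nhdsWithin t0 (Iio t0)) (nhds (G t0)) := hG.continuousAt.tendsto.mono_left nhdsWithin_le_nhds
  exact le_of_tendsto h1 (by filter_upwards [Ioo_mem_nhdsLT h01] with t ht; exact h t ht)

/-- integrability of the entropy integrand -/
lemma Sol.int_ent (hF : AF R ρb f) (h : Sol R ρb f c T ρL ρR r) {φ : ℝ × ℝ → ℝ} {C : NNReal} (hφ : LipschitzWith C φ)
    (hs : HasCompactSupport φ) {k : ℝ} (hk : k ∈ Icc 0 R) :
    Integrable (fun z => eD r k z * pdT φ z + eF f r k z * pdX φ z) :=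
  (int_pd hφ hs (measurable_eD h.meas k) (eD_le h.mem hk)).1.add
    (int_pd hφ hs (measurable_eF hF h.meas h.mem k) (eF_le hF h.mem hk)).2

lemma Pot.locLip (hV : Pot R ρb f T' r V) : LocallyLipschitz V := hV.lip.locallyLipschitz

/-- potentials are differentiable a.e. with the right derivative -/
lemma Pot.diff (hV : Pot R ρb f T' r V) : ∀ᵐ z : ℝ × ℝ, z.1 < T' →
    DifferentiableAt ℝ V z ∧ pdX V z = r z ∧ pdT V z = - fl f r z := by
  filter_upwards [hV.lip.ae_differentiableAt, hV.ae] with z h1 h2 h3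
  exact ⟨h1, h2 h3⟩
end

section

variable {R ρb : ℝ} {f : ℝ → ℝ} {c T T' ρL ρR : ℝ} {r V : ℝ × ℝ → ℝ}

lemma pdT_has {φ : ℝ × ℝ → ℝ} {z : ℝ × ℝ} (h : DifferentiableAt ℝ φ z) :
    HasDerivAt (fun s => φ (s, z.2)) (pdT φ z) z.1 := by
  have h1 : HasDerivAt (fun s : ℝ => (s, z.2)) (1, 0) z.1 := (hasDerivAt_id _).prodMk (hasDerivAt_const _ _)
  have h2 : HasFDerivAt φ (fderiv ℝ φ z) ((fun s : ℝ => (s, z.2)) z.1) := h.hasFDerivAt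
  exact h2.comp_hasDerivAt z.1 h1

lemma pdX_has {φ : ℝ × ℝ → ℝ} {z : ℝ × ℝ} (h : DifferentiableAt ℝ φ z) :
    HasDerivAt (fun s => φ (z.1, s)) (pdX φ z) z.2 := by
  have h1 : HasDerivAt (fun s : ℝ => (z.1, s)) (0, 1) z.2 := (hasDerivAt_const _ _).prodMk (hasDerivAt_id _)
  have h2 : HasFDerivAt φ (fderiv ℝ φ z) ((fun s : ℝ => (z.1, s)) z.2) := h.hasFDerivAt
  exact h2.comp_hasDerivAt z.2 h1

/-- pointwise computation -/
lemma core_pt {φ χ : ℝ × ℝ → ℝ} {h : ℝ → ℝ} {z : ℝ × ℝ} {k lam b h' a d : ℝ}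
    (hφ : ∀ z, φ z = h (V z - k * z.2 + lam * (z.1 - b)) * χ z)
    (dφ : DifferentiableAt ℝ φ z) (dV : DifferentiableAt ℝ V z) (hX : pdX V z = r z) (hTt : pdT V z = - fl f r z)
    (hz : 0 < z.1) (hh : HasDerivAt h h' (V z - k * z.2 + lam * (z.1 - b)))
    (ha : HasDerivAt (fun s => χ (s, z.2)) a z.1) (hd : HasDerivAt (fun s => χ (z.1, s)) d z.2) :
    eD r k z * pdT φ z + eF f r k z * pdX φ z = |r z - k| * (lam - f k) * h' * χ z
      + h (V z - k * z.2 + lam * (z.1 - b)) * (|r z - k| * a + eF f r k z * d) := by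
  have e1 : pdT φ z = h' * (- f (r z) + lam) * χ z + h (V z - k * z.2 + lam * (z.1 - b)) * a := by
    apply (pdT_has dφ).unique
    simp only [hφ]
    have h1 := pdT_has dV
    rw [hTt, fl, if_pos hz] at h1
    have h2 : HasDerivAt (fun s => V (s, z.2) - k * z.2 + lam * (s - b)) (- f (r z) + lam) z.1 := by
      simpa using (h1.sub_const (k * z.2)).fun_add (((hasDerivAt_id z.1).sub_const b).const_mul lam)
    exact (HasDerivAt.comp z.1 (h₂ := h) hh h2).fun_mul ha
  have e2 : pdX φ z = h' * (r z - k) * χ z + h (V z - k * z.2 + lam * (z.1 - b)) * d := by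
    apply (pdX_has dφ).unique
    simp only [hφ]
    have h1 := pdX_has dV
    rw [hX] at h1
    have h2 : HasDerivAt (fun s => V (z.1, s) - k * s + lam * (z.1 - b)) (r z - k) z.2 := by
      have := (h1.fun_sub ((hasDerivAt_id z.2).const_mul k)).add_const (lam * (z.1 - b))
      simpa using this
    exact (HasDerivAt.comp z.2 (h₂ := h) hh h2).fun_mul hd
  rw [e1, e2]
  have e3 : eF f r k z * (r z - k) = |r z - k| * (f (r z) - f k) := by
    unfold eF; rw [if_pos hz]
    have : Real.sign (r z - k) * (r z - k) = |r z - k| := by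
      rcases lt_trichotomy (r z - k) 0 with hh | hh | hh
      · rw [Real.sign_of_neg hh, abs_of_neg hh]; ring
      · rw [hh]; simp
      · rw [Real.sign_of_pos hh, abs_of_pos hh]; ring
    rw [← this]; ring
  unfold eD
  linear_combination h' * χ z * e3

lemma eF_lip (hm : ∀ z, r z ∈ Icc 0 R) {k L : ℝ} (hk : k ∈ Icc 0 R)
    (hL : ∀ x ∈ Icc 0 R, ∀ y ∈ Icc 0 R, |f x - f y| ≤ L * |x - y|) (z : ℝ × ℝ) (d : ℝ) :
    eF f r k z * d ≤ L * |r z - k| * |d| := by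
  have h0 := hL _ (hm z) _ hk
  apply (le_abs_self _).trans
  rw [abs_mul]
  apply mul_le_mul_of_nonneg_right _ (abs_nonneg _)
  unfold eF; split_ifs
  · rw [abs_mul]
    calc _ ≤ 1 * |f (r z) - f k| := mul_le_mul_of_nonneg_right (abs_sign_le _) (abs_nonneg _)
      _ ≤ _ := by rw [one_mul]; exact h0
  · rw [abs_zero]; exact (abs_nonneg _).trans h0

lemma st_deriv_zero {y : ℝ} (h : 1 < y) : HasDerivAt Real.smoothTransition 0 y := by
  have : Real.smoothTransition =ᶠ[nhds y] fun _ => 1 := by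
    filter_upwards [Ioi_mem_nhds h] with x hx
    exact Real.smoothTransition.one_of_one_le (le_of_lt hx)
  exact (hasDerivAt_const y (1:ℝ)).congr_of_eventuallyEq this

lemma st_deriv_zero' {y : ℝ} (h : y < 0) : HasDerivAt Real.smoothTransition 0 y := by
  have : Real.smoothTransition =ᶠ[nhds y] fun _ => 0 := by
    filter_upwards [Iio_mem_nhds h] with x hx
    exact Real.smoothTransition.zero_of_nonpos (le_of_lt hx)
  exact (hasDerivAt_const y (0:ℝ)).congr_of_eventuallyEq this

lemma st_diff (y : ℝ) : HasDerivAt Real.smoothTransition (deriv Real.smoothTransition y) y :=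
  ((Real.smoothTransition.contDiff (n := 1)).differentiable (by simp) y).hasDerivAt

/-- cone-type cutoff -/
def chi0 (t x L : ℝ) (z : ℝ × ℝ) : ℝ := sq (t - z.1) * (sq (z.2 - x + L * (t - z.1)) * sq (x - z.2 + L * (t - z.1)))

lemma chi0_nonneg (t x L z) : 0 ≤ chi0 t x L z := by
  unfold chi0; have := sq_nonneg'; exact mul_nonneg (this _) (mul_nonneg (this _) (this _))

lemma chi0_ne {t x L : ℝ} {z : ℝ × ℝ} (h : chi0 t x L z ≠ 0) : z.1 < t ∧ |z.2 - x| < L * (t - z.1) := by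
  unfold chi0 at h
  refine ⟨?_, ?_⟩
  · by_contra hh; exact h (by rw [sq_zero (z := t - z.1) (by linarith)]; simp)
  · rw [abs_lt]; constructor
    · by_contra hh; exact h (by rw [sq_zero (z := z.2 - x + L * (t - z.1)) (by linarith)]; simp)
    · by_contra hh; exact h (by rw [sq_zero (z := x - z.2 + L * (t - z.1)) (by linarith)]; simp)

lemma chi0_deriv (t x L : ℝ) (hL : 0 ≤ L) (z : ℝ × ℝ) : ∃ a d, HasDerivAt (fun s => chi0 t x L (s, z.2)) a z.1 ∧
    HasDerivAt (fun s => chi0 t x L (z.1, s)) d z.2 ∧ a + L * |d| ≤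
      - (2 * max (t - z.1) 0 * (sq (z.2 - x + L * (t - z.1)) * sq (x - z.2 + L * (t - z.1)))) := by
  have hA : HasDerivAt (fun s => sq (t - s)) (2 * max (t - z.1) 0 * (-1)) z.1 := by
    apply (sq_hasDeriv _).comp z.1 (h := fun s => t - s)
    simpa using (hasDerivAt_id z.1).const_sub t
  have hB : HasDerivAt (fun s => sq (z.2 - x + L * (t - s))) (2 * max (z.2 - x + L * (t - z.1)) 0 * (-L)) z.1 := by
    apply (sq_hasDeriv _).comp z.1 (h := fun s => z.2 - x + L * (t - s))
    simpa using (((hasDerivAt_id z.1).const_sub t).const_mul L).const_add (z.2 - x)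
  have hC : HasDerivAt (fun s => sq (x - z.2 + L * (t - s))) (2 * max (x - z.2 + L * (t - z.1)) 0 * (-L)) z.1 := by
    apply (sq_hasDeriv _).comp z.1 (h := fun s => x - z.2 + L * (t - s))
    simpa using (((hasDerivAt_id z.1).const_sub t).const_mul L).const_add (x - z.2)
  have hB' : HasDerivAt (fun s => sq (s - x + L * (t - z.1))) (2 * max (z.2 - x + L * (t - z.1)) 0 * 1) z.2 := by
    apply (sq_hasDeriv _).comp z.2 (h := fun s => s - x + L * (t - z.1))
    simpa using ((hasDerivAt_id z.2).sub_const x).add_const (L * (t - z.1))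
  have hC' : HasDerivAt (fun s => sq (x - s + L * (t - z.1))) (2 * max (x - z.2 + L * (t - z.1)) 0 * (-1)) z.2 := by
    apply (sq_hasDeriv _).comp z.2 (h := fun s => x - s + L * (t - z.1))
    simpa using ((hasDerivAt_id z.2).const_sub x).add_const (L * (t - z.1))
  refine ⟨_, _, hA.fun_mul (hB.fun_mul hC), (hB'.fun_mul hC').const_mul (sq (t - z.1)), ?_⟩
  have b0 : 0 ≤ max (z.2 - x + L * (t - z.1)) 0 := le_max_right _ _
  have c0 : 0 ≤ max (x - z.2 + L * (t - z.1)) 0 := le_max_right _ _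
  simp only
  have a1 := sq_nonneg' (t - z.1)
  have b1 := sq_nonneg' (z.2 - x + L * (t - z.1))
  have c1 := sq_nonneg' (x - z.2 + L * (t - z.1))
  set a := sq (t - z.1)
  set b := sq (z.2 - x + L * (t - z.1))
  set c := sq (x - z.2 + L * (t - z.1))
  set b' := max (z.2 - x + L * (t - z.1)) 0
  set c' := max (x - z.2 + L * (t - z.1)) 0
  have hd : |a * (2 * b' * 1 * c + b * (2 * c' * -1))| ≤ a * (2 * b' * c + b * (2 * c')) := by
    rw [abs_mul, abs_of_nonneg a1]
    apply mul_le_mul_of_nonneg_left _ a1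
    have p1 : 0 ≤ b' * c := mul_nonneg b0 c1
    have p2 : 0 ≤ b * c' := mul_nonneg b1 c0
    rw [abs_le]; constructor <;> nlinarith
  have := mul_le_mul_of_nonneg_left hd hL
  nlinarith

lemma ll_mul {g h : ℝ × ℝ → ℝ} (hg : LocallyLipschitz g) (hh : LocallyLipschitz h) :
    LocallyLipschitz (fun z => g z * h z) := by
  have h1 : ContDiff ℝ 1 (fun p : ℝ × ℝ => p.1 * p.2) := by fun_prop
  exact h1.locallyLipschitz.comp (hg.prodMk hh)

lemma chi0_locLip (t x L : ℝ) : LocallyLipschitz (chi0 t x L) := by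
  have h : ∀ g : ℝ × ℝ → ℝ, ContDiff ℝ 1 g → LocallyLipschitz (fun z => sq (g z)) := fun g hg =>
    sq_locLip.comp hg.locallyLipschitz
  have := ll_mul (h (fun z => t - z.1) (by fun_prop)) (ll_mul (h (fun z => z.2 - x + L * (t - z.1)) (by fun_prop))
    (h (fun z => x - z.2 + L * (t - z.1)) (by fun_prop)))
  exact this

lemma lip_affine {C : NNReal} (hV : LipschitzWith C V) (k lam b : ℝ) :
    ∃ C', LipschitzWith C' (fun z : ℝ × ℝ => V z - k * z.2 + lam * (z.1 - b)) := by
  have h1 : LipschitzWith ‖k‖₊ (fun z : ℝ × ℝ => k * z.2) := by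
    have := (lipschitzWith_smul k).comp (LipschitzWith.prod_snd (α := ℝ) (β := ℝ))
    simpa [Function.comp_def] using this
  have h2 : LipschitzWith ‖lam‖₊ (fun z : ℝ × ℝ => lam * (z.1 - b)) := by
    have := (lipschitzWith_smul lam).comp ((LipschitzWith.prod_fst (α := ℝ) (β := ℝ)).sub (LipschitzWith.const b))
    simpa [Function.comp_def] using this
  exact ⟨_, (hV.sub h1).add h2⟩
end

section

variable {R ρb : ℝ} {f : ℝ → ℝ} {c T T' ρL ρR : ℝ} {r V : ℝ × ℝ → ℝ}

lemma sqc_deriv (ε l s : ℝ) : HasDerivAt (fun s => sq (ε * s - l)) (2 * max (ε * s - l) 0 * ε) s := by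
  apply (sq_hasDeriv _).comp s (h := fun s => ε * s - l)
  simpa using ((hasDerivAt_id s).const_mul ε).sub_const l

lemma ramp_deriv (tb δ : ℝ) (s : ℝ) : HasDerivAt (fun s => Real.smoothTransition ((s - tb) / δ))
    (deriv Real.smoothTransition ((s - tb) / δ) * (1 / δ)) s := by
  apply (st_diff _).comp s (h := fun s => (s - tb) / δ)
  simpa using ((hasDerivAt_id s).sub_const tb).div_const δ

lemma cone_ae (hF : AF R ρb f) (h : Sol R ρb f c T ρL ρR r) (hV : Pot R ρb f T' r V) (hTT : T' ≤ T)
    {L : ℝ} (hL0 : 0 < L) (hL : ∀ x ∈ Icc 0 R, ∀ y ∈ Icc 0 R, |f x - f y| ≤ L * |x - y|)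
    {t tb x k l δ ε : ℝ} (htb : 0 ≤ tb) (htbt : tb < t) (ht : t < T') (hx : L * (t - tb) ≤ |x|) (hk : k ∈ Icc 0 R)
    (hδ : 0 < δ)
    (hsmall : ∀ s y, tb ≤ s → s ≤ tb + δ → |y - x| ≤ L * (t - s) → s ≤ t →
      ε * (V (s, y) - k * y + f k * (s - tb)) ≤ l) :
    ∀ᵐ z : ℝ × ℝ, tb < z.1 → |z.2 - x| < L * (t - z.1) →
      l < ε * (V z - k * z.2 + f k * (z.1 - tb)) → r z = k := by
  set χ : ℝ × ℝ → ℝ := fun z => Real.smoothTransition ((z.1 - tb) / δ) * chi0 t x L z with hχ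
  set φ : ℝ × ℝ → ℝ := fun z => sq (ε * (V z - k * z.2 + f k * (z.1 - tb)) - l) * χ z with hφ
  have hst : ∀ s : ℝ, 0 ≤ Real.smoothTransition s := Real.smoothTransition.nonneg
  have φ0 : ∀ z, 0 ≤ φ z := fun z => mul_nonneg (sq_nonneg' _) (mul_nonneg (hst _) (chi0_nonneg _ _ _ _))
  have hne : ∀ z, χ z ≠ 0 → tb < z.1 ∧ z.1 < t ∧ |z.2 - x| < L * (t - z.1) := by
    intro z hz
    have hc := chi0_ne (fun h0 => hz (by simp [hχ, h0]) : chi0 t x L z ≠ 0)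
    refine ⟨?_, hc⟩
    by_contra hh
    apply hz
    simp only [hχ]
    rw [Real.smoothTransition.zero_of_nonpos (div_nonpos_of_nonpos_of_nonneg (by linarith) hδ.le), zero_mul]
  have lφ : LocallyLipschitz φ := by
    obtain ⟨C', hC'⟩ := lip_affine hV.lip k (f k) tb
    apply ll_mul
    · have h1 : LocallyLipschitz (fun s => sq (ε * s - l)) := by
        have : ContDiff ℝ 1 (fun s : ℝ => ε * s - l) := by fun_prop
        exact sq_locLip.comp this.locallyLipschitz
      exact h1.comp hC'.locallyLipschitz
    · apply ll_mul _ (chi0_locLip _ _ _)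
      have : ContDiff ℝ 1 (fun z : ℝ × ℝ => (z.1 - tb) / δ) := by fun_prop
      exact st_locLip.comp this.locallyLipschitz
  obtain ⟨C, hC, hs, hsup⟩ := test_mk (T := T) lφ (a := tb) (b := t) (d := x - L * (t - tb)) (e := x + L * (t - tb))
    (by
      intro z hz
      have := hne z (fun h0 => hz (by simp [hφ, h0]))
      have h2 := abs_lt.1 this.2.2
      have h3 : L * (t - z.1) ≤ L * (t - tb) := by apply mul_le_mul_of_nonneg_left _ hL0.le; linarith
      refine ⟨⟨by linarith, by linarith⟩, ⟨by linarith, by linarith⟩⟩) (by linarith)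
  have hI : ∫ t in Ioi 0, φ (t, 0) = 0 := by
    apply integral_eq_zero_of_ae
    filter_upwards with s
    show φ (s, 0) = 0
    by_contra hh
    have := hne (s, 0) (fun h0 => hh (by simp [hφ, h0]))
    simp only [zero_sub, abs_neg] at this
    have h3 : L * (t - s) ≤ L * (t - tb) := by apply mul_le_mul_of_nonneg_left _ hL0.le; linarith
    linarith
  have hent := h.ent φ C hC hs φ0 hsup k hk
  rw [hI, mul_zero, mul_zero, add_zero] at hent
  have hz := ae_zero_of (h.int_ent hF hC hs hk) hent
    (g := fun z => sq (ε * (V z - k * z.2 + f k * (z.1 - tb)) - l) * (|r z - k| *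
      (Real.smoothTransition ((z.1 - tb) / δ) * (2 * max (t - z.1) 0 *
        (sq (z.2 - x + L * (t - z.1)) * sq (x - z.2 + L * (t - z.1))))))) (fun z => by
      have := sq_nonneg'
      refine mul_nonneg (this _) (mul_nonneg (abs_nonneg _) (mul_nonneg (hst _) (mul_nonneg ?_
        (mul_nonneg (this _) (this _)))))
      have := le_max_right (t - z.1) 0
      linarith) (by
      filter_upwards [hV.diff, hC.ae_differentiableAt] with z hVz hφz
      by_cases hzne : tb < z.1 ∧ z.1 < t ∧ |z.2 - x| < L * (t - z.1)
      swap
      · have hχz : χ z = 0 := by by_contra hh; exact hzne (hne z hh)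
        have hmin : IsLocalMin φ z := by
          filter_upwards with y
          simp only [hφ, hχz, mul_zero]; exact φ0 y
        have h0 := hmin.fderiv_eq_zero
        simp only [pdT, pdX, h0, zero_apply, mul_zero, add_zero]
        have hχ' : Real.smoothTransition ((z.1 - tb) / δ) * (2 * max (t - z.1) 0 *
          (sq (z.2 - x + L * (t - z.1)) * sq (x - z.2 + L * (t - z.1)))) = 0 := by
          by_cases h1 : tb < z.1
          · by_cases h2 : z.1 < t
            · have h3 : ¬ |z.2 - x| < L * (t - z.1) := fun h3 => hzne ⟨h1, h2, h3⟩
              rw [abs_lt, not_and_or] at h3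
              rcases h3 with h3 | h3
              · rw [sq_zero (z := z.2 - x + L * (t - z.1)) (by linarith)]; simp
              · rw [sq_zero (z := x - z.2 + L * (t - z.1)) (by linarith)]; simp
            · rw [max_eq_right (by linarith)]; simp
          · rw [Real.smoothTransition.zero_of_nonpos (div_nonpos_of_nonpos_of_nonneg (by linarith) hδ.le), zero_mul]
        rw [hχ']; simp
      obtain ⟨h1, h2, h3⟩ := hzne
      obtain ⟨dV, hX, hTt⟩ := hVz (by linarith)
      obtain ⟨a, d, ha, hd, had⟩ := chi0_deriv t x L hL0.le z
      have hpt := core_pt (f := f) (r := r) (h := fun s => sq (ε * s - l)) (χ := χ) (φ := φ) (k := k) (lam := f k) (b := tb)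
        (fun _ => rfl) hφz dV hX hTt (by linarith) (sqc_deriv ε l _) ((ramp_deriv tb δ z.1).fun_mul ha)
        (hd.const_mul (Real.smoothTransition ((z.1 - tb) / δ)))
      rw [hpt, sub_self]
      simp only [mul_zero, zero_mul, zero_add]
      by_cases hZ : sq (ε * (V z - k * z.2 + f k * (z.1 - tb)) - l) = 0
      · rw [hZ]; simp
      have hgt : tb + δ < z.1 := by
        by_contra hh
        apply hZ
        apply sq_zero
        have := hsmall z.1 z.2 h1.le (by linarith) h3.le h2.le
        linarith
      rw [(st_deriv_zero (y := (z.1 - tb) / δ) (by rw [lt_div_iff₀ hδ]; linarith)).deriv]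
      rw [← mul_neg]
      apply mul_le_mul_of_nonneg_left _ (sq_nonneg' _)
      have hf := eF_lip h.mem hk hL z d
      have hS := hst ((z.1 - tb) / δ)
      set S := Real.smoothTransition ((z.1 - tb) / δ)
      have e1 := mul_le_mul_of_nonneg_left hf hS
      have e2 := mul_le_mul_of_nonneg_left had (mul_nonneg hS (abs_nonneg (r z - k)))
      linarith)
  filter_upwards [hz] with z hz h1 h3 h4
  have h2 : z.1 < t := by
    by_contra hh
    have : L * (t - z.1) ≤ 0 := mul_nonpos_of_nonneg_of_nonpos hL0.le (by linarith)
    linarith [abs_nonneg (z.2 - x)]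
  by_contra hne'
  have h3' := abs_lt.1 h3
  have p1 := sq_pos (z := ε * (V z - k * z.2 + f k * (z.1 - tb)) - l) (by linarith)
  have p2 := sq_pos (z := z.2 - x + L * (t - z.1)) (by linarith)
  have p3 := sq_pos (z := x - z.2 + L * (t - z.1)) (by linarith)
  have p4 : 0 < |r z - k| := abs_pos.2 (sub_ne_zero.2 hne')
  have p5 : 0 < Real.smoothTransition ((z.1 - tb) / δ) :=
    Real.smoothTransition.pos_of_pos (div_pos (by linarith) hδ)
  have p6 : 0 < max (t - z.1) 0 := lt_max_of_lt_left (by linarith)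
  have : 0 < sq (ε * (V z - k * z.2 + f k * (z.1 - tb)) - l) * (|r z - k| *
      (Real.smoothTransition ((z.1 - tb) / δ) * (2 * max (t - z.1) 0 *
        (sq (z.2 - x + L * (t - z.1)) * sq (x - z.2 + L * (t - z.1)))))) := by positivity
  exact this.ne' hz

lemma cone_G (hF : AF R ρb f) (h : Sol R ρb f c T ρL ρR r) (hV : Pot R ρb f T' r V) (hTT : T' ≤ T)
    {L : ℝ} (hL0 : 0 < L) (hL : ∀ x ∈ Icc 0 R, ∀ y ∈ Icc 0 R, |f x - f y| ≤ L * |x - y|)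
    {t tb x k A ε : ℝ} (hε : |ε| = 1) (htb : 0 ≤ tb) (htbt : tb < t) (ht : t < T') (hx : L * (t - tb) ≤ |x|) (hk : k ∈ Icc 0 R)
    (hA : ∀ y, |y - x| ≤ L * (t - tb) → ε * (V (tb, y) - k * y) ≤ A) :
    ε * (V (t, x) - k * x + f k * (t - tb)) ≤ A := by
  apply le_of_forall_pos_le_add
  intro η hη
  set l := A + η with hl
  have hfb := hF.fpos
  set δ := η / f ρb with hδ
  have hδ0 : 0 < δ := div_pos hη hfb
  have hsmall : ∀ s y, tb ≤ s → s ≤ tb + δ → |y - x| ≤ L * (t - s) → s ≤ t →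
      ε * (V (s, y) - k * y + f k * (s - tb)) ≤ l := by
    intro s y h1 h2 h3 h4
    have h5 := hA y (h3.trans (mul_le_mul_of_nonneg_left (by linarith) hL0.le))
    have h6 := Pot.time hF h hV h1 (by linarith) y
    have h7 : |V (s, y) - V (tb, y) + f k * (s - tb)| ≤ η := by
      have a1 := hF.le_max hk
      have a2 := hF.2.2.1 _ hk
      have a3 : f k * (s - tb) ≤ f ρb * (s - tb) := mul_le_mul_of_nonneg_right a1 (by linarith)
      have a4 : 0 ≤ f k * (s - tb) := mul_nonneg a2 (by linarith)
      have a5 : f ρb * (s - tb) ≤ f ρb * δ := mul_le_mul_of_nonneg_left (by linarith) hfb.le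
      have a6 : f ρb * δ = η := by rw [hδ]; field_simp
      rw [abs_le]; constructor <;> nlinarith
    have h8 : ε * (V (s, y) - V (tb, y) + f k * (s - tb)) ≤ η := by
      apply (le_abs_self _).trans; rw [abs_mul, hε, one_mul]; exact h7
    nlinarith
  have hae := cone_ae hF h hV hTT hL0 hL htb htbt ht hx hk hδ0 hsmall
  obtain ⟨C', hC'⟩ := lip_affine hV.lip k (f k) tb
  set G : ℝ × ℝ → ℝ := fun z => max (ε * (V z - k * z.2 + f k * (z.1 - tb)) - l) 0 with hG
  have hGl : ∃ C2, LipschitzWith C2 G := by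
    have h1 : LipschitzWith ‖ε‖₊ (fun s : ℝ => ε * s) := by
      simpa using (lipschitzWith_smul ε : LipschitzWith ‖ε‖₊ (fun s : ℝ => ε • s))
    exact ⟨_, ((h1.comp hC').sub (LipschitzWith.const l)).max_const 0⟩
  obtain ⟨C2, hC2⟩ := hGl
  have hGc : Continuous G := hC2.continuous
  set Ω : Set (ℝ × ℝ) := {z | tb < z.1 ∧ |z.2 - x| < L * (t - z.1)} with hΩ
  have hΩo : IsOpen Ω := (isOpen_lt continuous_const continuous_fst).inter
    (isOpen_lt (f := fun z : ℝ × ℝ => |z.2 - x|) (g := fun z : ℝ × ℝ => L * (t - z.1)) (by fun_prop) (by fun_prop))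
  have hG0 : ∀ᵐ z, z ∈ Ω → pdT G z ≤ 0 := by
    filter_upwards [hae, hV.diff, hC2.ae_differentiableAt] with z h1 h2 hGz hz
    obtain ⟨hz1, hz2⟩ := hz
    have hzt : z.1 < t := by
      by_contra hh
      have : L * (t - z.1) ≤ 0 := mul_nonpos_of_nonneg_of_nonpos hL0.le (by linarith)
      linarith [abs_nonneg (z.2 - x)]
    obtain ⟨dV, hX, hTt⟩ := h2 (by linarith)
    by_cases hZ : l < ε * (V z - k * z.2 + f k * (z.1 - tb))
    · have hrk := h1 hz1 hz2 hZ
      have e1 : HasDerivAt (fun s => ε * (V (s, z.2) - k * z.2 + f k * (s - tb)) - l) (ε * (- fl f r z + f k)) z.1 := by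
        have h1 := pdT_has dV
        rw [hTt] at h1
        have h2 : HasDerivAt (fun s => V (s, z.2) - k * z.2 + f k * (s - tb)) (- fl f r z + f k) z.1 := by
          simpa using (h1.sub_const (k * z.2)).fun_add (((hasDerivAt_id z.1).sub_const tb).const_mul (f k))
        exact (h2.const_mul ε).sub_const l
      have e2 : (fun s => G (s, z.2)) =ᶠ[nhds z.1] (fun s => ε * (V (s, z.2) - k * z.2 + f k * (s - tb)) - l) := by
        have hc : ContinuousAt (fun s => ε * (V (s, z.2) - k * z.2 + f k * (s - tb)) - l) z.1 := e1.continuousAt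
        filter_upwards [hc.eventually (lt_mem_nhds (show (0:ℝ) < _ by simpa using hZ))] with s hs
        exact max_eq_left hs.le
      have e3 := (pdT_has hGz).unique (e1.congr_of_eventuallyEq e2)
      rw [e3, fl, if_pos (by linarith), hrk]; simp
    · have hmin : IsLocalMin G z := by
        filter_upwards with y
        have : G z = 0 := max_eq_right (by linarith)
        rw [this]; exact le_max_right _ _
      have h0 := hmin.fderiv_eq_zero
      simp [pdT, h0]
  have key : ∀ b ∈ Ioo tb t, G (b, x) ≤ 0 := by
    intro b hb
    by_cases hbd : b ≤ tb + δ
    · have := hsmall b x hb.1.le hbd (by simp; exact mul_nonneg hL0.le (by linarith [hb.2])) hb.2.le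
      exact max_le (by simp only; linarith) le_rfl
    · push Not at hbd
      have h1 := dirT_le hC2 hΩo hG0 (a := tb + δ) (b := b) (x := x) hbd.le (by
        intro u hu
        refine ⟨by linarith [hu.1], ?_⟩
        simp only [sub_self, abs_zero]
        apply mul_pos hL0; linarith [hu.2, hb.2])
      have h2 : G (tb + δ, x) = 0 := by
        apply max_eq_right
        have := hsmall (tb + δ) x (by linarith) le_rfl (by
          simp only [sub_self, abs_zero]; exact mul_nonneg hL0.le (by linarith [hb.2])) (by linarith [hb.2])
        simp only; linarith
      linarith
  have hfin := le_of_Ioo_time (G := fun s => G (s, x)) (by fun_prop) htbt key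
  have := (le_max_left _ _).trans hfin
  simp only at this
  linarith

lemma Sol.hj (hF : AF R ρb f) (h : Sol R ρb f c T ρL ρR r) {T'' : ℝ} (hV : Pot R ρb f T' r V) (hTT : T' ≤ T)
    {L : ℝ} (hL0 : 0 < L) (hL : ∀ x ∈ Icc 0 R, ∀ y ∈ Icc 0 R, |f x - f y| ≤ L * |x - y|) (hT : T'' < T') :
    HJ R (f ρb) L f T'' (fun t x => V (t, x)) where
  slope := fun t _ ht x y hxy => Pot.slope h hV (by linarith) hxy
  time := fun s t _ hst ht x => Pot.time hF h hV hst (by linarith) x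
  coneUp := by
    intro t s x k A h0 hs ht hx hk hA
    have := cone_G hF h hV hTT hL0 hL (t := t) (tb := t - s) (x := x) (k := k) (A := A) (ε := 1) (by simp) h0
      (by linarith) (by linarith) (by simpa using hx) hk (by simpa using hA)
    simpa using this
  coneDn := by
    intro t s x k A h0 hs ht hx hk hA
    have := cone_G hF h hV hTT hL0 hL (t := t) (tb := t - s) (x := x) (k := k) (A := -A) (ε := -1) (by simp) h0
      (by linarith) (by linarith) (by simpa using hx) hk (by
        intro y hy
        have := hA y (by simpa using hy)
        linarith)
    simp only [sub_sub_cancel] at this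
    linarith
end

section

variable {R ρb : ℝ} {f : ℝ → ℝ} {c T T' ρL ρR : ℝ} {r V : ℝ × ℝ → ℝ}

/-- indicator of the left/right quadrants -/
def qL (z : ℝ × ℝ) : ℝ := if 0 < z.1 ∧ z.2 ≤ 0 then 1 else 0
def qR (z : ℝ × ℝ) : ℝ := if 0 < z.1 ∧ 0 < z.2 then 1 else 0

lemma meas_qL : Measurable qL := by
  apply Measurable.ite _ measurable_const measurable_const
  exact (measurableSet_lt measurable_const measurable_fst).inter (measurableSet_le measurable_snd measurable_const)
lemma meas_qR : Measurable qR := by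
  apply Measurable.ite _ measurable_const measurable_const
  exact (measurableSet_lt measurable_const measurable_fst).inter (measurableSet_lt measurable_const measurable_snd)
lemma abs_qL (z) : |qL z| ≤ 1 := by unfold qL; split_ifs <;> simp
lemma abs_qR (z) : |qR z| ≤ 1 := by unfold qR; split_ifs <;> simp

lemma qL_test {φ : ℝ × ℝ → ℝ} (h : TestFn φ) : ∫ z, qL z * pdX φ z = ∫ t in Ioi 0, φ (t, 0) := by
  have hd : Differentiable ℝ φ := h.1.differentiable (by simp)
  obtain ⟨C, hC⟩ := lip_of_test h
  have hi : Integrable (fun z => pdX φ z) := by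
    simpa using (int_pd hC h.2 (g := fun _ => 1) measurable_const (B := 1) (by simp)).2
  have e : (fun z => qL z * pdX φ z) = (Ioi (0:ℝ) ×ˢ Iic (0:ℝ)).indicator (fun z => pdX φ z) := by
    funext z
    unfold qL Set.indicator
    simp only [mem_prod, mem_Ioi, mem_Iic]
    split_ifs <;> simp
  rw [e, integral_indicator (measurableSet_Ioi.prod measurableSet_Iic), Measure.volume_eq_prod,
    setIntegral_prod _ hi.integrableOn]
  apply setIntegral_congr_fun measurableSet_Ioi
  intro t _
  have hder : ∀ x, HasDerivAt (fun x => φ (t, x)) (pdX φ (t, x)) x := fun x => pdX_has (hd (t, x))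
  have hsl : ContDiff ℝ 1 (fun x => φ (t, x)) := by
    have := h.1.of_le (m := 1) (by exact_mod_cast le_top)
    fun_prop
  have := HasCompactSupport.integral_Iic_deriv_eq hsl (slice_suppX h.2 t) 0
  simp only [fun x => (hder x).deriv] at this
  exact this

lemma qR_test {φ : ℝ × ℝ → ℝ} (h : TestFn φ) : ∫ z, qR z * pdX φ z = - ∫ t in Ioi 0, φ (t, 0) := by
  have hd : Differentiable ℝ φ := h.1.differentiable (by simp)
  obtain ⟨C, hC⟩ := lip_of_test h
  have hi : Integrable (fun z => pdX φ z) := by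
    simpa using (int_pd hC h.2 (g := fun _ => 1) measurable_const (B := 1) (by simp)).2
  have e : (fun z => qR z * pdX φ z) = (Ioi (0:ℝ) ×ˢ Ioi (0:ℝ)).indicator (fun z => pdX φ z) := by
    funext z
    unfold qR Set.indicator
    simp only [mem_prod, mem_Ioi]
    split_ifs <;> simp
  rw [e, integral_indicator (measurableSet_Ioi.prod measurableSet_Ioi), Measure.volume_eq_prod,
    setIntegral_prod _ hi.integrableOn, ← integral_neg]
  apply setIntegral_congr_fun measurableSet_Ioi
  intro t _
  have hder : ∀ x, HasDerivAt (fun x => φ (t, x)) (pdX φ (t, x)) x := fun x => pdX_has (hd (t, x))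
  have hsl : ContDiff ℝ 1 (fun x => φ (t, x)) := by
    have := h.1.of_le (m := 1) (by exact_mod_cast le_top)
    fun_prop
  have := HasCompactSupport.integral_Ioi_deriv_eq hsl (slice_suppX h.2 t) 0
  simp only [fun x => (hder x).deriv] at this
  exact this

lemma g_lip {g : ℝ × ℝ → ℝ} (hg : Measurable g) (hg1 : ∀ z, |g z| ≤ 1) {K : ℝ}
    (H : ∀ φ, TestFn φ → ∫ z, g z * pdX φ z = K * ∫ t in Ioi 0, φ (t, 0))
    {φ : ℝ × ℝ → ℝ} {C : NNReal} (hφ : LipschitzWith C φ) (hs : HasCompactSupport φ)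
    (h0 : ∀ z, 0 ≤ φ z) (hT : tsupport φ ⊆ Iio T ×ˢ univ) :
    ∫ z, g z * pdX φ z = K * ∫ t in Ioi 0, φ (t, 0) := by
  have h1 := ent_lip (g1 := fun _ => 0) (g2 := g) measurable_const hg (B := 1) (K := -K) (T := T) (by simp) hg1
    (by intro φ hφ _ _; simp [H φ hφ]) hφ hs h0 hT
  have h2 := ent_lip (g1 := fun _ => 0) (g2 := fun z => - g z) measurable_const hg.neg (B := 1) (K := K) (T := T) (by simp)
    (by simpa using hg1)
    (by intro φ hφ _ _; simp [H φ hφ, integral_neg]) hφ hs h0 hT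
  simp only [zero_mul, zero_add, neg_mul, integral_neg] at h1 h2
  linarith

lemma u3 (hF : AF R ρb f) (h : Sol R ρb f c T ρL ρR r) {ε k : ℝ} (hε : ε = 1 ∨ ε = -1) (hk : k ∈ Icc 0 R)
    (h0 : ∀ y, 0 < -ε * y → 0 ≤ ε * (riem ρL ρR y - k))
    (hm : ∀ x ∈ Icc 0 R, ε * (x - k) < 0 → f x ≤ f k) {τ : ℝ} (hτ : τ < T) :
    ∀ᵐ z : ℝ × ℝ, 0 < z.1 → z.1 < τ → 0 < - ε * z.2 → 0 ≤ ε * (r z - k) := by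
  obtain ⟨L, hL0, hL⟩ := hF.lip
  have hst : ∀ s : ℝ, 0 ≤ Real.smoothTransition s := Real.smoothTransition.nonneg
  have hεε : ε * ε = 1 := by rcases hε with rfl | rfl <;> norm_num
  have key : ∀ A : ℕ, ∀ᵐ z : ℝ × ℝ, 0 < z.1 → z.1 < τ → 0 < - ε * z.2 → 0 < A + ε * z.2 - L * z.1 →
      0 ≤ ε * (r z - k) := by
    intro A
    set φ : ℝ × ℝ → ℝ := fun z => Real.smoothTransition (z.1 + 1) * (sq (τ - z.1) *
      (sq (A + ε * z.2 - L * z.1) * sq (-ε * z.2))) with hφ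
    have φ0 : ∀ z, 0 ≤ φ z := fun z => mul_nonneg (hst _) (mul_nonneg (sq_nonneg' _) (mul_nonneg (sq_nonneg' _) (sq_nonneg' _)))
    have hne : ∀ z, φ z ≠ 0 → -1 < z.1 ∧ z.1 < τ ∧ 0 < A + ε * z.2 - L * z.1 ∧ 0 < - ε * z.2 := by
      intro z hz
      refine ⟨?_, ?_, ?_, ?_⟩ <;> by_contra hh <;> apply hz <;> simp only [hφ]
      · rw [Real.smoothTransition.zero_of_nonpos (by linarith)]; simp
      · rw [sq_zero (z := τ - z.1) (by linarith)]; simp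
      · rw [sq_zero (z := A + ε * z.2 - L * z.1) (by linarith)]; simp
      · rw [sq_zero (z := -ε * z.2) (by linarith)]; simp
    have lφ : LocallyLipschitz φ := by
      have hsq : ∀ g : ℝ × ℝ → ℝ, ContDiff ℝ 1 g → LocallyLipschitz (fun z => sq (g z)) := fun g hg =>
        sq_locLip.comp hg.locallyLipschitz
      have h1 : ContDiff ℝ 1 (fun z : ℝ × ℝ => z.1 + 1) := by fun_prop
      exact ll_mul (st_locLip.comp h1.locallyLipschitz) (ll_mul (hsq (fun z => τ - z.1) (by fun_prop))
        (ll_mul (hsq (fun z => A + ε * z.2 - L * z.1) (by fun_prop)) (hsq (fun z => -ε * z.2) (by fun_prop))))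
    obtain ⟨C, hC, hs, hsup⟩ := test_mk (T := T) lφ (a := -1) (b := τ) (d := - (A + L)) (e := A + L)
      (by
        intro z hz
        obtain ⟨h1, h2, h3, h4⟩ := hne z hz
        have : -L ≤ L * z.1 := by nlinarith
        refine ⟨⟨h1.le, h2.le⟩, ?_⟩
        rw [mem_Icc, ← abs_le]
        have : |z.2| = - ε * z.2 := by
          rcases hε with rfl | rfl
          · rw [abs_of_neg (by linarith)]; ring
          · rw [abs_of_pos (by linarith)]; ring
        rw [this]; linarith) hτ
    have hI : ∫ t in Ioi 0, φ (t, 0) = 0 := by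
      apply integral_eq_zero_of_ae
      filter_upwards with s
      show φ (s, 0) = 0
      simp [hφ, sq_zero le_rfl]
    have hent := h.ent φ C hC hs φ0 hsup k hk
    rw [hI, mul_zero, mul_zero, add_zero] at hent
    have hw := h.weak hF hC hs φ0 hsup
    have hq1 := g_lip (T := T) meas_qL abs_qL (K := 1) (fun φ hφ => by rw [qL_test hφ]; ring) hC hs φ0 hsup
    have hq2 := g_lip (T := T) meas_qR abs_qR (K := -1) (fun φ hφ => by rw [qR_test hφ]; ring) hC hs φ0 hsup
    rw [hI, mul_zero] at hq1 hq2
    have ht0 := (lip_int_zero hC hs).1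
    have i1 := h.int_ent hF hC hs hk
    have i2 : Integrable (fun z => r z * pdT φ z + fl f r z * pdX φ z) :=
      (int_pd hC hs h.meas (B := R) (fun z => by rw [abs_of_nonneg (h.mem z).1]; exact (h.mem z).2)).1.add
      (int_pd hC hs (measurable_fl hF h.meas h.mem) (fl_le hF h.mem)).2
    have i3 := (int_pd hC hs meas_qL abs_qL).2
    have i4 := (int_pd hC hs meas_qR abs_qR).2
    have i5 : Integrable (fun z => pdT φ z) := by
      simpa using (int_pd hC hs (g := fun _ => 1) measurable_const (B := 1) (by simp)).1
    have j1 : Integrable (fun z => (eD r k z * pdT φ z + eF f r k z * pdX φ z) - ε * (r z * pdT φ z + fl f r z * pdX φ z)) :=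
      i1.sub (i2.const_mul ε)
    have j2 : Integrable (fun z => ε * k * pdT φ z + ε * f k * (qL z * pdX φ z + qR z * pdX φ z)) :=
      (i5.const_mul _).add ((i3.add i4).const_mul _)
    have v1 : ∫ z, ((eD r k z * pdT φ z + eF f r k z * pdX φ z) - ε * (r z * pdT φ z + fl f r z * pdX φ z))
       = ∫ z, (eD r k z * pdT φ z + eF f r k z * pdX φ z) := by
      rw [integral_sub i1 (i2.const_mul ε), integral_const_mul, hw]; simp
    have v2 : ∫ z, (ε * k * pdT φ z + ε * f k * (qL z * pdX φ z + qR z * pdX φ z)) = 0 := by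
      have i34 : Integrable (fun z => qL z * pdX φ z + qR z * pdX φ z) := i3.add i4
      rw [integral_add (i5.const_mul _) (i34.const_mul _), integral_const_mul, integral_const_mul,
        integral_add i3 i4, hq1, hq2, ht0]; simp
    have hz := ae_zero_of (j1.add j2) (by
        simp only [Pi.add_apply]
        rw [integral_add j1 j2, v1, v2, add_zero]; exact hent)
      (g := fun z => if 0 < z.1 ∧ ε * (r z - k) < 0 then 2 * (|r z - k| * (2 * max (τ - z.1) 0 *
        (sq (A + ε * z.2 - L * z.1) * sq (-ε * z.2)))) else 0) (fun z => by
        show 0 ≤ ite _ _ _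
        split_ifs
        · have := le_max_right (τ - z.1) 0
          have a1 := sq_nonneg' (A + ε * z.2 - L * z.1)
          have a2 := sq_nonneg' (-ε * z.2)
          positivity
        · exact le_rfl) (by
        filter_upwards [hC.ae_differentiableAt] with z dφ
        simp only [Pi.add_apply]
        by_cases hz1 : 0 < z.1
        · have hq : qL z + qR z = 1 := by
            unfold qL qR; rcases le_or_gt z.2 0 with h | h
            · simp [hz1, h, not_lt.2 h]
            · simp [hz1, h, not_le.2 h]
          have e0 : eD r k z * pdT φ z + eF f r k z * pdX φ z - ε * (r z * pdT φ z + fl f r z * pdX φ z) +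
            (ε * k * pdT φ z + ε * f k * (qL z * pdX φ z + qR z * pdX φ z)) =
            (|r z - k| - ε * (r z - k)) * pdT φ z + (Real.sign (r z - k) - ε) * (f (r z) - f k) * pdX φ z := by
            unfold eD eF fl; rw [if_pos hz1, if_pos hz1]
            linear_combination ε * f k * pdX φ z * hq
          rw [e0]
          by_cases hs0 : ε * (r z - k) < 0
          · rw [if_pos ⟨hz1, hs0⟩]
            have hab : |r z - k| = - (ε * (r z - k)) := by
              rcases hε with rfl | rfl
              · rw [abs_of_neg (by linarith)]; ring
              · rw [abs_of_pos (by linarith)]; ring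
            have hsg : Real.sign (r z - k) = - ε := by
              rcases hε with rfl | rfl
              · rw [Real.sign_of_neg (by linarith)]
              · rw [Real.sign_of_pos (by linarith)]; ring
            have hfk := hm _ (h.mem z) hs0
            have hlip := (neg_le_abs _).trans (hL _ (h.mem z) _ hk)
            have a1 := sq_nonneg' (τ - z.1)
            have a2 := sq_nonneg' (A + ε * z.2 - L * z.1)
            have a3 := sq_nonneg' (- ε * z.2)
            have hA1 : HasDerivAt (fun s => sq (τ - s)) (2 * max (τ - z.1) 0 * (-1)) z.1 := by
              apply (sq_hasDeriv _).comp z.1 (h := fun s => τ - s)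
              simpa using (hasDerivAt_id z.1).const_sub τ
            have hB : HasDerivAt (fun s => sq (A + ε * z.2 - L * s)) (2 * max (A + ε * z.2 - L * z.1) 0 * (-L)) z.1 := by
              apply (sq_hasDeriv _).comp z.1 (h := fun s => A + ε * z.2 - L * s)
              simpa using ((hasDerivAt_id z.1).const_mul L).const_sub (A + ε * z.2)
            have hB' : HasDerivAt (fun y => sq (A + ε * y - L * z.1)) (2 * max (A + ε * z.2 - L * z.1) 0 * ε) z.2 := by
              apply (sq_hasDeriv _).comp z.2 (h := fun y => A + ε * y - L * z.1)
              simpa using (((hasDerivAt_id z.2).const_mul ε).const_add (A:ℝ)).sub_const (L * z.1)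
            have hD' : HasDerivAt (fun y => sq (-ε * y)) (2 * max (-ε * z.2) 0 * (-ε)) z.2 := by
              apply (sq_hasDeriv _).comp z.2 (h := fun y => -ε * y)
              simpa using ((hasDerivAt_id z.2).const_mul (-ε))
            have hS : HasDerivAt (fun s => Real.smoothTransition (s + 1)) 0 z.1 := by
              have := (st_deriv_zero (y := z.1 + 1) (by linarith)).comp z.1 ((hasDerivAt_id z.1).add_const 1)
              simpa [Function.comp_def] using this
            have hS1 : Real.smoothTransition (z.1 + 1) = 1 := Real.smoothTransition.one_of_one_le (by linarith)
            have eT := (pdT_has dφ).unique (hS.fun_mul (hA1.fun_mul (hB.mul_const (sq (-ε * z.2)))))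
            have eX := (pdX_has dφ).unique (((hB'.fun_mul hD').const_mul (sq (τ - z.1))).const_mul
              (Real.smoothTransition (z.1 + 1)))
            simp only [hS1] at eT eX
            rw [eT, eX, hsg]
            have b0 : 0 ≤ max (A + ε * z.2 - L * z.1) 0 := le_max_right _ _
            have d0 : 0 ≤ max (-ε * z.2) 0 := le_max_right _ _
            rw [show |r z - k| - ε * (r z - k) = 2 * |r z - k| by rw [hab]; ring]
            have hE := hεε
            set B := sq (A + ε * z.2 - L * z.1)
            set D := sq (-ε * z.2)
            set a := sq (τ - z.1)
            set b' := max (A + ε * z.2 - L * z.1) 0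
            set d' := max (-ε * z.2) 0
            set Y := |r z - k|
            set F := f (r z) - f k
            have p1 : 0 ≤ (b' * a * D) * (L * Y + F) := mul_nonneg (by positivity) (by linarith)
            have p2 : 0 ≤ (d' * a * B) * (- F) := mul_nonneg (by positivity) (by simp only [F]; linarith)
            have : 2 * Y * (0 * (a * (B * D)) + 1 * (2 * max (τ - z.1) 0 * -1 * (B * D) + a * (2 * b' * -L * D))) +
              (-ε - ε) * F * (1 * (a * (2 * b' * ε * D + B * (2 * d' * -ε)))) =
              -(2 * (Y * (2 * max (τ - z.1) 0 * (B * D)))) - 4 * ((b' * a * D) * (L * Y + F)) - 4 * ((d' * a * B) * (- F)) := by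
              linear_combination (-4 * F * a * b' * D + 4 * F * a * B * d') * hE
            rw [this]; linarith
          · rw [if_neg (fun hh => hs0 hh.2), neg_zero]
            have hs1 : 0 ≤ ε * (r z - k) := not_lt.1 hs0
            have c1 : |r z - k| - ε * (r z - k) = 0 := by
              rcases hε with rfl | rfl
              · rw [abs_of_nonneg (by linarith)]; ring
              · rw [abs_of_nonpos (by linarith)]; ring
            have c2 : (Real.sign (r z - k) - ε) * (f (r z) - f k) = 0 := by
              by_cases hrk : r z = k
              · rw [hrk]; simp
              · rcases hε with rfl | rfl
                · rw [Real.sign_of_pos (lt_of_le_of_ne (by linarith) (fun h => hrk (by linarith)))]; ring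
                · rw [Real.sign_of_neg (lt_of_le_of_ne (by linarith) (fun h => hrk (by linarith)))]; ring
            rw [c1, c2]; simp
        · rw [if_neg (fun hh => hz1 hh.1), neg_zero]
          have hq : qL z = 0 ∧ qR z = 0 := by
            unfold qL qR; simp [hz1]
          unfold eD eF fl; rw [if_neg hz1, if_neg hz1, hq.1, hq.2]
          have e0 : (|r z - k| - ε * (r z - k)) * pdT φ z = 0 := by
            by_cases hy : 0 < -ε * z.2
            · have hs1 := h0 z.2 hy
              rw [← h.ini z (not_lt.1 hz1)] at hs1
              have c1 : |r z - k| - ε * (r z - k) = 0 := by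
                rcases hε with rfl | rfl
                · rw [abs_of_nonneg (by linarith)]; ring
                · rw [abs_of_nonpos (by linarith)]; ring
              rw [c1, zero_mul]
            · have hφz : φ z = 0 := by by_contra hh; exact hy (hne z hh).2.2.2
              have hmin : IsLocalMin φ z := by
                filter_upwards with y
                rw [hφz]; exact φ0 y
              simp [pdT, hmin.fderiv_eq_zero]
          linarith)
    filter_upwards [hz] with z hz h1 h2 h3 h4
    by_contra hh
    push Not at hh
    rw [if_pos ⟨h1, hh⟩] at hz
    have p1 := sq_pos h3
    have p2 := sq_pos h4
    have p3 : 0 < max (τ - z.1) 0 := lt_max_of_lt_left (by linarith)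
    have p4 : 0 < |r z - k| := abs_pos.2 (fun h => by rw [h] at hh; simp at hh)
    have : 0 < 2 * (|r z - k| * (2 * max (τ - z.1) 0 * (sq (A + ε * z.2 - L * z.1) * sq (-ε * z.2)))) := by positivity
    exact this.ne' hz
  have := ae_all_iff.2 key
  filter_upwards [this] with z hz h1 h2 h3
  obtain ⟨n, hn⟩ := exists_nat_gt (L * z.1 - ε * z.2)
  exact hz n h1 h2 h3 (by linarith)

lemma u3_left (hF : AF R ρb f) (h : Sol R ρb f c T ρL ρR r) (hρL : ρL ∈ Icc 0 R) (hV : Pot R ρb f T' r V) (hTT : T' ≤ T) {k : ℝ}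
    (hk : k ∈ Icc 0 ρb) (hkL : k ≤ ρL) {t : ℝ} (ht0 : 0 ≤ t) (ht : t < T') {x : ℝ} (hx : x ≤ 0) :
    V (t, x) ≤ V (t, 0) + k * x := by
  have hb := hF.2.2.2.2.2.1
  have hu := u3 hF h (ε := 1) (k := k) (Or.inl rfl) ⟨hk.1, hk.2.trans hb.2.le⟩ (by
    intro y hy; rw [riem, if_pos (by linarith)]; linarith) (by
    intro y hy hyk
    exact hF.strictMonoOn.monotoneOn ⟨hy.1, by linarith [hk.2]⟩ hk (by linarith)) (τ := (t + T') / 2) (by linarith)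
  have hΩ : IsOpen (Ioo (0:ℝ) ((t + T') / 2) ×ˢ Iio (0:ℝ)) := isOpen_Ioo.prod isOpen_Iio
  have hae : ∀ᵐ z, z ∈ (Ioo (0:ℝ) ((t + T') / 2) ×ˢ Iio (0:ℝ)) → k ≤ pdX V z := by
    filter_upwards [hu, hV.ae] with z h1 h2 hz
    have h3 : z.2 < 0 := hz.2
    have := h1 hz.1.1 hz.1.2 (by linarith)
    rw [(h2 (by linarith [hz.1.2])).1]; linarith
  have hc := hV.cont
  rcases hx.lt_or_eq with hx | rfl
  swap
  · simp
  have hcl : IsClosed {p : ℝ × ℝ | V (p.1, x) ≤ V (p.1, p.2) + k * (x - p.2)} :=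
      isClosed_le (by fun_prop) (by fun_prop)
  have hmem : (t, (0:ℝ)) ∈ closure (Ioo (0:ℝ) ((t + T') / 2) ×ˢ Ioo x 0) := by
    rw [closure_prod_eq, closure_Ioo (by linarith), closure_Ioo hx.ne]
    exact ⟨⟨ht0, by simp only; linarith⟩, right_mem_Icc.2 hx.le⟩
  have hsub : (Ioo (0:ℝ) ((t + T') / 2) ×ˢ Ioo x 0) ⊆ {p : ℝ × ℝ | V (p.1, x) ≤ V (p.1, p.2) + k * (x - p.2)} := by
    rintro p ⟨h1, h2⟩
    have := dirX_ge hV.lip hΩ hae (t := p.1) (a := x) (b := p.2) h2.1.le (fun u hu => ⟨h1, hu.2.trans_lt h2.2⟩)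
    simp only [mem_ofPred_eq]; linarith
  have := closure_minimal hsub hcl hmem
  simpa using this

lemma u3_right (hF : AF R ρb f) (h : Sol R ρb f c T ρL ρR r) (hV : Pot R ρb f T' r V) (hTT : T' ≤ T) {k : ℝ}
    (hk : k ∈ Icc ρb R) (hkR : ρR ≤ k) {t : ℝ} (ht0 : 0 ≤ t) (ht : t < T') {x : ℝ} (hx : 0 ≤ x) :
    V (t, x) ≤ V (t, 0) + k * x := by
  have hb := hF.2.2.2.2.2.1
  have hu := u3 hF h (ε := -1) (k := k) (Or.inr rfl) ⟨hb.1.le.trans hk.1, hk.2⟩ (by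
    intro y hy; rw [riem, if_neg (by linarith)]; linarith) (by
    intro y hy hyk
    exact hF.strictAntiOn.antitoneOn hk ⟨by linarith [hk.1], hy.2⟩ (by linarith)) (τ := (t + T') / 2) (by linarith)
  have hΩ : IsOpen (Ioo (0:ℝ) ((t + T') / 2) ×ˢ Ioi (0:ℝ)) := isOpen_Ioo.prod isOpen_Ioi
  have hae : ∀ᵐ z, z ∈ (Ioo (0:ℝ) ((t + T') / 2) ×ˢ Ioi (0:ℝ)) → pdX V z ≤ k := by
    filter_upwards [hu, hV.ae] with z h1 h2 hz
    have h3 : 0 < z.2 := hz.2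
    have := h1 hz.1.1 hz.1.2 (by linarith)
    rw [(h2 (by linarith [hz.1.2])).1]; linarith
  have hc := hV.cont
  rcases hx.lt_or_eq with hx | rfl
  swap
  · simp
  have hcl : IsClosed {p : ℝ × ℝ | V (p.1, x) ≤ V (p.1, p.2) + k * (x - p.2)} :=
      isClosed_le (by fun_prop) (by fun_prop)
  have hmem : (t, (0:ℝ)) ∈ closure (Ioo (0:ℝ) ((t + T') / 2) ×ˢ Ioo 0 x) := by
    rw [closure_prod_eq, closure_Ioo (by linarith), closure_Ioo hx.ne]
    exact ⟨⟨ht0, by simp only; linarith⟩, left_mem_Icc.2 hx.le⟩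
  have hsub : (Ioo (0:ℝ) ((t + T') / 2) ×ˢ Ioo 0 x) ⊆ {p : ℝ × ℝ | V (p.1, x) ≤ V (p.1, p.2) + k * (x - p.2)} := by
    rintro p ⟨h1, h2⟩
    have := dirX_le hV.lip hΩ hae (t := p.1) (a := p.2) (b := x) h2.2.le (fun u hu => ⟨h1, h2.1.trans_le hu.1⟩)
    simp only [mem_ofPred_eq]; linarith
  have := closure_minimal hsub hcl hmem
  simpa using this
end

section

variable {R ρb : ℝ} {f : ℝ → ℝ} {c T T' ρL ρR : ℝ} {r V : ℝ × ℝ → ℝ}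

lemma jp_ae (hF : AF R ρb f) (h : Sol R ρb f c T ρL ρR r) (hV : Pot R ρb f T' r V) (hTT : T' ≤ T) (hc : c ≤ f ρb)
    {t0 t1 a v η : ℝ} (ht1 : 0 ≤ t1) (ht10 : t1 < t0) (ht0 : t0 < T') (ha : 0 < a)
    (hsmall : ∀ z : ℝ × ℝ, z.1 ∈ Icc t1 t0 → z.2 ∈ Icc (-a) a → v - η < V z - ρb * z.2 + c * (z.1 - t0) →
      t1 + (t0 - t1) / 2 < z.1 ∧ |z.2| < a / 2) :
    ∀ᵐ z : ℝ × ℝ, t1 < z.1 → z.1 < t0 → |z.2| < a → v - η < V z - ρb * z.2 + c * (z.1 - t0) → r z = ρb := by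
  set δ := (t0 - t1) / 2 with hδ
  have hδ0 : 0 < δ := by simp only [hδ]; linarith
  have hb' := hF.2.2.2.2.2.1
  have hk : ρb ∈ Icc 0 R := ⟨hb'.1.le, hb'.2.le⟩
  have hfb := hF.fpos
  set χ : ℝ × ℝ → ℝ := fun z => (sq (t0 - z.1) * Real.smoothTransition ((z.1 - t1) / δ)) *
    (Real.smoothTransition ((z.2 - (-a)) / (a / 2)) * Real.smoothTransition ((-z.2 - (-a)) / (a / 2))) with hχ
  set φ : ℝ × ℝ → ℝ := fun z => sq (1 * (V z - ρb * z.2 + c * (z.1 - t0)) - (v - η)) * χ z with hφ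
  have hst : ∀ s : ℝ, 0 ≤ Real.smoothTransition s := Real.smoothTransition.nonneg
  have χ0 : ∀ z, 0 ≤ χ z := fun z => mul_nonneg (mul_nonneg (sq_nonneg' _) (hst _)) (mul_nonneg (hst _) (hst _))
  have φ0 : ∀ z, 0 ≤ φ z := fun z => mul_nonneg (sq_nonneg' _) (χ0 z)
  have hst0 : ∀ s, s ≤ 0 → ∀ d : ℝ, 0 < d → Real.smoothTransition (s / d) = 0 := fun s hs d hd =>
    Real.smoothTransition.zero_of_nonpos (div_nonpos_of_nonpos_of_nonneg hs hd.le)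
  have hne : ∀ z, χ z ≠ 0 → t1 < z.1 ∧ z.1 < t0 ∧ |z.2| < a := by
    intro z hz
    refine ⟨?_, ?_, ?_⟩
    · by_contra hh; apply hz; simp only [hχ]; rw [hst0 (z.1 - t1) (by linarith) δ hδ0]; simp
    · by_contra hh; apply hz; simp only [hχ]; rw [sq_zero (z := t0 - z.1) (by linarith)]; simp
    · rw [abs_lt]; constructor
      · by_contra hh; apply hz; simp only [hχ]; rw [hst0 (z.2 - (-a)) (by linarith) (a/2) (by linarith)]; simp
      · by_contra hh; apply hz; simp only [hχ]; rw [hst0 (-z.2 - (-a)) (by linarith) (a/2) (by linarith)]; simp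
  have lφ : LocallyLipschitz φ := by
    obtain ⟨C', hC'⟩ := lip_affine hV.lip ρb c t0
    have hsq : ∀ g : ℝ × ℝ → ℝ, ContDiff ℝ 1 g → LocallyLipschitz (fun z => sq (g z)) := fun g hg =>
        sq_locLip.comp hg.locallyLipschitz
    have hstl : ∀ g : ℝ × ℝ → ℝ, ContDiff ℝ 1 g → LocallyLipschitz (fun z => Real.smoothTransition (g z)) := fun g hg =>
        st_locLip.comp hg.locallyLipschitz
    apply ll_mul
    · have h1 : LocallyLipschitz (fun s => sq (1 * s - (v - η))) := by
        have : ContDiff ℝ 1 (fun s : ℝ => 1 * s - (v - η)) := by fun_prop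
        exact sq_locLip.comp this.locallyLipschitz
      exact h1.comp hC'.locallyLipschitz
    · exact ll_mul (ll_mul (hsq (fun z => t0 - z.1) (by fun_prop)) (hstl (fun z => (z.1 - t1) / δ) (by fun_prop)))
        (ll_mul (hstl (fun z => (z.2 - (-a)) / (a / 2)) (by fun_prop)) (hstl (fun z => (-z.2 - (-a)) / (a / 2)) (by fun_prop)))
  obtain ⟨C, hC, hs, hsup⟩ := test_mk (T := T) lφ (a := t1) (b := t0) (d := - a) (e := a)
    (by
      intro z hz
      have := hne z (fun h0 => hz (by simp [hφ, h0]))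
      have h2 := abs_lt.1 this.2.2
      exact ⟨⟨by linarith, by linarith⟩, ⟨by linarith, by linarith⟩⟩) (by linarith)
  have hent := h.ent φ C hC hs φ0 hsup ρb hk
  have hq1 := g_lip (T := T) meas_qL abs_qL (K := 1) (fun φ hφ => by rw [qL_test hφ]; ring) hC hs φ0 hsup
  have hq2 := g_lip (T := T) meas_qR abs_qR (K := -1) (fun φ hφ => by rw [qR_test hφ]; ring) hC hs φ0 hsup
  have i1 := h.int_ent hF hC hs hk
  have i3 := (int_pd hC hs meas_qL abs_qL).2
  have i4 := (int_pd hC hs meas_qR abs_qR).2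
  have i34 : Integrable (fun z => qL z * pdX φ z - qR z * pdX φ z) := i3.sub i4
  have hz := ae_zero_of (i1.add (i34.const_mul (f ρb - c))) (by
      simp only [Pi.add_apply]
      rw [integral_add i1 (i34.const_mul _), integral_const_mul, integral_sub i3 i4, hq1, hq2]
      have : 2 * ((1 - c / f ρb) * f ρb * ∫ t in Ioi 0, φ (t, 0)) =
        (f ρb - c) * (1 * (∫ t in Ioi 0, φ (t, 0)) - -1 * ∫ t in Ioi 0, φ (t, 0)) := by
        field_simp; ring
      linarith)
    (g := fun z => sq (1 * (V z - ρb * z.2 + c * (z.1 - t0)) - (v - η)) * (|r z - ρb| *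
      ((2 * max (t0 - z.1) 0 * Real.smoothTransition ((z.1 - t1) / δ)) * (Real.smoothTransition ((z.2 - (-a)) / (a / 2)) * Real.smoothTransition ((-z.2 - (-a)) / (a / 2))))))
    (fun z => by
      have := le_max_right (t0 - z.1) 0
      refine mul_nonneg (sq_nonneg' _) (mul_nonneg (abs_nonneg _) (mul_nonneg (mul_nonneg (by linarith) (hst _))
        (mul_nonneg (hst _) (hst _))))) (by
      filter_upwards [hV.diff, hC.ae_differentiableAt] with z hVz hφz
      simp only [Pi.add_apply]
      by_cases hzne : φ z = 0
      · have hmin : IsLocalMin φ z := by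
          filter_upwards with y
          rw [hzne]; exact φ0 y
        have h0 := hmin.fderiv_eq_zero
        simp only [pdT, pdX, h0, zero_apply, mul_zero, add_zero, sub_zero]
        have hz2 : sq (1 * (V z - ρb * z.2 + c * (z.1 - t0)) - (v - η)) = 0 ∨ χ z = 0 := mul_eq_zero.1 hzne
        rcases hz2 with hz2 | hz2
        · rw [hz2]; simp
        · have : (2 * max (t0 - z.1) 0 * Real.smoothTransition ((z.1 - t1) / δ)) * (Real.smoothTransition ((z.2 - (-a)) / (a / 2)) * Real.smoothTransition ((-z.2 - (-a)) / (a / 2))) = 0 := by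
            simp only [hχ, mul_eq_zero] at hz2
            rcases hz2 with (hz2 | hz2) | (hz2 | hz2)
            · have : max (t0 - z.1) 0 = 0 := by
                by_contra hh
                have : 0 < t0 - z.1 := by
                  by_contra h3; exact hh (max_eq_right (by linarith))
                exact (sq_pos this).ne' hz2
              rw [this]; simp
            · rw [hz2]; simp
            · rw [hz2]; simp
            · rw [hz2]; simp
          rw [this]; simp
      have hz1 : sq (1 * (V z - ρb * z.2 + c * (z.1 - t0)) - (v - η)) ≠ 0 := left_ne_zero_of_mul hzne
      obtain ⟨h1, h2, h3⟩ := hne z (right_ne_zero_of_mul hzne)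
      have h3' := abs_lt.1 h3
      have hZ : v - η < V z - ρb * z.2 + c * (z.1 - t0) := by
        by_contra hh; exact hz1 (sq_zero (by linarith))
      obtain ⟨g1, g2⟩ := hsmall z ⟨h1.le, h2.le⟩ ⟨h3'.1.le, h3'.2.le⟩ hZ
      have g2' := abs_lt.1 g2
      obtain ⟨dV, hX, hTt⟩ := hVz (by linarith)
      have ha2 : 0 < a / 2 := by linarith
      have u1 : (1:ℝ) < (z.1 - t1) / δ := by rw [lt_div_iff₀ hδ0]; linarith
      have u2 : (1:ℝ) < (z.2 - (-a)) / (a / 2) := by rw [lt_div_iff₀ ha2]; linarith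
      have u3 : (1:ℝ) < (-z.2 - (-a)) / (a / 2) := by rw [lt_div_iff₀ ha2]; linarith
      have s1 := Real.smoothTransition.one_of_one_le u1.le
      have s2 := Real.smoothTransition.one_of_one_le u2.le
      have s3 := Real.smoothTransition.one_of_one_le u3.le
      have d1 : HasDerivAt (fun s => Real.smoothTransition ((s - t1) / δ)) 0 z.1 := by
        have := ramp_deriv t1 δ z.1
        rwa [(st_deriv_zero u1).deriv, zero_mul] at this
      have d2 : HasDerivAt (fun s => Real.smoothTransition ((s - (-a)) / (a / 2))) 0 z.2 := by
        have := ramp_deriv (-a) (a/2) z.2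
        rwa [(st_deriv_zero u2).deriv, zero_mul] at this
      have d3 : HasDerivAt (fun s => Real.smoothTransition ((-s - (-a)) / (a / 2))) 0 z.2 := by
        have := ramp_deriv (-a) (a/2) (-z.2)
        rw [(st_deriv_zero u3).deriv, zero_mul] at this
        have := this.comp z.2 (hasDerivAt_neg z.2)
        simpa [Function.comp_def] using this
      have hA1 : HasDerivAt (fun s => sq (t0 - s)) (2 * max (t0 - z.1) 0 * (-1)) z.1 := by
        apply (sq_hasDeriv _).comp z.1 (h := fun s => t0 - s)
        simpa using (hasDerivAt_id z.1).const_sub t0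
      have hχt := (hA1.fun_mul d1).mul_const
        (Real.smoothTransition ((z.2 - (-a)) / (a / 2)) * Real.smoothTransition ((-z.2 - (-a)) / (a / 2)))
      have hχx := (d2.fun_mul d3).const_mul (sq (t0 - z.1) * Real.smoothTransition ((z.1 - t1) / δ))
      have hpt := core_pt (f := f) (r := r) (h := fun s => sq (1 * s - (v - η))) (χ := χ) (φ := φ) (k := ρb) (lam := c) (b := t0)
        (fun _ => rfl) hφz dV hX hTt (by linarith) (sqc_deriv 1 (v - η) _) hχt hχx
      have e2 : pdX φ z = 2 * max (1 * (V z - ρb * z.2 + c * (z.1 - t0)) - (v - η)) 0 * 1 * (r z - ρb) * χ z := by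
        have := (pdX_has hφz).unique (f := fun s => φ (z.1, s)) (by
          have h1 := pdX_has dV
          rw [hX] at h1
          have h2 : HasDerivAt (fun s => V (z.1, s) - ρb * s + c * (z.1 - t0)) (r z - ρb) z.2 := by
            have := (h1.fun_sub ((hasDerivAt_id z.2).const_mul ρb)).add_const (c * (z.1 - t0))
            simpa using this
          exact (HasDerivAt.comp z.2 (h₂ := fun s => sq (1 * s - (v - η))) (sqc_deriv 1 (v - η) _) h2).fun_mul hχx)
        rw [this]
        ring
      rw [hpt, e2]
      simp only [s1, s2, s3, mul_zero, mul_one, zero_mul, add_zero]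
      have hm0 := le_max_right (1 * (V z - ρb * z.2 + c * (z.1 - t0)) - (v - η)) 0
      set M := max (1 * (V z - ρb * z.2 + c * (z.1 - t0)) - (v - η)) 0
      have hχz := χ0 z
      have hq : (qL z - qR z) * (r z - ρb) ≤ |r z - ρb| := by
        unfold qL qR; rcases le_or_gt z.2 0 with hh | hh
        · simp only [hh, not_lt.2 hh, and_true, and_false, if_false, if_pos (show 0 < z.1 by linarith)]
          linarith [le_abs_self (r z - ρb)]
        · simp only [hh, not_le.2 hh, and_true, and_false, if_false, if_pos (show 0 < z.1 by linarith)]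
          linarith [neg_le_abs (r z - ρb)]
      have hp : 0 ≤ (f ρb - c) * (2 * M * χ z) * (|r z - ρb| - (qL z - qR z) * (r z - ρb)) :=
        mul_nonneg (mul_nonneg (by linarith) (by positivity)) (by linarith)
      nlinarith)
  filter_upwards [hz] with z hz h1 h2 h3 h4
  by_contra hne'
  have h3' := abs_lt.1 h3
  have p1 := sq_pos (z := 1 * (V z - ρb * z.2 + c * (z.1 - t0)) - (v - η)) (by linarith)
  have p4 : 0 < |r z - ρb| := abs_pos.2 (sub_ne_zero.2 hne')
  have p5 : 0 < Real.smoothTransition ((z.1 - t1) / δ) :=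
    Real.smoothTransition.pos_of_pos (div_pos (by linarith) hδ0)
  have p7 : 0 < Real.smoothTransition ((z.2 - (-a)) / (a / 2)) :=
    Real.smoothTransition.pos_of_pos (div_pos (by linarith) (by linarith))
  have p8 : 0 < Real.smoothTransition ((-z.2 - (-a)) / (a / 2)) :=
    Real.smoothTransition.pos_of_pos (div_pos (by linarith) (by linarith))
  have p6 : 0 < max (t0 - z.1) 0 := lt_max_of_lt_left (by linarith)
  have : 0 < sq (1 * (V z - ρb * z.2 + c * (z.1 - t0)) - (v - η)) * (|r z - ρb| *
      ((2 * max (t0 - z.1) 0 * Real.smoothTransition ((z.1 - t1) / δ)) * (Real.smoothTransition ((z.2 - (-a)) / (a / 2)) * Real.smoothTransition ((-z.2 - (-a)) / (a / 2))))) := by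
    positivity
  exact this.ne' hz

lemma Sol.jp (hF : AF R ρb f) (h : Sol R ρb f c T ρL ρR r) (hV : Pot R ρb f T' r V) (hTT : T' ≤ T) (hc : c ≤ f ρb)
    {T'' : ℝ} (hT : T'' < T') : JP ρb c T'' (fun t x => V (t, x)) := by
  intro t0 lam km kp a t1 ht1 ht10 ht0 ha hkp hkm hlam hU1 hU2
  set v := V (t0, 0) with hv
  set κ := min (km - ρb) (ρb - kp) with hκ
  have hκ0 : 0 < κ := lt_min (by linarith) (by linarith)
  set η := min ((c - lam) * ((t0 - t1) / 2)) (κ * (a / 2)) with hη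
  have hη0 : 0 < η := lt_min (mul_pos (by linarith) (by linarith)) (mul_pos hκ0 (by linarith))
  have hη1 : η ≤ (c - lam) * ((t0 - t1) / 2) := min_le_left _ _
  have hη2 : η ≤ κ * (a / 2) := min_le_right _ _
  have hbd : ∀ z : ℝ × ℝ, z.1 ∈ Icc t1 t0 → z.2 ∈ Icc (-a) a →
      V z - ρb * z.2 + c * (z.1 - t0) ≤ v - (c - lam) * (t0 - z.1) - κ * |z.2| := by
    intro z hz1 hz2
    rcases le_total z.2 0 with hh | hh
    · have h1 : V z ≤ v + lam * (t0 - z.1) + km * z.2 := hU1 z.1 hz1 z.2 ⟨hz2.1, hh⟩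
      rw [abs_of_nonpos hh]
      have h2 : κ ≤ km - ρb := min_le_left _ _
      nlinarith
    · have h1 : V z ≤ v + lam * (t0 - z.1) + kp * z.2 := hU2 z.1 hz1 z.2 ⟨hh, hz2.2⟩
      rw [abs_of_nonneg hh]
      have h2 : κ ≤ ρb - kp := min_le_right _ _
      nlinarith
  have hae := jp_ae hF h hV hTT hc ht1 ht10 (by linarith) ha (v := v) (η := η) (by
    intro z hz1 hz2 hZ
    have h1 := hbd z hz1 hz2
    have p1 : 0 ≤ (c - lam) * (t0 - z.1) := mul_nonneg (by linarith) (by linarith [hz1.2])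
    have p2 : 0 ≤ κ * |z.2| := by positivity
    constructor
    · have : (c - lam) * (t0 - z.1) < (c - lam) * ((t0 - t1) / 2) := by linarith
      have := lt_of_mul_lt_mul_left this (by linarith)
      linarith
    · have : κ * |z.2| < κ * (a / 2) := by linarith
      exact lt_of_mul_lt_mul_left this hκ0.le)
  have hVc := hV.cont
  have hZc : Continuous (fun z : ℝ × ℝ => V z - ρb * z.2 + c * (z.1 - t0)) := by fun_prop
  have hev : ∀ᶠ z in nhds (t0, (0:ℝ)), v - η < V z - ρb * z.2 + c * (z.1 - t0) := by
    apply hZc.continuousAt.eventually (lt_mem_nhds _)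
    simp only [mul_zero, sub_self, add_zero, sub_zero]
    linarith
  obtain ⟨d, hd0, hd⟩ := Metric.eventually_nhds_iff.1 hev
  set d' := min d (min a (t0 - t1)) with hd'
  have hd'0 : 0 < d' := lt_min hd0 (lt_min ha (by linarith))
  have e1 : d' ≤ d := min_le_left _ _
  have e2 : d' ≤ a := (min_le_right _ _).trans (min_le_left _ _)
  have e3 : d' ≤ t0 - t1 := (min_le_right _ _).trans (min_le_right _ _)
  have hΩ : IsOpen (Ioo (t0 - d') t0 ×ˢ Ioo (-d') d') := isOpen_Ioo.prod isOpen_Ioo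
  have hX : ∀ᵐ z, z ∈ (Ioo (t0 - d') t0 ×ˢ Ioo (-d') d') → ρb ≤ pdX V z := by
    filter_upwards [hae, hV.ae] with z h1 h2 hz
    obtain ⟨hz1, hz2⟩ := hz
    have hz2' : |z.2| < d' := abs_lt.2 hz2
    rw [(h2 (by linarith [hz1.2])).1]
    refine (h1 (by linarith [hz1.1]) hz1.2 (by linarith) (hd ?_)).ge
    rw [Prod.dist_eq, max_lt_iff, Real.dist_eq, Real.dist_eq, sub_zero]
    exact ⟨by rw [abs_lt]; constructor <;> linarith [hz1.1, hz1.2], by linarith⟩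
  have hfin := le_of_Ioo_time (G := fun t => ρb * (d' / 2) - (V (t, d' / 2) - V (t, 0))) (by fun_prop)
    (show t0 - d' < t0 by linarith) (a := 0) (by
      intro t ht
      have := dirX_ge hV.lip hΩ hX (t := t) (a := 0) (b := d' / 2) (by linarith) (fun u hu => ⟨ht, by
        constructor <;> simp only <;> linarith [hu.1, hu.2]⟩)
      linarith)
  have := hU2 t0 ⟨ht10.le, le_rfl⟩ (d' / 2) ⟨by linarith, by linarith⟩
  simp only [sub_self, mul_zero, add_zero] at this
  nlinarith
end

section

variable {R ρb : ℝ} {f : ℝ → ℝ} {c T T' ρL ρR : ℝ} {r V : ℝ × ℝ → ℝ}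

/-- lower bound on the potential at the interface coming from the left -/
lemma low_left (hF : AF R ρb f) (h : Sol R ρb f c T ρL ρR r) (hL : ρL ∈ Icc 0 R) (hV : Pot R ρb f T' r V)
    (hTT : T' ≤ T) {t : ℝ} (ht0 : 0 ≤ t) (ht : t < T') : -(f (min ρL ρb)) * t ≤ V (t, 0) := by
  have hb := hF.2.2.2.2.2.1
  obtain ⟨L, hL0, hLip⟩ := hF.lip
  have hJ := h.hj hF hV hTT hL0 hLip (show (t : ℝ) < T' from ht)
  have h0 : ∀ x ≤ 0, V (0, x) = ρL * x := fun x hx => hV.initL h (by linarith) hx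
  rcases le_total ρL ρb with hle | hle
  · rw [min_eq_left hle]
    have h1 := hJ.far hL hL0 h0 ⟨ht0, le_rfl⟩ (x := -(L * t)) le_rfl
    have h2 := u3_left hF h hL hV hTT (k := ρL) ⟨hL.1, hle⟩ le_rfl ht0 ht (x := -(L * t))
      (by nlinarith)
    linarith
  · rw [min_eq_right hle]
    have h1 := (hJ.time 0 t le_rfl ht0 le_rfl 0).1
    simp only [h0 0 le_rfl] at h1
    linarith

lemma low_right (hF : AF R ρb f) (h : Sol R ρb f c T ρL ρR r) (hL : ρR ∈ Icc 0 R) (hV : Pot R ρb f T' r V)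
    (hTT : T' ≤ T) {t : ℝ} (ht0 : 0 ≤ t) (ht : t < T') : -(f (max ρR ρb)) * t ≤ V (t, 0) := by
  have hb := hF.2.2.2.2.2.1
  obtain ⟨L, hL0, hLip⟩ := hF.lip
  have hJ := h.hj hF hV hTT hL0 hLip (show (t : ℝ) < T' from ht)
  have h0 : ∀ x, 0 ≤ x → V (0, x) = ρR * x := fun x hx => hV.initR h (by linarith) hx
  rcases le_total ρb ρR with hle | hle
  · rw [max_eq_left hle]
    have h1 := hJ.refl.far (ρL := R - ρR) ⟨by linarith [hL.2], by linarith [hL.1]⟩ hL0 (by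
      intro x hx
      rw [h0 (-x) (by linarith)]; ring) ⟨ht0, le_rfl⟩ (x := -(L * t)) le_rfl
    have h2 := u3_right hF h hV hTT (k := ρR) ⟨hle, hL.2⟩ le_rfl ht0 ht (x := L * t)
      (by nlinarith)
    simp only [neg_neg, sub_sub_cancel] at h1
    linarith
  · rw [max_eq_right hle]
    have h1 := (hJ.time 0 t le_rfl ht0 le_rfl 0).1
    simp only [h0 0 le_rfl] at h1
    linarith

/-- upper bound on the potential at the interface -/
lemma up_int (hF : AF R ρb f) (h : Sol R ρb f c T ρL ρR r) (hL : ρL ∈ Icc 0 R) (hR : ρR ∈ Icc 0 R)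
    (hV : Pot R ρb f T' r V)
    (hTT : T' ≤ T) (hc : c ≤ f ρb) {F : ℝ} (h1 : F ≤ f (min ρL ρb)) (h2 : F ≤ f (max ρR ρb)) (h3 : F ≤ c)
    {s t : ℝ} (hs : 0 ≤ s) (hst : s ≤ t) (ht : t < T') : V (t, 0) - V (s, 0) ≤ -F * (t - s) := by
  have hb := hF.2.2.2.2.2.1
  obtain ⟨L, hL0, hLip⟩ := hF.lip
  have hJ := h.hj hF hV hTT hL0 hLip ht
  have hmin : min ρL ρb ∈ Icc 0 ρb := ⟨le_min hL.1 hb.1.le, min_le_right _ _⟩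
  have hmax : max ρR ρb ∈ Icc ρb R := ⟨le_max_right _ _, max_le hR.2 hb.2.le⟩
  exact hJ.interface hF.1.le hF.fpos.le hL0 hb.1.le hb.2.le hmin.1 hmin.2 hmax.1 hmax.2
    hF.strictMonoOn.monotoneOn hF.strictAntiOn.antitoneOn (h.jp hF hV hTT hc ht)
    (fun t' h0 h1 x hx => u3_left hF h hL hV hTT hmin (min_le_left _ _) h0 (by linarith) hx)
    (fun t' h0 h1 x hx => u3_right hF h hV hTT hmax (le_max_left _ _) h0 (by linarith) hx)
    h1 h2 h3 hs hst le_rfl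

lemma uniq_c {r1 r2 : ℝ × ℝ → ℝ} (hF : AF R ρb f) (h1 : Sol R ρb f c T ρL ρR r1)
    (h2 : Sol R ρb f c T ρL ρR r2) (hL : ρL ∈ Icc 0 R) (hR : ρR ∈ Icc 0 R) (hc : c ≤ f ρb)
    (hFc : min (f (min ρL ρb)) (f (max ρR ρb)) ≤ c) :
    ∀ᵐ z : ℝ × ℝ, 0 < z.1 → z.1 < T → r1 z = r2 z := by
  have hb := hF.2.2.2.2.2.1
  obtain ⟨L, hL0, hLip⟩ := hF.lip
  have key : ∀ n : ℕ, ∀ᵐ z : ℝ × ℝ, 0 < z.1 → z.1 < T - 1 / (n + 1) → r1 z = r2 z := by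
    intro n
    set T2 : ℝ := T - 1 / (n + 1) with hT2
    have hT2T : T2 < T := by rw [hT2]; have : (0:ℝ) < 1 / (n + 1) := by positivity
                             linarith
    by_cases hpos : T2 ≤ 0
    · filter_upwards with z a b
      linarith
    push Not at hpos
    set T1 := (T2 + T) / 2 with hT1
    have hT1T : T1 < T := by linarith
    have hT21 : T2 < T1 := by linarith
    have hT10 : 0 < T1 := by linarith
    obtain ⟨V1, a1, a2, a3⟩ := exists_pot hF h1 hT1T hT10
    obtain ⟨V2, b1, b2, b3⟩ := exists_pot hF h2 hT1T hT10
    have hV1 : Pot R ρb f T1 r1 V1 := ⟨a1, a2, a3⟩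
    have hV2 : Pot R ρb f T1 r2 V2 := ⟨b1, b2, b3⟩
    have hJ1 := h1.hj hF hV1 hT1T.le hL0 hLip hT21
    have hJ2 := h2.hj hF hV2 hT1T.le hL0 hLip hT21
    set F := min (f (min ρL ρb)) (f (max ρR ρb)) with hFd
    have val : ∀ {r V : ℝ × ℝ → ℝ}, Sol R ρb f c T ρL ρR r → Pot R ρb f T1 r V → ∀ t ∈ Icc 0 T2,
        V (t, 0) = - F * t := by
      intro r V h hV t ht
      have htT : t < T1 := by linarith [ht.2]
      have u := up_int hF h hL hR hV hT1T.le hc (min_le_left _ _) (min_le_right _ _) hFc le_rfl ht.1 htT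
      have hz : V (0, 0) = 0 := by rw [hV.initL h hT10 le_rfl]; simp
      have l1 := low_left hF h hL hV hT1T.le ht.1 htT
      have l2 := low_right hF h hR hV hT1T.le ht.1 htT
      rw [← hFd] at u
      apply le_antisymm
      · linarith
      · rcases min_choice (f (min ρL ρb)) (f (max ρR ρb)) with hh | hh
        · rw [hFd, hh]; exact l1
        · rw [hFd, hh]; exact l2
    have huniq := hJ1.unique hJ2 hF.1.le hF.fpos.le hL0 hL hR
      (fun x hx => hV1.initL h1 hT10 hx) (fun x hx => hV2.initL h2 hT10 hx)
      (fun x hx => hV1.initR h1 hT10 hx) (fun x hx => hV2.initR h2 hT10 hx)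
      (fun t ht => by rw [val h1 hV1 t ht, val h2 hV2 t ht])
    filter_upwards [a3, b3] with z hz1 hz2 hz0 hzT
    rw [← (hz1 (by linarith)).1, ← (hz2 (by linarith)).1]
    have heq : V1 =ᶠ[nhds z] V2 := by
      have ho : IsOpen {z : ℝ × ℝ | 0 < z.1 ∧ z.1 < T2} :=
        (isOpen_lt continuous_const continuous_fst).inter (isOpen_lt continuous_fst continuous_const)
      filter_upwards [ho.mem_nhds (show z ∈ {z : ℝ × ℝ | 0 < z.1 ∧ z.1 < T2} from ⟨hz0, hzT⟩)] with y hy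
      exact huniq y.1 ⟨hy.1.le, hy.2.le⟩ y.2
    unfold pdX
    rw [heq.fderiv_eq]
  filter_upwards [ae_all_iff.2 key] with z hz h0 hT
  obtain ⟨n, hn⟩ := exists_nat_one_div_lt (show 0 < T - z.1 by linarith)
  exact hz n h0 (by linarith)

end

section

variable {R ρb : ℝ} {f : ℝ → ℝ} {c T T' ρL ρR : ℝ} {r V : ℝ × ℝ → ℝ}

lemma Pot.slice (hV : Pot R ρb f T' r V) : ∀ᵐ t : ℝ, t < T' → ∀ a b, a ≤ b →
    ∫ x in Ioc a b, r (t, x) = V (t, b) - V (t, a) := by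
  have h1 : ∀ᵐ t : ℝ, ∀ᵐ x : ℝ, t < T' → DifferentiableAt ℝ V (t, x) ∧ pdX V (t, x) = r (t, x) := by
    apply Measure.ae_ae_of_ae_prod (μ := volume) (ν := volume)
      (p := fun z : ℝ × ℝ => z.1 < T' → DifferentiableAt ℝ V z ∧ pdX V z = r z)
    rw [← Measure.volume_eq_prod]
    filter_upwards [hV.diff] with z hz h
    exact ⟨(hz h).1, (hz h).2.1⟩
  filter_upwards [h1] with t ht htT a b hab
  have hl : LipschitzWith (R + f ρb).toNNReal (fun x => V (t, x)) := by
    apply LipschitzWith.of_dist_le_mul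
    intro x y
    have := hV.lip.dist_le_mul (t, x) (t, y)
    rw [Prod.dist_eq, dist_self, max_eq_right dist_nonneg] at this
    exact this
  have := (hl.lipschitzOnWith (s := uIcc a b)).absolutelyContinuousOnInterval.integral_deriv_eq_sub
  rw [intervalIntegral.integral_of_le hab] at this
  rw [← this]
  apply integral_congr_ae
  apply ae_restrict_of_ae
  filter_upwards [ht] with x hx
  obtain ⟨d, e⟩ := hx htT
  rw [← e]
  exact (pdX_has d).deriv.symm

/-- a globally monotone extension of the weight -/
def wx (w : ℝ → ℝ) (x : ℝ) : ℝ := w (min x 0)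

lemma AW.wx_mono {w : ℝ → ℝ} (hW : AW w) : Monotone (wx w) := fun x y hxy =>
  hW.2.1 (min_le_right x 0) (min_le_right y 0) (min_le_min_right 0 hxy)

lemma wx_eq {w : ℝ → ℝ} {x : ℝ} (hx : x ≤ 0) : wx w x = w x := by
  unfold wx; rw [min_eq_left hx]

lemma AW.w0 {w : ℝ → ℝ} (hW : AW w) : 0 ≤ w 0 := hW.1 0 le_rfl

lemma AW.le_w0 {w : ℝ → ℝ} (hW : AW w) {x : ℝ} (hx : x ≤ 0) : w x ≤ w 0 := hW.2.1 hx self_mem_Iic hx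

lemma AW.pos {w : ℝ → ℝ} (hW : AW w) : ∃ b > 0, 0 < w (-b) := by
  by_contra hcon
  push Not at hcon
  have h0 : ∫ x in Iic (0:ℝ), w x = 0 := by
    rw [integral_Iic_eq_integral_Iio]
    apply setIntegral_eq_zero_of_forall_eq_zero
    intro x hx
    have h1 := hcon (-x) (by linarith [mem_Iio.1 hx])
    rw [neg_neg] at h1
    exact le_antisymm h1 (hW.1 x (mem_Iio.1 hx).le)
  rw [hW.2.2.1] at h0
  norm_num at h0

/-- layer cake representation of integrals against the monotone weight -/
lemma AW.layer {w : ℝ → ℝ} (hW : AW w) {g : ℝ → ℝ} (hg : Measurable g) {K : ℝ} (hK : ∀ x, |g x| ≤ K) :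
    ∃ G : ℝ → ℝ, IntegrableOn G (Ioc 0 (w 0)) ∧ ∫ x in Iic (0:ℝ), w x * g x = ∫ s in Ioc 0 (w 0), G s ∧
      ∀ s ∈ Ioc 0 (w 0), ∃ a, 0 ≤ a ∧ G s = ∫ x in Ioc (-a) 0, g x ∧
        ∀ b, 0 ≤ b → s < w (-b) → b ≤ a := by
  obtain ⟨h1, h2, h3, iw, hiw, h4⟩ := hW
  have hW : AW w := ⟨h1, h2, h3, iw, hiw, h4⟩
  have hK0 : 0 ≤ K := (abs_nonneg _).trans (hK 0)
  have hwm : Measurable (wx w) := hW.wx_mono.measurable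
  set H : ℝ → ℝ → ℝ := fun x s => if s < wx w x then g x else 0 with hH
  have hHm : Measurable (Function.uncurry H) := by
    apply Measurable.ite _ (hg.comp measurable_fst) measurable_const
    exact measurableSet_lt measurable_snd (hwm.comp measurable_fst)
  have hint : Integrable (Function.uncurry H)
      ((volume.restrict (Ioc (-iw) 0)).prod (volume.restrict (Ioc 0 (w 0)))) := by
    refine Integrable.of_bound (C := K) hHm.aestronglyMeasurable ?_
    filter_upwards with z
    simp only [Function.uncurry, hH, Real.norm_eq_abs]
    split_ifs
    · exact hK _
    · simpa using hK0
  refine ⟨fun s => ∫ x in Ioc (-iw) 0, H x s, hint.integral_prod_right, ?_, ?_⟩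
  · rw [← integral_integral_swap hint]
    have e1 : ∫ x in Iic (0:ℝ), w x * g x = ∫ x in Ioc (-iw) 0, w x * g x := by
      apply setIntegral_eq_of_subset_of_forall_sdiff_eq_zero measurableSet_Iic Ioc_subset_Iic_self
      intro x hx
      have : x ≤ -iw := by
        by_contra hc
        exact hx.2 ⟨by linarith, hx.1⟩
      rw [h4 x this, zero_mul]
    rw [e1]
    apply setIntegral_congr_fun measurableSet_Ioc
    intro x hx
    simp only
    have hw0 := h1 x hx.2
    have hw1 := hW.le_w0 hx.2
    have e2 : ∀ s, H x s = (Iio (w x)).indicator (fun _ => g x) s := by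
      intro s
      simp only [hH, indicator, mem_Iio, wx_eq hx.2]
    simp_rw [e2]
    rw [setIntegral_indicator measurableSet_Iio]
    have e3 : Ioc 0 (w 0) ∩ Iio (w x) = Ioo 0 (w x) := by
      ext s; simp only [mem_inter_iff, mem_Ioc, mem_Iio, mem_Ioo]
      constructor
      · rintro ⟨⟨a, b⟩, c⟩; exact ⟨a, c⟩
      · rintro ⟨a, c⟩; exact ⟨⟨a, by linarith⟩, c⟩
    rw [e3]
    simp [hw0]
  · intro s hs
    set A := {x : ℝ | x ≤ 0 ∧ s < w x} with hA
    have hAb : ∀ x ∈ A, -iw ≤ x := by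
      intro x hx
      by_contra hc
      have := h4 x (by linarith)
      have := hx.2
      linarith [hs.1]
    by_cases hne : A.Nonempty
    · set a := - sInf A with ha
      have hbdd : BddBelow A := ⟨-iw, hAb⟩
      have ha0 : 0 ≤ a := by
        obtain ⟨x, hx⟩ := hne
        have := csInf_le hbdd hx
        linarith [hx.1]
      have haiw : a ≤ iw := by
        have := le_csInf hne hAb
        linarith
      refine ⟨a, ha0, ?_, ?_⟩
      · have e : ∀ᵐ x : ℝ, x ∈ Ioc (-iw) 0 → H x s = (Ioc (-a) 0).indicator g x := by
          have : ∀ᵐ x : ℝ, x ≠ -a := by simp [ae_iff]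
          filter_upwards [this] with x hxa hx
          simp only [hH, indicator, wx_eq hx.2]
          by_cases hs' : s < w x
          · have : -a ≤ x := by rw [ha, neg_neg]; exact csInf_le hbdd ⟨hx.2, hs'⟩
            rw [if_pos hs', if_pos ⟨lt_of_le_of_ne this (Ne.symm hxa), hx.2⟩]
          · rw [if_neg hs', if_neg]
            intro hx'
            have hlt : sInf A < x := by have := hx'.1; rw [ha, neg_neg] at this; exact this
            obtain ⟨y, hy, hyx⟩ := exists_lt_of_csInf_lt hne hlt
            exact hs' (hy.2.trans_le (h2 hy.1 hx.2 hyx.le))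
        simp only
        rw [setIntegral_congr_ae measurableSet_Ioc e, setIntegral_indicator measurableSet_Ioc]
        congr 2
        rw [inter_eq_right]
        exact Ioc_subset_Ioc_left (by linarith)
      · intro b hb hsb
        have := csInf_le hbdd (show -b ∈ A from ⟨by linarith, hsb⟩)
        linarith
    · refine ⟨0, le_rfl, ?_, ?_⟩
      · rw [neg_zero, Ioc_self]
        simp only [Measure.restrict_empty, integral_zero_measure]
        apply setIntegral_eq_zero_of_forall_eq_zero
        intro x hx
        simp only [hH, wx_eq hx.2]
        rw [if_neg]
        intro hs'
        exact hne ⟨x, hx.2, hs'⟩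
      · intro b hb hsb
        exact absurd ⟨-b, by linarith, hsb⟩ hne

lemma AW.int_ge {w : ℝ → ℝ} (hW : AW w) {g : ℝ → ℝ} (hg : Measurable g) {K m : ℝ} (hK : ∀ x, |g x| ≤ K)
    (hm : ∀ a, 0 ≤ a → m ≤ ∫ x in Ioc (-a) 0, g x) : m * w 0 ≤ ∫ x in Iic (0:ℝ), w x * g x := by
  obtain ⟨G, hG, e, hG2⟩ := hW.layer hg hK
  rw [e]
  have : m * w 0 = ∫ s in Ioc 0 (w 0), m := by simp [hW.w0, mul_comm]
  rw [this]
  apply setIntegral_mono_on (by simp) hG measurableSet_Ioc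
  intro s hs
  obtain ⟨a, ha, e, -⟩ := hG2 s hs
  rw [e]; exact hm a ha

lemma AW.int_le {w : ℝ → ℝ} (hW : AW w) {g : ℝ → ℝ} (hg : Measurable g) {K m : ℝ} (hK : ∀ x, |g x| ≤ K)
    (hm : ∀ a, 0 ≤ a → ∫ x in Ioc (-a) 0, g x ≤ m) : ∫ x in Iic (0:ℝ), w x * g x ≤ m * w 0 := by
  have := hW.int_ge (g := fun x => - g x) hg.neg (K := K) (m := -m) (by simpa using hK) (by
    intro a ha
    rw [integral_neg]; linarith [hm a ha])
  simp only [mul_neg, integral_neg] at this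
  linarith

lemma AW.int_neg {w : ℝ → ℝ} (hW : AW w) {g : ℝ → ℝ} (hg : Measurable g) {K δ b : ℝ} (hK : ∀ x, |g x| ≤ K)
    (hb : 0 ≤ b) (hwb : 0 < w (-b)) (hδ : 0 < δ)
    (hm : ∀ a, 0 ≤ a → ∫ x in Ioc (-a) 0, g x ≤ 0) (hm2 : ∀ a, b ≤ a → ∫ x in Ioc (-a) 0, g x ≤ -δ) :
    ∫ x in Iic (0:ℝ), w x * g x < 0 := by
  obtain ⟨G, hG, e, hG2⟩ := hW.layer hg hK
  rw [e]
  have hb0 := hW.le_w0 (show -b ≤ 0 by linarith)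
  have h1 : ∫ s in Ioc 0 (w 0), G s ≤ ∫ s in Ioc 0 (w 0), (Ioo 0 (w (-b))).indicator (fun _ => -δ) s := by
    apply setIntegral_mono_on hG _ measurableSet_Ioc
    · intro s hs
      obtain ⟨a, ha, e, h3⟩ := hG2 s hs
      rw [e]
      by_cases hsb : s < w (-b)
      · rw [indicator_of_mem (show s ∈ Ioo 0 (w (-b)) from ⟨hs.1, hsb⟩)]
        exact hm2 a (h3 b hb hsb)
      · rw [indicator_of_notMem (fun h => hsb h.2)]
        exact hm a ha
    · apply Integrable.indicator _ measurableSet_Ioo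
      simp
  rw [setIntegral_indicator measurableSet_Ioo] at h1
  have e3 : Ioc 0 (w 0) ∩ Ioo 0 (w (-b)) = Ioo 0 (w (-b)) := by
    rw [inter_eq_right]
    intro s hs; exact ⟨hs.1, by linarith [hs.2]⟩
  rw [e3] at h1
  simp [hwb.le] at h1
  nlinarith

lemma AW.integ {w : ℝ → ℝ} (hW : AW w) : IntegrableOn w (Iic 0) := by
  by_contra h
  have := integral_undef h
  rw [hW.2.2.1] at this
  norm_num at this

/-- the average minus a constant -/
lemma AW.avg_sub {w : ℝ → ℝ} (hW : AW w) {g : ℝ → ℝ} (hg : Measurable g) {K m : ℝ} (hK : ∀ x, |g x| ≤ K) :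
    ∫ x in Iic (0:ℝ), w x * (g x - m) = (∫ x in Iic (0:ℝ), w x * g x) - m := by
  have i2 : IntegrableOn (fun x => w x * m) (Iic 0) := Integrable.mul_const hW.integ m
  have i1 : IntegrableOn (fun x => w x * g x) (Iic 0) := by
    apply Integrable.mul_bdd (c := K) hW.integ hg.aestronglyMeasurable
    filter_upwards with x; exact hK x
  simp_rw [mul_sub]
  rw [integral_sub i1 i2, integral_mul_const, hW.2.2.1, one_mul]

end

section

section plem
variable {R M : ℝ} {p : ℝ → ℝ}

lemma AP2.fin {M} (hP : AP2 R M p) {s : Set ℝ} (hs : s ⊆ Icc 0 R) : (p '' s).Finite :=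
  hP.2.2.subset (image_mono hs)

lemma AP2.le_pplus {M} (hP : AP2 R M p) {η y : ℝ} (h0 : 0 ≤ η) (hy : η < y) (hyR : y ≤ R) : p y ≤ pplus R p η := by
  unfold pplus
  rw [if_neg (by linarith)]
  exact le_csSup (hP.fin (fun x hx => ⟨by linarith [hx.1], hx.2⟩)).bddAbove ⟨y, ⟨hy, hyR⟩, rfl⟩

lemma AP2.pplus_le {M} (hP : AP2 R M p) {η a : ℝ} (h0 : 0 ≤ η) (hη : η ≤ R) (ha : ∀ y, η ≤ y → (η < R → η < y) → y ≤ R → p y ≤ a) :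
    pplus R p η ≤ a := by
  unfold pplus
  split_ifs with h
  · exact ha R hη (fun h' => h') le_rfl
  · push Not at h
    refine csSup_le (show (p '' Ioc η R).Nonempty from ⟨p R, R, ⟨h, le_rfl⟩, rfl⟩) ?_
    rintro _ ⟨y, hy, rfl⟩
    exact ha y hy.1.le (fun _ => hy.1) hy.2

lemma AP2.pminus_le {M} (hP : AP2 R M p) {η y : ℝ} (hη : η ≤ R) (hy0 : 0 ≤ y) (hy : y < η) : pminus p η ≤ p y := by
  unfold pminus
  rw [if_neg (by linarith)]
  exact csInf_le (hP.fin (fun x hx => ⟨hx.1, by linarith [hx.2]⟩)).bddBelow ⟨y, ⟨hy0, hy⟩, rfl⟩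

lemma AP2.le_pminus {η a : ℝ} (h0 : 0 ≤ η) (ha : ∀ y, 0 ≤ y → y ≤ η → (0 < η → y < η) → a ≤ p y) :
    a ≤ pminus p η := by
  unfold pminus
  split_ifs with h
  · exact ha 0 le_rfl h0 (fun h' => h')
  · push Not at h
    refine le_csInf (show (p '' Ico 0 η).Nonempty from ⟨p 0, 0, ⟨le_rfl, h⟩, rfl⟩) ?_
    rintro _ ⟨y, hy, rfl⟩
    exact ha y hy.1 hy.2.le (fun _ => hy.2)

lemma AP2.pplus_spec (hR : 0 < R) (hP : AP2 R M p) {ρL : ℝ} (hL : ρL ∈ Icc 0 R) :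
    ∃ δ > 0, ∀ η ∈ Icc 0 R, (η < ρL + δ → pplus R p ρL ≤ pplus R p η) ∧
      (ρL ≤ η → η < ρL + δ → pplus R p η ≤ pplus R p ρL ∧ pplus R p ρL ≤ pminus p η) := by
  obtain ⟨hA, hv, hf⟩ := hP
  have hP : AP2 R M p := ⟨hA, hv, hf⟩
  have main : ∃ δ > 0, ∃ ξ0, ξ0 ∈ Icc 0 R ∧ pplus R p ρL = p ξ0 ∧ ∀ η ∈ Icc 0 R, η < ρL + δ → η ≤ ξ0 ∧ (ξ0 = R ∨ η < ξ0) := by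
    rcases hL.2.eq_or_lt with h | h
    · refine ⟨1, one_pos, R, ⟨hR.le, le_rfl⟩, ?_, fun η hη _ => ⟨hη.2, Or.inl rfl⟩⟩
      unfold pplus; rw [if_pos h.ge]
    · have hne : (p '' Ioc ρL R).Nonempty := ⟨p R, R, ⟨h, le_rfl⟩, rfl⟩
      have := hne.csSup_mem (hP.fin (fun x hx => ⟨by linarith [hx.1, hL.1], hx.2⟩))
      obtain ⟨ξ, hξ, e⟩ := this
      refine ⟨ξ - ρL, by linarith [hξ.1], ξ, ⟨by linarith [hξ.1, hL.1], hξ.2⟩, ?_,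
        fun η hη hh => ⟨by linarith, Or.inr (by linarith)⟩⟩
      unfold pplus; rw [if_neg (by linarith), e]
  obtain ⟨δ, hδ, ξ0, hξ0, e, hm⟩ := main
  refine ⟨δ, hδ, fun η hη => ⟨fun hh => ?_, fun hle hh => ⟨?_, ?_⟩⟩⟩
  · rw [e]
    obtain ⟨h1, h2⟩ := hm η hη hh
    rcases h1.eq_or_lt with h3 | h3
    · rcases h2 with h2 | h2
      · subst h3; unfold pplus; rw [if_pos h2.ge, h2]
      · exact hP.le_pplus hη.1 h2 hξ0.2
    · exact hP.le_pplus hη.1 h3 hξ0.2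
  · apply hP.pplus_le hη.1 hη.2
    intro y hy1 hy2 hy3
    rcases hL.2.eq_or_lt with h | h
    · unfold pplus; rw [if_pos h.ge]
      have : y = R := by linarith
      rw [this]
    · apply hP.le_pplus hL.1 _ hy3
      rcases hη.2.eq_or_lt with h' | h'
      · linarith
      · linarith [hy2 h']
  · rw [e]
    apply AP2.le_pminus hη.1
    intro y hy0 hy1 hy2
    have := (hm η hη hh).1
    exact hA ⟨hy0, by linarith [hξ0.2]⟩ hξ0 (by linarith)

lemma AP2.pminus_spec1 (hP : AP2 R M p) {ρL : ℝ} (hL : ρL ∈ Icc 0 R) (η : ℝ) (hη : η ∈ Icc 0 R) (hh : η < ρL) :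
    pminus p ρL ≤ pplus R p η := by
  have h1 := hP.pminus_le hL.2 (y := (η + ρL) / 2) (by linarith [hη.1, hL.1]) (by linarith)
  have h2 := hP.le_pplus hη.1 (y := (η + ρL) / 2) (by linarith) (by linarith [hη.2, hL.2])
  linarith

lemma AP2.pminus_spec2 (hP : AP2 R M p) {ρL : ℝ} (hL : ρL ∈ Icc 0 R) (h0 : 0 < ρL) :
    ∃ δ > 0, ∀ η ∈ Icc 0 R, ρL - δ < η → η < ρL → pplus R p η ≤ pminus p ρL ∧ pminus p ρL ≤ pminus p η := by
  have hne : (p '' Ico 0 ρL).Nonempty := ⟨p 0, 0, ⟨le_rfl, h0⟩, rfl⟩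
  obtain ⟨ξ, hξ, e⟩ := hne.csInf_mem (hP.fin (fun x hx => ⟨hx.1, by linarith [hx.2, hL.2]⟩))
  have e' : pminus p ρL = p ξ := by unfold pminus; rw [if_neg (by linarith), e]
  refine ⟨ρL - ξ, by linarith [hξ.2], fun η hη h1 h2 => ⟨?_, ?_⟩⟩
  · rw [e']
    apply hP.pplus_le hη.1 hη.2
    intro y hy1 hy2 hy3
    exact hP.1 ⟨hξ.1, by linarith [hξ.2, hL.2]⟩ ⟨by linarith [hη.1], hy3⟩ (by linarith)
  · apply AP2.le_pminus hη.1
    intro y hy1 hy2 hy3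
    exact hP.pminus_le hL.2 hy1 (by linarith)

end plem

variable {R ρb : ℝ} {f : ℝ → ℝ} {c T T' ρL ρR : ℝ} {r V : ℝ × ℝ → ℝ}

lemma ae_of_lt {P : ℝ → Prop} (h : ∀ T' < T, 0 < T' → ∀ᵐ t : ℝ, 0 < t → t < T' → P t) :
    ∀ᵐ t : ℝ, 0 < t → t < T → P t := by
  have key : ∀ n : ℕ, ∀ᵐ t : ℝ, 0 < t → t < T - 1 / (n + 1) → P t := by
    intro n
    by_cases h0 : 0 < T - 1 / ((n:ℝ) + 1)
    · apply h _ _ h0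
      have : (0:ℝ) < 1 / (n + 1) := by positivity
      linarith
    · filter_upwards with t h1 h2
      linarith
  filter_upwards [ae_all_iff.2 key] with z hz h0 hT
  obtain ⟨n, hn⟩ := exists_nat_one_div_lt (show 0 < T - z by linarith)
  exact hz n h0 (by linarith)

lemma wAvg_mem {w : ℝ → ℝ} (hW : AW w) {ρ : ℝ → ℝ → ℝ} (hm : Measurable (Function.uncurry ρ))
    (hr : ∀ t x, ρ t x ∈ Icc 0 R) (t : ℝ) : wAvg w ρ t ∈ Icc 0 R := by
  have hmt : Measurable (ρ t) := hm.comp measurable_prodMk_left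
  unfold wAvg
  constructor
  · apply setIntegral_nonneg measurableSet_Iic
    intro x hx
    exact mul_nonneg (hW.1 x hx) (hr t x).1
  · have i1 : IntegrableOn (fun x => w x * ρ t x) (Iic 0) := by
      apply Integrable.mul_bdd (c := R) hW.integ hmt.aestronglyMeasurable
      filter_upwards with x; rw [Real.norm_eq_abs, abs_of_nonneg (hr t x).1]; exact (hr t x).2
    have i2 : IntegrableOn (fun x => w x * R) (Iic 0) := Integrable.mul_const hW.integ R
    have := setIntegral_mono_on i1 i2 measurableSet_Iic (fun x hx =>
      mul_le_mul_of_nonneg_left (hr t x).2 (hW.1 x hx))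
    rwa [integral_mul_const, hW.2.2.1, one_mul] at this

lemma slice_sub (h : Sol R ρb f c T ρL ρR r) {t : ℝ}
    (hs : ∀ a b, a ≤ b → ∫ x in Ioc a b, r (t, x) = V (t, b) - V (t, a)) {a : ℝ} (ha : 0 ≤ a) :
    ∫ x in Ioc (-a) 0, (r (t, x) - ρL) = V (t, 0) - V (t, -a) - ρL * a := by
  have hmt : Measurable (fun x => r (t, x)) := h.meas.comp measurable_prodMk_left
  have i1 : IntegrableOn (fun x => r (t, x)) (Ioc (-a) 0) := by
    refine Integrable.of_bound (C := R) hmt.aestronglyMeasurable ?_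
    filter_upwards with x; rw [Real.norm_eq_abs, abs_of_nonneg (h.mem _).1]; exact (h.mem _).2
  rw [integral_sub i1 (by simp), hs (-a) 0 (by linarith)]
  simp [ha, mul_comm]

lemma avg_bound {w : ℝ → ℝ} (hW : AW w) (hF : AF R ρb f) (h : Sol R ρb f c T ρL ρR r) (hL : ρL ∈ Icc 0 R) :
    ∀ᵐ t : ℝ, 0 < t → t < T → |(∫ x in Iic (0:ℝ), w x * r (t, x)) - ρL| ≤ f ρb * t * w 0 := by
  apply ae_of_lt
  intro T' hT' hT0
  obtain ⟨V, a1, a2, a3⟩ := exists_pot hF h hT' hT0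
  have hV : Pot R ρb f T' r V := ⟨a1, a2, a3⟩
  filter_upwards [hV.slice] with t hs ht0 htT
  have hmt : Measurable (fun x => r (t, x)) := h.meas.comp measurable_prodMk_left
  rw [← hW.avg_sub hmt (K := R) (m := ρL) (by
    intro x; rw [abs_of_nonneg (h.mem _).1]; exact (h.mem _).2)]
  have hb : ∀ x, |r (t, x) - ρL| ≤ R := by
    intro x
    have := h.mem (t, x)
    rw [abs_le]; constructor <;> linarith [this.1, this.2, hL.1, hL.2]
  have hY : ∀ a, 0 ≤ a → |∫ x in Ioc (-a) 0, (r (t, x) - ρL)| ≤ f ρb * t := by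
    intro a ha
    rw [slice_sub h (hs htT) ha]
    have t1 := hV.time hF h ht0.le htT 0
    have t2 := hV.time hF h ht0.le htT (-a)
    rw [hV.initL h hT0 (by linarith)] at t1 t2
    rw [abs_le]; constructor <;> linarith [t1.1, t1.2, t2.1, t2.2]
  have l1 := hW.int_ge (g := fun x => r (t, x) - ρL) (hmt.sub_const _) hb (m := -(f ρb * t)) (fun a ha => (abs_le.1 (hY a ha)).1)
  have l2 := hW.int_le (g := fun x => r (t, x) - ρL) (hmt.sub_const _) hb (m := (f ρb * t)) (fun a ha => (abs_le.1 (hY a ha)).2)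
  rw [abs_le]; constructor <;> linarith

lemma avg_lt {w : ℝ → ℝ} (hW : AW w) (hF : AF R ρb f) (h : Sol R ρb f c T ρL ρR r) (hL : ρL ∈ Icc 0 R)
    (hR : ρR ∈ Icc 0 R) (hc : c ≤ f ρb) (hcR : c ≤ f (max ρR ρb)) (hcL : c ≤ f (min ρL ρb)) (hfc : f ρL < c)
    {L b : ℝ} (hL0 : 0 < L) (hLip : ∀ x ∈ Icc 0 R, ∀ y ∈ Icc 0 R, |f x - f y| ≤ L * |x - y|)
    (hwb : 0 < w (-b)) (hLT : L * T ≤ b) :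
    ∀ᵐ t : ℝ, 0 < t → t < T → (∫ x in Iic (0:ℝ), w x * r (t, x)) < ρL := by
  apply ae_of_lt
  intro T' hT' hT0
  obtain ⟨V, a1, a2, a3⟩ := exists_pot hF h hT' hT0
  have hV : Pot R ρb f T' r V := ⟨a1, a2, a3⟩
  filter_upwards [hV.slice] with t hs ht0 htT
  have hmt : Measurable (fun x => r (t, x)) := h.meas.comp measurable_prodMk_left
  rw [← sub_neg, ← hW.avg_sub hmt (K := R) (m := ρL) (by
    intro x; rw [abs_of_nonneg (h.mem _).1]; exact (h.mem _).2)]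
  have hb : ∀ x, |r (t, x) - ρL| ≤ R := by
    intro x
    have := h.mem (t, x)
    rw [abs_le]; constructor <;> linarith [this.1, this.2, hL.1, hL.2]
  have hJ := h.hj hF hV hT'.le hL0 hLip htT
  have hini : ∀ x ≤ 0, V (0, x) = ρL * x := fun x hx => hV.initL h hT0 hx
  have hI : ∀ s ∈ Icc 0 t, V (t, 0) + c * (t - s) ≤ V (s, 0) := by
    intro s hs
    have := up_int hF h hL hR hV hT'.le hc hcL hcR le_rfl hs.1 hs.2 htT
    linarith
  have hlow := hJ.lower_left hF.1.le hF.fpos.le hL0 hL hini ⟨ht0.le, le_rfl⟩ hfc.le hI t ⟨ht0.le, le_rfl⟩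
  have hLt : L * t < b := lt_of_lt_of_le (by apply mul_lt_mul_of_pos_left _ hL0; linarith) hLT
  apply hW.int_neg (g := fun x => r (t, x) - ρL) (hmt.sub_const _) hb (b := b) (δ := (c - f ρL) * t)
    (by nlinarith) hwb (by nlinarith)
  · intro a ha
    rw [slice_sub h (hs htT) ha]
    have := hlow (-a) (by linarith)
    linarith
  · intro a ha
    have h0a : 0 ≤ a := by nlinarith
    rw [slice_sub h (hs htT) h0a]
    have h1 := hJ.far hL hL0 hini ⟨ht0.le, le_rfl⟩ (x := -a) (by linarith)
    have h2 := hI 0 ⟨le_rfl, ht0.le⟩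
    rw [hini 0 le_rfl] at h2
    linarith

end

section

variable {R ρb : ℝ} {f w p : ℝ → ℝ} {c T T' ρL ρR : ℝ}

/-- the five cases -/
def Cases (R ρb : ℝ) (f p : ℝ → ℝ) (ρL ρR : ℝ) : Prop :=
          (ρL < ρR ∧ f ρR < f ρL ∧ f ρR ≤ pplus R p ρL) ∨
          (ρL < ρR ∧ f ρL ≤ f ρR ∧ f ρL ≤ pplus R p ρL) ∨
          (ρR ≤ ρL ∧ ρL ≤ ρb ∧ f ρL ≤ pplus R p ρL) ∨
          (ρR ≤ ρb ∧ ρb < ρL ∧ f ρb = pplus R p ρL) ∨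
          (ρb < ρR ∧ ρR ≤ ρL ∧ f ρR ≤ pminus p ρL ∧ f ρL < pplus R p ρL)

/-- the flux at the interface -/
def flx (ρb : ℝ) (f : ℝ → ℝ) (ρL ρR : ℝ) : ℝ := min (f (min ρL ρb)) (f (max ρR ρb))

lemma AP2.pplus_le_max {M : ℝ} (hP : AP2 R M p) (hL : ρL ∈ Icc 0 R) : pplus R p ρL ≤ M :=
  hP.pplus_le hL.1 hL.2 (fun y hy1 _ hy3 => (hP.2.1 y ⟨by linarith [hL.1], hy3⟩).2)

lemma cases_red (hF : AF R ρb f) (hP : AP2 R (f ρb) p) (hL : ρL ∈ Icc 0 R) (hR : ρR ∈ Icc 0 R)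
    (hC : Cases R ρb f p ρL ρR) :
    flx ρb f ρL ρR ≤ pplus R p ρL ∨
    (ρb < ρR ∧ ρR ≤ ρL ∧ f ρR ≤ pminus p ρL ∧ f ρL < pplus R p ρL ∧ pplus R p ρL < f ρR) := by
  have hb := hF.2.2.2.2.2.1
  unfold flx
  rcases hC with ⟨h1, h2, h3⟩ | ⟨h1, h2, h3⟩ | ⟨h1, h2, h3⟩ | ⟨h1, h2, h3⟩ | ⟨h1, h2, h3, h4⟩
  · left
    have : ρb ≤ ρR := by
      by_contra hh
      push Not at hh
      have := hF.strictMonoOn ⟨hL.1, by linarith⟩ ⟨hR.1, hh.le⟩ h1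
      linarith
    rw [max_eq_left this]
    exact (min_le_right _ _).trans h3
  · left
    have : ρL ≤ ρb := by
      by_contra hh
      push Not at hh
      have := hF.strictAntiOn ⟨hh.le, hL.2⟩ ⟨by linarith, hR.2⟩ h1
      linarith
    rw [min_eq_left this]
    exact (min_le_left _ _).trans h3
  · left
    rw [min_eq_left h2]
    exact (min_le_left _ _).trans h3
  · left
    rw [min_eq_right h2.le, ← h3]
    exact min_le_left _ _
  · by_cases h5 : f ρR ≤ pplus R p ρL
    · left
      rw [max_eq_left h1.le]
      exact (min_le_right _ _).trans h5
    · right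
      exact ⟨h1, h2, h3, h4, not_le.1 h5⟩

lemma wAvg_ext {ρ : ℝ → ℝ → ℝ} {t : ℝ} (ht : 0 < t) :
    ∫ x in Iic (0:ℝ), w x * extI ρL ρR ρ (t, x) = wAvg w ρ t := by
  unfold wAvg extI
  simp [ht]

lemma sol_exists (hF : AF R ρb f) (hW : AW w) (hP : AP2 R (f ρb) p) (hL : ρL ∈ Icc 0 R) (hR : ρR ∈ Icc 0 R)
    (hC : Cases R ρb f p ρL ρR) :
    ∃ T0 > 0, ∃ c, c ≤ f ρb ∧ flx ρb f ρL ρR ≤ c ∧ ∀ T, 0 < T → T ≤ T0 → ∀ ρ γm γp,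
      EWSolOn R (f ρb) T f w p (riem ρL ρR) ρ γm γp → Sol R ρb f c T ρL ρR (extI ρL ρR ρ) := by
  have hb := hF.2.2.2.2.2.1
  have hfp := hF.fpos
  have hw0 := hW.w0
  obtain ⟨δ, hδ, hpp⟩ := hP.pplus_spec hF.1 hL
  obtain ⟨b, hb0, hwb⟩ := hW.pos
  obtain ⟨L, hL0, hLip⟩ := hF.lip
  have hple := hP.pplus_le_max hL
  set T1 := δ / (f ρb * w 0 + 1) with hT1
  have hT1p : 0 < T1 := by positivity
  have base : ∀ T, 0 < T → T ≤ T1 → ∀ ρ γm γp q, CEIOn R (f ρb) T f q (riem ρL ρR) ρ γm γp →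
      (∀ᵐ t ∂(volume.restrict (Ioo (0:ℝ) T)), q t ∈ Icc (pplus R p (wAvg w ρ t)) (pminus p (wAvg w ρ t))) →
      Sol R ρb f (pplus R p ρL) T ρL ρR (extI ρL ρR ρ) := by
    intro T hT hTT ρ γm γp q hq hq2
    have hs0 := hq.sol hF hL hR (c := 0) (ae_of_all _ fun t => (hq.2.1 t).1)
    apply hq.sol hF hL hR
    have hav := avg_bound hW hF hs0 hL
    filter_upwards [hq2, ae_restrict_of_ae hav, ae_restrict_mem measurableSet_Ioo] with t h1 h2 h3
    have h4 := h2 h3.1 h3.2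
    rw [wAvg_ext h3.1] at h4
    refine le_trans ?_ h1.1
    apply (hpp _ (wAvg_mem hW hq.1.1 hq.1.2.1 t)).1
    have h5 := (abs_le.1 h4).2
    have h6 : f ρb * t * w 0 < δ := by
      have h7 : T1 * (f ρb * w 0 + 1) = δ := by rw [hT1]; field_simp
      have h8 : t < T1 := by linarith [h3.2]
      have : 0 ≤ f ρb * w 0 := by positivity
      nlinarith
    linarith
  rcases cases_red hF hP hL hR hC with h | ⟨c1, c2, c3, c4, c5⟩
  · refine ⟨T1, hT1p, pplus R p ρL, hple, h, ?_⟩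
    rintro T hT hTT ρ γm γp ⟨q, hq, hq2⟩
    exact base T hT hTT ρ γm γp q hq hq2
  · have emin : min ρL ρb = ρb := min_eq_right (by linarith)
    have emax : max ρR ρb = ρR := max_eq_left c1.le
    have hfl : flx ρb f ρL ρR = f ρR := by
      unfold flx
      rw [emin, emax]; exact min_eq_right (hF.le_max hR)
    refine ⟨min T1 (b / L), lt_min hT1p (by positivity), f ρR, hF.le_max hR, hfl.le, ?_⟩
    rintro T hT hTT ρ γm γp ⟨q, hq, hq2⟩
    have hs := base T hT (hTT.trans (min_le_left _ _)) ρ γm γp q hq hq2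
    have hTb : L * T ≤ b := by
      have := hTT.trans (min_le_right _ _)
      rw [le_div_iff₀ hL0] at this; linarith
    have hlt := avg_lt hW hF hs hL hR hple (by rw [emax]; exact c5.le) (by rw [emin]; exact hple) c4 hL0 hLip hwb hTb
    apply hq.sol hF hL hR
    filter_upwards [hq2, ae_restrict_of_ae hlt, ae_restrict_mem measurableSet_Ioo] with t h1 h2 h3
    have h4 := h2 h3.1 h3.2
    rw [wAvg_ext h3.1] at h4
    exact c3.trans ((hP.pminus_spec1 hL _ (wAvg_mem hW hq.1.1 hq.1.2.1 t) h4).trans h1.1)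

lemma uniqueness (hF : AF R ρb f) (hW : AW w) (hP : AP2 R (f ρb) p) (hL : ρL ∈ Icc 0 R) (hR : ρR ∈ Icc 0 R)
    (hC : Cases R ρb f p ρL ρR) :
    ∃ T0 > 0, ∀ T, 0 < T → T ≤ T0 → ∀ ρ1 ρ2 γm1 γp1 γm2 γp2,
      EWSolOn R (f ρb) T f w p (riem ρL ρR) ρ1 γm1 γp1 →
      EWSolOn R (f ρb) T f w p (riem ρL ρR) ρ2 γm2 γp2 → aeEqOn T ρ1 ρ2 := by
  obtain ⟨T0, hT0, c, hc, hFc, hS⟩ := sol_exists hF hW hP hL hR hC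
  refine ⟨T0, hT0, ?_⟩
  intro T hT hTT ρ1 ρ2 γm1 γp1 γm2 γp2 h1 h2
  have := uniq_c hF (hS T hT hTT _ _ _ h1) (hS T hT hTT _ _ _ h2) hL hR hc hFc
  unfold aeEqOn
  filter_upwards [ae_restrict_of_ae this, ae_restrict_mem (measurableSet_Ioo.prod MeasurableSet.univ)] with z hz hz2
  have := hz hz2.1.1 hz2.1.2
  simpa [extI, hz2.1.1] using this

end

section

lemma pd_swap {φ : ℝ × ℝ → ℝ} (h : TestFn φ) (z : ℝ × ℝ) : pdX (pdT φ) z = pdT (pdX φ) z := by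
  have hd : Differentiable ℝ (fderiv ℝ φ) := (h.1.fderiv_right (m := 1) (by norm_cast)).differentiable (by simp)
  have hs : IsSymmSndFDerivAt ℝ φ z := h.1.contDiffAt.isSymmSndFDerivAt (by simp only [minSmoothness_of_isRCLikeNormedField]; exact WithTop.coe_le_coe.2 (le_top : (2 : ℕ∞) ≤ ⊤))
  have e1 : ∀ v u : ℝ × ℝ, fderiv ℝ (fun z => fderiv ℝ φ z v) z u = fderiv ℝ (fderiv ℝ φ) z u v := by
    intro v u
    rw [fderiv_clm_apply (hd z) (by fun_prop)]
    simp
  unfold pdX pdT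
  rw [e1, e1]
  exact hs _ _

lemma test_pdT {φ : ℝ × ℝ → ℝ} (h : TestFn φ) : TestFn (pdT φ) := by
  refine ⟨?_, h.2.fderiv_apply (𝕜 := ℝ) _⟩
  exact (h.1.fderiv_right (m := (⊤ : ℕ∞)) (by norm_cast)).clm_apply contDiff_const

lemma test_pdX {φ : ℝ × ℝ → ℝ} (h : TestFn φ) : TestFn (pdX φ) := by
  refine ⟨?_, h.2.fderiv_apply (𝕜 := ℝ) _⟩
  exact (h.1.fderiv_right (m := (⊤ : ℕ∞)) (by norm_cast)).clm_apply contDiff_const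

lemma curl_zero {W φ : ℝ × ℝ → ℝ} {C : NNReal} (hW : LipschitzWith C W) (h : TestFn φ) :
    ∫ z, pdX W z * pdT φ z = ∫ z, pdT W z * pdX φ z := by
  obtain ⟨D1, h1⟩ := lip_of_test (test_pdT h)
  obtain ⟨D2, h2⟩ := lip_of_test (test_pdX h)
  have a1 := lip_ibp hW h1 (test_pdT h).2
  have a2 := lip_ibp hW h2 (test_pdX h).2
  rw [a1.1, a2.2]
  simp_rw [pd_swap h]

end

section

/-- the self-similar profile, selected by maximization -/
structure Sel (R : ℝ) (f : ℝ → ℝ) (ε ρL ρR : ℝ) (m : ℝ → ℝ) : Prop where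
  eps : ε = 1 ∨ ε = -1
  hL : ρL ∈ Icc 0 R
  hR : ρR ∈ Icc 0 R
  ord : 0 ≤ ε * (ρR - ρL)
  mem : ∀ ξ, m ξ ∈ uIcc ρL ρR
  opt : ∀ ξ, ∀ i ∈ uIcc ρL ρR, ε * (i * ξ - f i) ≤ ε * (m ξ * ξ - f (m ξ))

variable {R ρb : ℝ} {f : ℝ → ℝ} {ε ρL ρR : ℝ} {m : ℝ → ℝ}

lemma exists_sel (hF : AF R ρb f) (hL : ρL ∈ Icc 0 R) (hR : ρR ∈ Icc 0 R) (he : ε = 1 ∨ ε = -1)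
    (ho : 0 ≤ ε * (ρR - ρL)) : ∃ m, Sel R f ε ρL ρR m := by
  have hsub : uIcc ρL ρR ⊆ Icc 0 R := fun x hx => ⟨(le_min hL.1 hR.1).trans hx.1, hx.2.trans (max_le hL.2 hR.2)⟩
  have : ∀ ξ : ℝ, ∃ j ∈ uIcc ρL ρR, ∀ i ∈ uIcc ρL ρR, ε * (i * ξ - f i) ≤ ε * (j * ξ - f j) := by
    intro ξ
    obtain ⟨j, hj, hm⟩ := (isCompact_uIcc (a := ρL) (b := ρR)).exists_isMaxOn ⟨ρL, left_mem_uIcc⟩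
      (f := fun i => ε * (i * ξ - f i)) (by
        have := hF.contOn.mono hsub
        fun_prop)
    exact ⟨j, hj, fun i hi => hm hi⟩
  choose m h1 h2 using this
  exact ⟨m, he, hL, hR, ho, h1, h2⟩

namespace Sel

lemma sq (h : Sel R f ε ρL ρR m) : ε * ε = 1 := by rcases h.eps with e | e <;> rw [e] <;> norm_num

lemma sub (h : Sel R f ε ρL ρR m) : uIcc ρL ρR ⊆ Icc 0 R :=
  fun x hx => ⟨(le_min h.hL.1 h.hR.1).trans hx.1, hx.2.trans (max_le h.hL.2 h.hR.2)⟩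

lemma mem_iff (h : Sel R f ε ρL ρR m) {i : ℝ} : i ∈ uIcc ρL ρR ↔ 0 ≤ ε * (i - ρL) ∧ 0 ≤ ε * (ρR - i) := by
  have := h.ord
  rcases h.eps with e | e <;> subst e
  · rw [uIcc_of_le (by linarith), mem_Icc]
    constructor <;> rintro ⟨a, b⟩ <;> constructor <;> linarith
  · rw [uIcc_of_ge (by linarith), mem_Icc]
    constructor <;> rintro ⟨a, b⟩ <;> constructor <;> linarith

lemma memI (h : Sel R f ε ρL ρR m) (ξ : ℝ) : m ξ ∈ Icc 0 R := h.sub (h.mem ξ)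

lemma mono (h : Sel R f ε ρL ρR m) : Monotone (fun ξ => ε * m ξ) := by
  intro ξ ξ' hle
  rcases hle.eq_or_lt with e | hlt
  · subst e; rfl
  have h1 := h.opt ξ _ (h.mem ξ')
  have h2 := h.opt ξ' _ (h.mem ξ)
  simp only
  by_contra hc
  push Not at hc
  nlinarith

lemma meas (h : Sel R f ε ρL ρR m) : Measurable m := by
  have h1 := h.mono.measurable
  have : m = fun ξ => ε * (ε * m ξ) := by ext ξ; rw [← mul_assoc, h.sq, one_mul]
  rw [this]
  exact h1.const_mul ε

lemma abs_eps (h : Sel R f ε ρL ρR m) : |ε| = 1 := by rcases h.eps with e | e <;> rw [e] <;> norm_num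

lemma farL (h : Sel R f ε ρL ρR m) {L : ℝ} (hLip : ∀ x ∈ Icc 0 R, ∀ y ∈ Icc 0 R, |f x - f y| ≤ L * |x - y|)
    {ξ : ℝ} (hξ : ξ < -L) : m ξ = ρL := by
  have h1 := h.opt ξ ρL left_mem_uIcc
  have h2 := (h.mem_iff.1 (h.mem ξ)).1
  have h3 := hLip _ (h.memI ξ) _ h.hL
  have h4 : |m ξ - ρL| = ε * (m ξ - ρL) := by
    rw [← abs_of_nonneg h2, abs_mul, h.abs_eps, one_mul]
  have h5 : ε * (f (m ξ) - f ρL) ≥ -|f (m ξ) - f ρL| := by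
    have := neg_abs_le (ε * (f (m ξ) - f ρL))
    rwa [abs_mul, h.abs_eps, one_mul] at this
  rw [h4] at h3
  have h6 : ε * (m ξ - ρL) = 0 := by
    apply le_antisymm _ h2
    by_contra hc
    push Not at hc
    nlinarith
  rw [h6] at h4
  linarith [abs_eq_zero.1 h4]

lemma farR (h : Sel R f ε ρL ρR m) {L : ℝ} (hLip : ∀ x ∈ Icc 0 R, ∀ y ∈ Icc 0 R, |f x - f y| ≤ L * |x - y|)
    {ξ : ℝ} (hξ : L < ξ) : m ξ = ρR := by
  have h1 := h.opt ξ ρR right_mem_uIcc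
  have h2 := (h.mem_iff.1 (h.mem ξ)).2
  have h3 := hLip _ h.hR _ (h.memI ξ)
  have h4 : |ρR - m ξ| = ε * (ρR - m ξ) := by
    rw [← abs_of_nonneg h2, abs_mul, h.abs_eps, one_mul]
  have h5 : ε * (f ρR - f (m ξ)) ≤ |f ρR - f (m ξ)| := by
    have := le_abs_self (ε * (f ρR - f (m ξ)))
    rwa [abs_mul, h.abs_eps, one_mul] at this
  rw [h4] at h3
  have h6 : ε * (ρR - m ξ) = 0 := by
    apply le_antisymm _ h2
    by_contra hc
    push Not at hc
    nlinarith
  rw [h6] at h4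
  linarith [abs_eq_zero.1 h4]

end Sel

/-- the self-similar solution, extended to negative times -/
def rr (ρL ρR : ℝ) (m : ℝ → ℝ) (z : ℝ × ℝ) : ℝ := if 0 < z.1 then m (z.2 / z.1) else riem ρL ρR z.2

/-- its potential -/
def UU (f : ℝ → ℝ) (ρL ρR : ℝ) (m : ℝ → ℝ) (z : ℝ × ℝ) : ℝ :=
  rr ρL ρR m z * z.2 - f (rr ρL ρR m z) * max z.1 0

namespace Sel

lemma rr_mem' (h : Sel R f ε ρL ρR m) (z) : rr ρL ρR m z ∈ uIcc ρL ρR := by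
  unfold rr riem
  split_ifs
  · exact h.mem _
  · exact left_mem_uIcc
  · exact right_mem_uIcc

lemma rr_mem (h : Sel R f ε ρL ρR m) (z) : rr ρL ρR m z ∈ Icc 0 R := h.sub (h.rr_mem' z)

lemma rr_meas (h : Sel R f ε ρL ρR m) : Measurable (rr ρL ρR m) :=
  Measurable.ite (measurableSet_lt measurable_const measurable_fst)
    (h.meas.comp (measurable_snd.div measurable_fst)) ((measurable_riem ρL ρR).comp measurable_snd)

lemma U_ge (h : Sel R f ε ρL ρR m) {i : ℝ} (hi : i ∈ uIcc ρL ρR) (z : ℝ × ℝ) :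
    ε * (i * z.2 - f i * max z.1 0) ≤ ε * UU f ρL ρR m z := by
  unfold UU
  by_cases hz : 0 < z.1
  · rw [max_eq_left hz.le]
    simp only [rr, if_pos hz]
    have := h.opt (z.2 / z.1) i hi
    have e : z.2 = z.2 / z.1 * z.1 := by field_simp
    set ξ := z.2 / z.1
    rw [e]
    nlinarith
  · rw [max_eq_right (by linarith)]
    simp only [rr, if_neg hz, riem]
    have := h.mem_iff.1 hi
    split_ifs with hx
    · nlinarith
    · push Not at hx
      nlinarith

lemma U_lip (h : Sel R f ε ρL ρR m) (hF : AF R ρb f) : LipschitzWith (R + f ρb).toNNReal (UU f ρL ρR m) := by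
  have key : ∀ z y, ε * UU f ρL ρR m z - ε * UU f ρL ρR m y ≤ (R + f ρb) * dist z y := by
    intro z y
    set i := rr ρL ρR m z with hi
    have h1 := h.U_ge (h.rr_mem' z) y
    have h2 : UU f ρL ρR m z = i * z.2 - f i * max z.1 0 := rfl
    rw [h2]
    rw [← hi] at h1
    have hiR : i ∈ Icc 0 R := h.rr_mem z
    have a1 : |z.2 - y.2| ≤ dist z y := by rw [Prod.dist_eq, ← Real.dist_eq]; exact le_max_right _ _
    have a2 : |max z.1 0 - max y.1 0| ≤ dist z y := by
      rw [Prod.dist_eq]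
      refine le_trans ?_ (le_max_left _ _)
      rw [Real.dist_eq]
      exact abs_max_sub_max_le_abs _ _ _
    have a3 : |ε * i * (z.2 - y.2)| ≤ R * dist z y := by
      rw [abs_mul, abs_mul, h.abs_eps, one_mul, abs_of_nonneg hiR.1]
      exact mul_le_mul hiR.2 a1 (abs_nonneg _) hF.1.le
    have hfi := hF.2.2.1 i hiR
    have a4 : |ε * f i * (max z.1 0 - max y.1 0)| ≤ f ρb * dist z y := by
      rw [abs_mul, abs_mul, h.abs_eps, one_mul, abs_of_nonneg hfi]
      exact mul_le_mul (hF.le_max hiR) a2 (abs_nonneg _) hF.fpos.le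
    have := abs_le.1 a3
    have := abs_le.1 a4
    nlinarith
  apply LipschitzWith.of_dist_le_mul
  intro z y
  rw [Real.coe_toNNReal _ (by linarith [hF.1, hF.fpos]), Real.dist_eq]
  have h1 := key z y
  have h2 := key y z
  rw [dist_comm y z] at h2
  rcases h.eps with e | e <;> subst e <;> rw [abs_le] <;> constructor <;> linarith

lemma U_ae (h : Sel R f ε ρL ρR m) (hF : AF R ρb f) : ∀ᵐ z : ℝ × ℝ, DifferentiableAt ℝ (UU f ρL ρR m) z ∧
    z.1 ≠ 0 ∧ pdX (UU f ρL ρR m) z = rr ρL ρR m z ∧ pdT (UU f ρL ρR m) z = - fl f (rr ρL ρR m) z := by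
  have hne : ∀ᵐ z : ℝ × ℝ, z.1 ≠ 0 := by
    have : (volume : Measure (ℝ × ℝ)) ({z : ℝ × ℝ | z.1 = 0}) = 0 := by
      have e : {z : ℝ × ℝ | z.1 = 0} = ({0} : Set ℝ) ×ˢ univ := by ext; simp
      rw [e, Measure.volume_eq_prod, Measure.prod_prod]; simp
    rw [ae_iff]; simpa using this
  filter_upwards [(h.U_lip hF).ae_differentiableAt, hne] with z hd hz
  refine ⟨hd, hz, ?_⟩
  set U := UU f ρL ρR m with hU
  set i := rr ρL ρR m z with hi
  -- one-dimensional minima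
  have hmin : ∀ y : ℝ × ℝ, ε * (U z - (i * z.2 - f i * max z.1 0)) ≤ ε * (U y - (i * y.2 - f i * max y.1 0)) := by
    intro y
    have h1 := h.U_ge (h.rr_mem' z) y
    have h2 : U z = i * z.2 - f i * max z.1 0 := rfl
    rw [h2]
    linarith
  have hε : ε ≠ 0 := by rcases h.eps with e | e <;> rw [e] <;> norm_num
  constructor
  · have h1 : HasDerivAt (fun s => ε * (U (z.1, s) - (i * s - f i * max z.1 0))) (ε * (pdX U z - i)) z.2 := by
      have := ((pdX_has hd).sub (((hasDerivAt_id z.2).const_mul i).sub_const (f i * max z.1 0))).const_mul ε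
      simpa using this
    have h2 : IsLocalMin (fun s => ε * (U (z.1, s) - (i * s - f i * max z.1 0))) z.2 := by
      filter_upwards with s
      exact hmin (z.1, s)
    have := h2.hasDerivAt_eq_zero h1
    have := (mul_eq_zero.1 this).resolve_left hε
    linarith
  · by_cases hp : 0 < z.1
    · have h1 : HasDerivAt (fun s => ε * (U (s, z.2) - (i * z.2 - f i * s))) (ε * (pdT U z + f i)) z.1 := by
        have := ((pdT_has hd).sub (((hasDerivAt_id z.1).const_mul (f i)).const_sub (i * z.2))).const_mul ε
        simpa using this
      have h2 : IsLocalMin (fun s => ε * (U (s, z.2) - (i * z.2 - f i * s))) z.1 := by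
        filter_upwards [lt_mem_nhds hp] with s hs
        have := hmin (s, z.2)
        rwa [max_eq_left hp.le, max_eq_left (by exact hs.le)] at this
      have := h2.hasDerivAt_eq_zero h1
      have := (mul_eq_zero.1 this).resolve_left hε
      unfold fl
      rw [if_pos hp, ← hi]; linarith
    · have hp' : z.1 < 0 := lt_of_le_of_ne (not_lt.1 hp) hz
      have h1 : HasDerivAt (fun s => ε * (U (s, z.2) - (i * z.2))) (ε * (pdT U z)) z.1 := by
        have := ((pdT_has hd).sub_const (i * z.2)).const_mul ε
        simpa using this
      have h2 : IsLocalMin (fun s => ε * (U (s, z.2) - (i * z.2))) z.1 := by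
        filter_upwards [gt_mem_nhds hp'] with s hs
        have := hmin (s, z.2)
        rwa [max_eq_right hp'.le, max_eq_right (by exact hs.le), mul_zero, sub_zero] at this
      have := h2.hasDerivAt_eq_zero h1
      have := (mul_eq_zero.1 this).resolve_left hε
      unfold fl
      rw [if_neg hp, this, neg_zero]

end Sel
end

section

variable {R ρb : ℝ} {f : ℝ → ℝ} {ε ρL ρR : ℝ} {m : ℝ → ℝ}

lemma fd_smul (c : ℝ) (V : ℝ × ℝ → ℝ) (z : ℝ × ℝ) : fderiv ℝ (fun y => c * V y) z = c • fderiv ℝ V z :=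
  congrFun (fderiv_const_smul_field (𝕜 := ℝ) (f := V) c) z

lemma tplus_deriv {t : ℝ} (ht : t ≠ 0) : HasDerivAt (fun s : ℝ => max s 0) (if 0 < t then 1 else 0) t := by
  split_ifs with h
  · refine (hasDerivAt_id t).congr_of_eventuallyEq ?_
    filter_upwards [lt_mem_nhds h] with s hs
    exact max_eq_left hs.le
  · have h' : t < 0 := lt_of_le_of_ne (not_lt.1 h) ht
    refine (hasDerivAt_const t (0:ℝ)).congr_of_eventuallyEq ?_
    filter_upwards [gt_mem_nhds h'] with s hs
    exact max_eq_right hs.le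

/-- shifted potential -/
def VV (f : ℝ → ℝ) (ρL ρR : ℝ) (m : ℝ → ℝ) (k c : ℝ) (z : ℝ × ℝ) : ℝ :=
  UU f ρL ρR m z - k * z.2 + c * max z.1 0

namespace Sel

lemma V_lip (h : Sel R f ε ρL ρR m) (hF : AF R ρb f) (k c : ℝ) :
    ∃ C : NNReal, LipschitzWith C (VV f ρL ρR m k c) := by
  have h1 : LipschitzWith (‖k‖₊ * 1) (fun z : ℝ × ℝ => k * z.2) :=
    (lipschitzWith_smul k).comp LipschitzWith.prod_snd
  have h2 : LipschitzWith (‖c‖₊ * (1)) (fun z : ℝ × ℝ => c * max z.1 0) :=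
    (lipschitzWith_smul c).comp (LipschitzWith.prod_fst.max_const 0)
  exact ⟨_, ((h.U_lip hF).sub h1).add h2⟩

lemma V_ae (h : Sel R f ε ρL ρR m) (hF : AF R ρb f) (k c : ℝ) : ∀ᵐ z : ℝ × ℝ,
    DifferentiableAt ℝ (VV f ρL ρR m k c) z ∧ pdX (VV f ρL ρR m k c) z = rr ρL ρR m z - k ∧
    pdT (VV f ρL ρR m k c) z = - fl f (rr ρL ρR m) z + c * (if 0 < z.1 then 1 else 0) := by
  filter_upwards [h.U_ae hF] with z ⟨hd, hz, hX, hT⟩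
  have d1 : DifferentiableAt ℝ (fun z : ℝ × ℝ => max z.1 0) z :=
    (tplus_deriv hz).differentiableAt.comp z differentiableAt_fst
  have d2 : DifferentiableAt ℝ (VV f ρL ρR m k c) z := by
    unfold VV
    exact (hd.sub (by fun_prop)).add (d1.const_mul c)
  refine ⟨d2, ?_, ?_⟩
  · apply (pdX_has d2).unique
    have := ((pdX_has hd).sub ((hasDerivAt_id z.2).const_mul k)).add_const (c * max z.1 0)
    rw [hX] at this
    simpa [VV] using this
  · apply (pdT_has d2).unique
    have := ((pdT_has hd).sub_const (k * z.2)).fun_add ((tplus_deriv hz).const_mul c)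
    rw [hT] at this
    simpa [VV] using this

end Sel

lemma kink_null (a : ℝ) : ∀ᵐ z : ℝ × ℝ, z.2 ≠ a * max z.1 0 := by
  have hm : MeasurableSet {z : ℝ × ℝ | z.2 = a * max z.1 0} := measurableSet_eq_fun (by fun_prop) (by fun_prop)
  rw [ae_iff]
  have e : {z : ℝ × ℝ | ¬ z.2 ≠ a * max z.1 0} = {z : ℝ × ℝ | z.2 = a * max z.1 0} := by ext; simp
  rw [e, Measure.volume_eq_prod, Measure.measure_prod_null hm]
  filter_upwards with t
  have : Prod.mk t ⁻¹' {z : ℝ × ℝ | z.2 = a * max z.1 0} = {a * max t 0} := by ext; simp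
  rw [this]; simp

/-- the sign with respect to the line of slope `a` -/
def sg (a : ℝ) (z : ℝ × ℝ) : ℝ := Real.sign (z.2 - a * max z.1 0)

lemma kink {V : ℝ × ℝ → ℝ} {C : NNReal} (hV : LipschitzWith C V) (a : ℝ) (h0 : ∀ t, V (t, a * max t 0) = 0)  :
    ∃ C' : NNReal, LipschitzWith C' (fun z => sg a z * V z) := by
  have e : (fun z => sg a z * V z) = fun z : ℝ × ℝ => V (z.1, max z.2 (a * max z.1 0)) - V (z.1, min z.2 (a * max z.1 0)) := by
    ext z
    rcases lt_trichotomy z.2 (a * max z.1 0) with h | h | h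
    · rw [sg, Real.sign_of_neg (by linarith), max_eq_right h.le, min_eq_left h.le, h0]; ring
    · rw [sg, h, sub_self, Real.sign_zero, max_self, min_self]; ring
    · rw [sg, Real.sign_of_pos (by linarith), max_eq_left h.le, min_eq_right h.le, h0]; ring
  have h2 : LipschitzWith (‖a‖₊ * (1)) (fun z : ℝ × ℝ => a * max z.1 0) :=
    (lipschitzWith_smul a).comp (LipschitzWith.prod_fst.max_const 0)
  rw [e]
  exact ⟨_, (hV.comp (LipschitzWith.prod_fst.prodMk (LipschitzWith.prod_snd.max h2))).sub
    (hV.comp (LipschitzWith.prod_fst.prodMk (LipschitzWith.prod_snd.min h2)))⟩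

lemma kink_pd {V : ℝ × ℝ → ℝ} (a : ℝ) {z : ℝ × ℝ} (hz : z.2 ≠ a * max z.1 0) :
    pdX (fun z => sg a z * V z) z = sg a z * pdX V z ∧ pdT (fun z => sg a z * V z) z = sg a z * pdT V z := by
  have hc : Continuous (fun z : ℝ × ℝ => z.2 - a * max z.1 0) := by fun_prop
  have e : (fun z => sg a z * V z) =ᶠ[nhds z] fun y => sg a z * V y := by
    rcases lt_or_gt_of_ne hz with h | h
    · have h' : z.2 - a * max z.1 0 < 0 := by linarith
      filter_upwards [(hc.continuousAt (x := z)).eventually (gt_mem_nhds h')] with y hy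
      rw [sg, sg, Real.sign_of_neg hy, Real.sign_of_neg (by linarith)]
    · have h' : 0 < z.2 - a * max z.1 0 := by linarith
      filter_upwards [(hc.continuousAt (x := z)).eventually (lt_mem_nhds h')] with y hy
      rw [sg, sg, Real.sign_of_pos hy, Real.sign_of_pos (by linarith)]
  unfold pdX pdT
  rw [e.fderiv_eq]
  have : fderiv ℝ (fun y => sg a z * V y) z = sg a z • fderiv ℝ V z := fd_smul _ _ _
  rw [this]
  simp

lemma sg_meas (a : ℝ) : Measurable (sg a) := measurable_sign.comp (by fun_prop)

lemma sg_le (a : ℝ) (z) : |sg a z| ≤ 1 := abs_sign_le _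

lemma slice_sgn {φ : ℝ × ℝ → ℝ} (hφ : TestFn φ) (t c : ℝ) :
    ∫ x, Real.sign (x - c) * pdX φ (t, x) = - 2 * φ (t, c) := by
  have hd : ∀ x, pdX φ (t, x) = deriv (fun y => φ (t, y)) x := fun x =>
    (slice_hasDerivAtX (hφ.1.differentiable (by simp)) t x).deriv.symm
  have hc : ContDiff ℝ 1 (fun y => φ (t, y)) := by
    have : ContDiff ℝ 1 φ := hφ.1.of_le (by norm_cast)
    fun_prop
  have hs := slice_suppX hφ.2 t
  have hi : Integrable (deriv (fun y => φ (t, y))) :=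
    (hc.continuous_deriv le_rfl).integrable_of_hasCompactSupport hs.deriv
  have hI : Integrable (fun x => Real.sign (x - c) * deriv (fun y => φ (t, y)) x) := by
    refine hi.bdd_mul (c := 1) ((measurable_sign.comp (by fun_prop)).aestronglyMeasurable) ?_
    filter_upwards with x
    exact abs_sign_le _
  simp_rw [hd]
  rw [← integral_add_compl measurableSet_Iic hI (s := Iic c), compl_Iic]
  have e1 : ∫ x in Iic c, Real.sign (x - c) * deriv (fun y => φ (t, y)) x = - φ (t, c) := by
    rw [← HasCompactSupport.integral_Iic_deriv_eq hc hs c, ← integral_neg, integral_Iic_eq_integral_Iio,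
      integral_Iic_eq_integral_Iio]
    apply setIntegral_congr_fun measurableSet_Iio
    intro x hx
    simp only
    rw [Real.sign_of_neg (by linarith [mem_Iio.1 hx])]; ring
  have e2 : ∫ x in Ioi c, Real.sign (x - c) * deriv (fun y => φ (t, y)) x = - φ (t, c) := by
    rw [← HasCompactSupport.integral_Ioi_deriv_eq hc hs c]
    apply setIntegral_congr_fun measurableSet_Ioi
    intro x hx
    simp only
    rw [Real.sign_of_pos (by linarith [mem_Ioi.1 hx])]; ring
  rw [e1, e2]; ring

lemma sg_int {φ : ℝ × ℝ → ℝ} (hφ : TestFn φ) (h0 : ∀ z, 0 ≤ φ z) (a : ℝ) :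
    ∫ z, (sg a z * (if 0 < z.1 then 1 else 0)) * pdX φ z ≤ 0 := by
  obtain ⟨C, hC⟩ := lip_of_test hφ
  have hm : Measurable (fun z : ℝ × ℝ => sg a z * (if 0 < z.1 then (1:ℝ) else 0)) :=
    (sg_meas a).mul (Measurable.ite (measurableSet_lt measurable_const measurable_fst) measurable_const measurable_const)
  have hI := (int_pd hC hφ.2 hm (B := 1) (by
    intro z; have := sg_le a z
    split_ifs <;> simp [this])).2
  rw [Measure.volume_eq_prod] at hI ⊢
  rw [integral_prod _ hI]
  apply integral_nonpos
  intro t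
  simp only [Pi.zero_apply]
  split_ifs with ht
  · have : ∫ x, sg a (t, x) * 1 * pdX φ (t, x) = - 2 * φ (t, a * max t 0) := by
      rw [← slice_sgn hφ]; simp [sg]
    rw [this]; linarith [h0 (t, a * max t 0)]
  · simp

lemma ent_core (h : Sel R f ε ρL ρR m) (hF : AF R ρb f) {k : ℝ} (hk : k ∈ Icc 0 R)
    {φ V : ℝ × ℝ → ℝ} {C : NNReal} (hV : LipschitzWith C V) (hφ : TestFn φ) {g : ℝ × ℝ → ℝ} (hg : Measurable g)
    {B : ℝ} (hB : ∀ z, |g z| ≤ B)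
    (hae : ∀ᵐ z, eD (rr ρL ρR m) k z = pdX V z ∧ eF f (rr ρL ρR m) k z = - pdT V z - g z) (hI : ∫ z, g z * pdX φ z ≤ 0) :
    0 ≤ ∫ z, (eD (rr ρL ρR m) k z * pdT φ z + eF f (rr ρL ρR m) k z * pdX φ z) := by
  obtain ⟨C', hC'⟩ := lip_of_test hφ
  have i1 := (int_pd hC' hφ.2 (measurable_pdX V) (abs_pdX_le hV)).1
  have i2 := (int_pd hC' hφ.2 (measurable_pdT V) (abs_pdT_le hV)).2
  have i3 := (int_pd hC' hφ.2 hg hB).2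
  have i12 : Integrable (fun z => pdX V z * pdT φ z - pdT V z * pdX φ z) := i1.sub i2
  have e : ∫ z, (eD (rr ρL ρR m) k z * pdT φ z + eF f (rr ρL ρR m) k z * pdX φ z) =
      ∫ z, ((pdX V z * pdT φ z - pdT V z * pdX φ z) - g z * pdX φ z) := by
    apply integral_congr_ae
    filter_upwards [hae] with z ⟨h1, h2⟩
    rw [h1, h2]; ring
  rw [e, integral_sub i12 i3, integral_sub i1 i2, curl_zero hV hφ]
  linarith

lemma ent_const (h : Sel R f ε ρL ρR m) (hF : AF R ρb f) {k : ℝ} (hk : k ∈ Icc 0 R)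
    {φ : ℝ × ℝ → ℝ} (hφ : TestFn φ) {s : ℝ}
    (hs : ∀ z, eD (rr ρL ρR m) k z = s * (rr ρL ρR m z - k) ∧ Real.sign (rr ρL ρR m z - k) * (f (rr ρL ρR m z) - f k) = s * (f (rr ρL ρR m z) - f k)) :
    0 ≤ ∫ z, (eD (rr ρL ρR m) k z * pdT φ z + eF f (rr ρL ρR m) k z * pdX φ z) := by
  obtain ⟨C, hV⟩ := h.V_lip hF k (f k)
  have hV' : LipschitzWith (‖s‖₊ * C) (fun z => s * VV f ρL ρR m k (f k) z) := (lipschitzWith_smul s).comp hV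
  refine ent_core h hF hk hV' hφ (g := fun _ => 0) measurable_const (B := 0) (by simp) ?_ (by simp)
  filter_upwards [h.V_ae hF k (f k)] with z ⟨hd, hX, hT⟩
  have e : fderiv ℝ (fun z => s * VV f ρL ρR m k (f k) z) z = s • fderiv ℝ (VV f ρL ρR m k (f k)) z := fd_smul _ _ _
  unfold pdX at hX ⊢
  unfold pdT at hT ⊢
  rw [e]
  simp only [smul_apply, hX, hT, smul_eq_mul]
  refine ⟨(hs z).1, ?_⟩
  unfold eF fl
  split_ifs
  · rw [(hs z).2]; ring
  · ring

lemma ent_mid (h : Sel R f ε ρL ρR m) (hF : AF R ρb f) {k : ℝ} (hk : k ∈ uIcc ρL ρR)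
    (hk1 : 0 < ε * (k - ρL)) (hk2 : 0 < ε * (ρR - k)) 
    {φ : ℝ × ℝ → ℝ} (hφ : TestFn φ) (h0 : ∀ z, 0 ≤ φ z) :
    0 ≤ ∫ z, (eD (rr ρL ρR m) k z * pdT φ z + eF f (rr ρL ρR m) k z * pdX φ z) := by
  obtain ⟨L, hL, hLip⟩ := hF.lip
  obtain ⟨a, ha1, ha2⟩ : ∃ a, (∀ ξ < a, ε * m ξ ≤ ε * k) ∧ ∀ ξ > a, ε * k ≤ ε * m ξ := by
    have hb : BddAbove {ξ | ε * m ξ < ε * k} := by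
      refine ⟨L, fun ξ hξ => ?_⟩
      by_contra hc
      push Not at hc
      have := h.farR hLip hc
      rw [mem_ofPred_eq, this] at hξ
      nlinarith
    have hn : {ξ | ε * m ξ < ε * k}.Nonempty := by
      refine ⟨-L - 1, ?_⟩
      rw [mem_ofPred_eq, h.farL hLip (by linarith)]
      nlinarith
    refine ⟨sSup {ξ | ε * m ξ < ε * k}, fun ξ hξ => ?_, fun ξ hξ => ?_⟩
    · obtain ⟨y, hy, hlt⟩ := exists_lt_of_lt_csSup hn hξ
      exact (h.mono hlt.le).trans (le_of_lt hy)
    · by_contra hc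
      push Not at hc
      exact absurd (le_csSup hb hc) (not_le.2 hξ)
  set z1 : ℝ := UU f ρL ρR m (1, a) - k * a + f k with hz1
  have hz1p : 0 ≤ ε * z1 := by
    have := h.U_ge hk (1, a)
    simp at this
    rw [hz1]; nlinarith
  obtain ⟨C, hV⟩ := h.V_lip hF k (f k - z1)
  have hV0 : ∀ t, VV f ρL ρR m k (f k - z1) (t, a * max t 0) = 0 := by
    intro t
    rw [hz1]
    unfold VV UU
    by_cases ht : 0 < t
    · have e1 : rr ρL ρR m (t, a * max t 0) = rr ρL ρR m (1, a) := by
        simp only [rr, if_pos ht, max_eq_left ht.le]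
        simp
        rw [mul_div_cancel_right₀ _ ht.ne']
      rw [e1]
      simp only [max_eq_left ht.le]
      simp
      ring
    · have : max t 0 = 0 := max_eq_right (not_lt.1 ht)
      simp [this]
  obtain ⟨C1, hV1⟩ := kink hV a hV0
  have hV' : LipschitzWith (‖ε‖₊ * C1) (fun z => ε * (sg a z * VV f ρL ρR m k (f k - z1) z)) :=
    (lipschitzWith_smul ε).comp hV1
  have hkR := h.sub hk
  have hm : Measurable (fun z : ℝ × ℝ => ε * z1 * (sg a z * (if 0 < z.1 then (1:ℝ) else 0))) :=
    ((sg_meas a).mul (Measurable.ite (measurableSet_lt measurable_const measurable_fst) measurable_const measurable_const)).const_mul _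
  refine ent_core h hF hkR hV' hφ (g := fun z => ε * z1 * (sg a z * (if 0 < z.1 then 1 else 0))) hm (B := |ε * z1|)
      ?_ ?_ ?_
  · intro z
    rw [abs_mul]
    apply mul_le_of_le_one_right (abs_nonneg _)
    have := sg_le a z
    split_ifs <;> simp [this]
  · filter_upwards [h.V_ae hF k (f k - z1), kink_null a] with z ⟨hd, hX, hT⟩ hz
    obtain ⟨p1, p2⟩ := kink_pd (V := VV f ρL ρR m k (f k - z1)) a hz
    have e : fderiv ℝ (fun z => ε * (sg a z * VV f ρL ρR m k (f k - z1) z)) z =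
      ε • fderiv ℝ (fun z => sg a z * VV f ρL ρR m k (f k - z1) z) z := fd_smul _ _ _
    have q1 : pdX (fun z => ε * (sg a z * VV f ρL ρR m k (f k - z1) z)) z = ε * (sg a z * (rr ρL ρR m z - k)) := by
      rw [← hX, ← p1]; unfold pdX; rw [e]; rfl
    have q2 : pdT (fun z => ε * (sg a z * VV f ρL ρR m k (f k - z1) z)) z = ε * (sg a z * (- fl f (rr ρL ρR m) z + (f k - z1) * (if 0 < z.1 then 1 else 0))) := by
      rw [← hT, ← p2]; unfold pdT; rw [e]; rfl
    rw [q1, q2]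
    -- sign analysis
    have key : (z.2 < a * max z.1 0 → ε * (rr ρL ρR m z - k) ≤ 0) ∧ (a * max z.1 0 < z.2 → 0 ≤ ε * (rr ρL ρR m z - k)) := by
      unfold rr
      split_ifs with ht
      · rw [max_eq_left ht.le]
        constructor
        · intro hh
          have := ha1 (z.2 / z.1) (by rwa [div_lt_iff₀ ht])
          linarith
        · intro hh
          have := ha2 (z.2 / z.1) (by rwa [gt_iff_lt, lt_div_iff₀ ht])
          linarith
      · rw [max_eq_right (not_lt.1 ht), mul_zero]
        unfold riem
        constructor
        · intro hh; rw [if_pos hh]; nlinarith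
        · intro hh; rw [if_neg (not_lt.2 hh.le)]; nlinarith
    have key2 : |rr ρL ρR m z - k| = ε * sg a z * (rr ρL ρR m z - k) ∧ (rr ρL ρR m z - k = 0 ∨ Real.sign (rr ρL ρR m z - k) = ε * sg a z) := by
      rcases lt_or_gt_of_ne hz with hh | hh
      · have h1 := key.1 hh
        rw [sg, Real.sign_of_neg (by linarith)]
        rcases h.eps with e | e <;> rw [e] at h1 ⊢
        · rcases (show rr ρL ρR m z - k ≤ 0 by linarith).eq_or_lt with e0 | e0
          · exact ⟨by rw [e0]; simp, Or.inl e0⟩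
          · exact ⟨by rw [abs_of_neg e0]; ring, Or.inr (by rw [Real.sign_of_neg e0]; ring)⟩
        · rcases (show 0 ≤ rr ρL ρR m z - k by linarith).eq_or_lt with e0 | e0
          · exact ⟨by rw [← e0]; simp, Or.inl e0.symm⟩
          · exact ⟨by rw [abs_of_pos e0]; ring, Or.inr (by rw [Real.sign_of_pos e0]; ring)⟩
      · have h1 := key.2 hh
        rw [sg, Real.sign_of_pos (by linarith)]
        rcases h.eps with e | e <;> rw [e] at h1 ⊢
        · rcases (show 0 ≤ rr ρL ρR m z - k by linarith).eq_or_lt with e0 | e0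
          · exact ⟨by rw [← e0]; simp, Or.inl e0.symm⟩
          · exact ⟨by rw [abs_of_pos e0]; ring, Or.inr (by rw [Real.sign_of_pos e0]; ring)⟩
        · rcases (show rr ρL ρR m z - k ≤ 0 by linarith).eq_or_lt with e0 | e0
          · exact ⟨by rw [e0]; simp, Or.inl e0⟩
          · exact ⟨by rw [abs_of_neg e0]; ring, Or.inr (by rw [Real.sign_of_neg e0]; ring)⟩
    refine ⟨by unfold eD; rw [key2.1]; ring, ?_⟩
    unfold eF fl
    split_ifs
    · rcases key2.2 with e0 | e0
      · have : rr ρL ρR m z = k := by linarith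
        rw [this]; ring
      · rw [e0]; ring
    · ring
  · have := sg_int hφ h0 a
    simp_rw [mul_assoc (ε * z1)]
    rw [integral_const_mul]
    exact mul_nonpos_of_nonneg_of_nonpos hz1p this

lemma ent_all (h : Sel R f ε ρL ρR m) (hF : AF R ρb f) {k : ℝ} (hk : k ∈ Icc 0 R)
    {φ : ℝ × ℝ → ℝ} (hφ : TestFn φ) (h0 : ∀ z, 0 ≤ φ z) :
    0 ≤ ∫ z, (eD (rr ρL ρR m) k z * pdT φ z + eF f (rr ρL ρR m) k z * pdX φ z) := by
  have aux1 : (∀ z, 0 ≤ rr ρL ρR m z - k) → 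
    0 ≤ ∫ z, (eD (rr ρL ρR m) k z * pdT φ z + eF f (rr ρL ρR m) k z * pdX φ z) := by
    intro hp
    refine ent_const h hF hk hφ (s := 1) (fun z => ⟨by unfold eD; rw [abs_of_nonneg (hp z)]; ring, ?_⟩)
    rcases (hp z).eq_or_lt with e | e
    · have : rr ρL ρR m z = k := by linarith
      rw [this]; simp
    · rw [Real.sign_of_pos e]
  have aux2 : (∀ z, rr ρL ρR m z - k ≤ 0) → 
    0 ≤ ∫ z, (eD (rr ρL ρR m) k z * pdT φ z + eF f (rr ρL ρR m) k z * pdX φ z) := by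
    intro hp
    refine ent_const h hF hk hφ (s := -1) (fun z => ⟨by unfold eD; rw [abs_of_nonpos (hp z)]; ring, ?_⟩)
    rcases (hp z).eq_or_lt with e | e
    · have : rr ρL ρR m z = k := by linarith
      rw [this]; simp
    · rw [Real.sign_of_neg e]
  by_cases c1 : 0 < ε * (k - ρL)
  · by_cases c2 : 0 < ε * (ρR - k)
    · exact ent_mid h hF (h.mem_iff.2 ⟨c1.le, c2.le⟩) c1 c2 hφ h0
    · have : ∀ z, ε * (rr ρL ρR m z - k) ≤ 0 := by
        intro z
        have := (h.mem_iff.1 (h.rr_mem' z)).2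
        nlinarith
      rcases h.eps with e | e <;> rw [e] at this
      · exact aux2 (fun z => by linarith [this z])
      · exact aux1 (fun z => by linarith [this z])
  · have : ∀ z, 0 ≤ ε * (rr ρL ρR m z - k) := by
      intro z
      have := (h.mem_iff.1 (h.rr_mem' z)).1
      nlinarith
    rcases h.eps with e | e <;> rw [e] at this
    · exact aux1 (fun z => by linarith [this z])
    · exact aux2 (fun z => by linarith [this z])

lemma ent_on (h : Sel R f ε ρL ρR m) (hF : AF R ρb f) {q : ℝ → ℝ} (hqr : ∀ t, q t ∈ Icc 0 (f ρb)) (T : ℝ) :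
    EntIneqOn R (f ρb) T f q (riem ρL ρR) (fun t x => rr ρL ρR m (t, x)) := by
  intro φ hφ h0 _ k hk
  set r := rr ρL ρR m with hrdef
  have hmem := h.rr_mem
  have hrm := h.rr_meas
  rw [← hrdef] at hmem hrm
  have hfk := hF.2.2.1 k hk
  have hfp := hF.fpos
  have hB1 : ∀ z, |eD r k z| ≤ R + f ρb := fun z => (eD_le hmem hk z).trans (by linarith)
  have hB2 : ∀ z, |eF f r k z| ≤ R + f ρb := fun z => (eF_le hF hmem hk z).trans (by linarith [hF.1])
  obtain ⟨C', hC'⟩ := lip_of_test hφ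
  have i1 := (int_pd hC' hφ.2 (measurable_eD hrm k) hB1).1
  have i2 := (int_pd hC' hφ.2 (measurable_eF hF hrm hmem k) hB2).2
  have hI : Integrable (fun z => eD r k z * pdT φ z + eF f r k z * pdX φ z) := i1.add i2
  have hS : MeasurableSet (Ioi (0:ℝ) ×ˢ (univ : Set ℝ)) := measurableSet_Ioi.prod MeasurableSet.univ
  have e1 : ∫ z, (eD r k z * pdT φ z + eF f r k z * pdX φ z) =
      (∫ t in Ioi (0:ℝ), ∫ x : ℝ,
          (|r (t, x) - k| * pdT φ (t, x) +
            Real.sign (r (t, x) - k) * (f (r (t, x)) - f k) * pdX φ (t, x))) +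
        ∫ x : ℝ, |riem ρL ρR x - k| * φ (0, x) := by
    rw [← integral_add_compl hS hI]
    congr 1
    · rw [Measure.volume_eq_prod, setIntegral_prod]
      · apply setIntegral_congr_fun measurableSet_Ioi
        intro t ht
        simp only
        rw [Measure.restrict_univ]
        apply integral_congr_ae
        filter_upwards with x
        simp only [eD, eF, if_pos (mem_Ioi.1 ht)]
      · exact hI.integrableOn
    · rw [← past_int hφ (u := fun x => |riem ρL ρR x - k|) (B := R)]
      · apply setIntegral_congr_fun hS.compl
        intro z hz
        have : ¬ 0 < z.1 := by simpa using hz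
        simp only [eD, eF, hrdef, rr, if_neg this]; ring
      · exact ((measurable_riem ρL ρR).sub_const k).abs
      · intro x
        have := riem_mem h.hL h.hR x
        simp only [mem_Icc] at *
        rw [abs_abs, abs_le]; constructor <;> linarith
  have e0 := ent_all h hF hk hφ h0
  rw [← hrdef, e1] at e0
  have e2 : 0 ≤ ∫ t in Ioi (0:ℝ), (1 - q t / f ρb) * f k * φ (t, 0) := by
    apply integral_nonneg
    intro t
    have := (hqr t).2
    have h2 : q t / f ρb ≤ 1 := by rwa [div_le_one hfp]
    exact mul_nonneg (mul_nonneg (by linarith) hfk) (h0 _)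
  linarith

end

section

variable {R ρb : ℝ} {f : ℝ → ℝ} {ε ρL ρR : ℝ} {m : ℝ → ℝ}

lemma Sel.cont_ae (h : Sel R f ε ρL ρR m) {s : ℝ} (hs : 0 < s) : ∀ᵐ x : ℝ, ContinuousAt m (x / s) := by
  have h1 := h.mono.countable_not_continuousAt
  have h2 : {x | ¬ ContinuousAt m (x / s)} ⊆ (fun y => y * s) '' {y | ¬ ContinuousAt (fun ξ => ε * m ξ) y} := by
    intro x hx
    refine ⟨x / s, ?_, by field_simp⟩
    intro hc
    apply hx
    have := hc.const_mul ε
    refine this.congr ?_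
    filter_upwards with y
    rw [← mul_assoc, h.sq, one_mul]
  rw [ae_iff]
  exact ((h1.image _).mono h2).measure_zero _

lemma Sel.reg (h : Sel R f ε ρL ρR m) (hF : AF R ρb f) : RegSol R (fun t x => rr ρL ρR m (t, x)) := by
  refine ⟨h.rr_meas, fun t x => h.rr_mem _, ?_⟩
  intro r hr s hs
  have hb : ∀ t x, |rr ρL ρR m (t, x) - rr ρL ρR m (s, x)| ≤ R := by
    intro t x
    have h1 := h.rr_mem (t, x)
    have h2 := h.rr_mem (s, x)
    rw [mem_Icc] at h1 h2
    rw [abs_le]; constructor <;> linarith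
  have hpt : ∀ᵐ x : ℝ, Tendsto (fun t => |rr ρL ρR m (t, x) - rr ρL ρR m (s, x)|) (nhdsWithin s (Ici 0)) (nhds 0) := by
    rcases hs.eq_or_lt with e | hs'
    · subst e
      obtain ⟨L, hL, hLip⟩ := hF.lip
      have hne : ∀ᵐ x : ℝ, x ≠ 0 := by rw [ae_iff]; simp
      filter_upwards [hne] with x hx
      apply tendsto_const_nhds.congr'
      have hx' : 0 < |x| / L := by positivity
      filter_upwards [self_mem_nhdsWithin, mem_nhdsWithin_of_mem_nhds (gt_mem_nhds hx')] with t ht ht2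
      rw [lt_div_iff₀ hL] at ht2
      simp only [rr, lt_irrefl, if_false]
      split_ifs with ht0
      · unfold riem
        rcases lt_or_gt_of_ne hx with hx1 | hx1
        · rw [if_pos hx1, h.farL hLip]; · simp
          rw [div_lt_iff₀ ht0]; rw [abs_of_neg hx1] at ht2; linarith
        · rw [if_neg (not_lt.2 hx1.le), h.farR hLip]; · simp
          rw [lt_div_iff₀ ht0]; rw [abs_of_pos hx1] at ht2; linarith
      · simp
    · filter_upwards [h.cont_ae hs'] with x hx
      have h1 : Tendsto (fun t : ℝ => x / t) (nhds s) (nhds (x / s)) :=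
        tendsto_const_nhds.div tendsto_id hs'.ne'
      have h2 : Tendsto (fun t => m (x / t)) (nhds s) (nhds (m (x / s))) := hx.tendsto.comp h1
      have h3 : Tendsto (fun t => |m (x / t) - m (x / s)|) (nhds s) (nhds 0) := by
        have := (h2.sub_const (m (x / s))).abs
        simpa using this
      refine (h3.mono_left nhdsWithin_le_nhds).congr' ?_
      filter_upwards [mem_nhdsWithin_of_mem_nhds (lt_mem_nhds hs')] with t ht
      simp only [rr, if_pos ht, if_pos hs']
  have hmm : ∀ t, Measurable (fun x => rr ρL ρR m (t, x)) := fun t => h.rr_meas.comp measurable_prodMk_left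
  have := tendsto_integral_filter_of_dominated_convergence (μ := volume.restrict (Icc (-r) r))
    (F := fun t x => |rr ρL ρR m (t, x) - rr ρL ρR m (s, x)|) (f := fun _ => 0) (l := nhdsWithin s (Ici 0))
    (fun _ => R) ?_ ?_ ?_ ?_
  · simpa using this
  · filter_upwards with t
    exact ((hmm t).sub (hmm s)).abs.aestronglyMeasurable
  · filter_upwards with t
    filter_upwards with x
    rw [Real.norm_eq_abs, abs_abs]; exact hb t x
  · exact integrable_const _
  · exact ae_restrict_of_ae hpt

lemma trace_gen {ρ : ℝ → ℝ → ℝ} (hρ : Measurable (Function.uncurry ρ)) {γ B : ℝ} (hb : ∀ t x, |ρ t x - γ| ≤ B)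
    {S : ℝ → Set ℝ} (hS : ∀ e, MeasurableSet (S e)) (hv : ∀ e, 0 < e → volume (S e) = ENNReal.ofReal e)
    (H : ∀ t > 0, ∀ η > 0, ∃ δ > 0, ∀ e, 0 < e → e < δ → ∀ x ∈ S e, |ρ t x - γ| ≤ η)
    {φ : ℝ × ℝ → ℝ} (hφ : TestFn φ) :
    Tendsto (fun e : ℝ => (1 / e) * ∫ t in Ioi (0:ℝ), ∫ x in S e,
        |ρ t x - γ| * φ (t, x)) (nhdsWithin 0 (Ioi 0)) (nhds 0) := by
  obtain ⟨M, hM⟩ : ∃ M, ∀ z, |φ z| ≤ M := by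
    obtain ⟨M, hM⟩ := hφ.2.exists_bound_of_continuous hφ.1.continuous
    exact ⟨M, hM⟩
  have hM0 : 0 ≤ M := (abs_nonneg _).trans (hM 0)
  have hB0 : 0 ≤ B := (abs_nonneg _).trans (hb 0 0)
  obtain ⟨A, hA⟩ : ∃ A, ∀ z, φ z ≠ 0 → z.1 ≤ A := by
    obtain ⟨A, hA⟩ := (hφ.2.isCompact.image continuous_fst).bddAbove
    exact ⟨A, fun z hz => hA ⟨z, subset_tsupport _ hz, rfl⟩⟩
  have hg : Measurable (fun z : ℝ × ℝ => |ρ z.1 z.2 - γ| * φ z) :=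
    (hρ.sub_const γ).abs.mul hφ.1.continuous.measurable
  have hbd : ∀ e, 0 < e → ∀ t η, (∀ x ∈ S e, |ρ t x - γ| ≤ η) → 0 ≤ η →
      ‖(1 / e) * ∫ x in S e, |ρ t x - γ| * φ (t, x)‖ ≤ η * M := by
    intro e he t η hη hη0
    have h1 : ‖∫ x in S e, |ρ t x - γ| * φ (t, x)‖ ≤ η * M * volume.real (S e) := by
      apply norm_setIntegral_le_of_norm_le_const
      · rw [hv e he]; exact ENNReal.ofReal_lt_top
      · intro x hx
        rw [Real.norm_eq_abs, abs_mul, abs_abs]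
        exact mul_le_mul (hη x hx) (hM _) (abs_nonneg _) hη0
    rw [Measure.real, hv e he, ENNReal.toReal_ofReal he.le] at h1
    rw [norm_mul, Real.norm_of_nonneg (by positivity : 0 ≤ 1 / e)]
    calc 1 / e * ‖∫ x in S e, |ρ t x - γ| * φ (t, x)‖ ≤ 1 / e * (η * M * e) := by gcongr
      _ = η * M := by field_simp
  have key := tendsto_integral_filter_of_dominated_convergence (μ := volume.restrict (Ioi (0:ℝ)))
    (F := fun e t => (1 / e) * ∫ x in S e, |ρ t x - γ| * φ (t, x)) (f := fun _ => 0) (l := nhdsWithin 0 (Ioi 0))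
    ((Icc 0 A).indicator (fun _ => B * M)) ?_ ?_ ?_ ?_
  · simp only [integral_zero, integral_const_mul] at key
    exact key
  · filter_upwards with e
    refine (StronglyMeasurable.aestronglyMeasurable ?_).const_mul _
    exact (hg.stronglyMeasurable).integral_prod_right (ν := volume.restrict (S e))
  · filter_upwards [self_mem_nhdsWithin] with e he
    filter_upwards [ae_restrict_mem measurableSet_Ioi] with t ht
    by_cases htA : t ≤ A
    · rw [indicator_of_mem (show t ∈ Icc 0 A from ⟨le_of_lt ht, htA⟩)]
      exact hbd e he t B (fun x _ => hb t x) hB0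
    · have : ∀ x, φ (t, x) = 0 := fun x => by
        by_contra hc
        exact htA (hA _ hc)
      simp only [this, mul_zero, integral_zero, norm_zero]
      apply indicator_nonneg
      intro _ _; positivity
  · rw [integrable_indicator_iff measurableSet_Icc]
    refine integrableOn_const ?_
    refine ((Measure.restrict_apply_le _ _).trans_lt ?_).ne
    rw [Real.volume_Icc]; exact ENNReal.ofReal_lt_top
  · filter_upwards [ae_restrict_mem measurableSet_Ioi] with t ht
    rw [Metric.tendsto_nhdsWithin_nhds]
    intro η hη
    obtain ⟨δ, hδ, hd⟩ := H t ht (η / (2 * (M + 1))) (by positivity)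
    refine ⟨δ, hδ, fun {e} he hed => ?_⟩
    rw [dist_zero_right, Real.norm_of_nonneg (le_of_lt he)] at hed
    rw [dist_zero_right]
    refine (hbd e he t _ (hd e he hed) (by positivity)).trans_lt ?_
    have : η / (2 * (M + 1)) * M = η * (M / (2 * (M + 1))) := by ring
    rw [this]
    apply mul_lt_of_lt_one_right hη
    rw [div_lt_one (by positivity)]; linarith

lemma Sel.lim_mem (h : Sel R f ε ρL ρR m) (hF : AF R ρb f) {l : Filter ℝ} [l.NeBot] (hl : l ≤ nhds 0) {γ : ℝ}
    (hγ : Tendsto m l (nhds γ)) : γ ∈ uIcc ρL ρR ∧ ∀ i ∈ uIcc ρL ρR, ε * f γ ≤ ε * f i := by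
  have h1 : γ ∈ uIcc ρL ρR := isClosed_Icc.mem_of_tendsto hγ (Eventually.of_forall h.mem)
  refine ⟨h1, fun i hi => ?_⟩
  have h2 : Tendsto (fun ξ => f (m ξ)) l (nhds (f γ)) := by
    have := hF.contOn γ (h.sub h1)
    exact this.tendsto.comp (tendsto_nhdsWithin_iff.2 ⟨hγ, Eventually.of_forall h.memI⟩)
  have hid : Tendsto (fun ξ : ℝ => ξ) l (nhds 0) := hl
  have h3 := ((hγ.mul hid).sub h2).const_mul ε
  have h4 := ((hid.const_mul i).sub_const (f i)).const_mul ε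
  have := le_of_tendsto_of_tendsto h4 h3 (Eventually.of_forall fun ξ => h.opt ξ i hi)
  linarith

lemma Sel.traces (h : Sel R f ε ρL ρR m) (hF : AF R ρb f) : ∃ γm γp : ℝ,
    LeftTraceAt (fun t x => rr ρL ρR m (t, x)) (fun _ => γm) ∧ RightTraceAt (fun t x => rr ρL ρR m (t, x)) (fun _ => γp) ∧
    (γm ∈ uIcc ρL ρR ∧ ∀ i ∈ uIcc ρL ρR, ε * f γm ≤ ε * f i) ∧ (γp ∈ uIcc ρL ρR ∧ ∀ i ∈ uIcc ρL ρR, ε * f γp ≤ ε * f i) := by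
  have hm1 : ∀ {l : Filter ℝ} {c : ℝ}, Tendsto (fun ξ => ε * m ξ) l (nhds c) → Tendsto m l (nhds (ε * c)) := by
    intro l c hc
    refine (hc.const_mul ε).congr fun ξ => ?_
    rw [← mul_assoc, h.sq, one_mul]
  have tl := hm1 (h.mono.tendsto_leftLim 0)
  have tr := hm1 (h.mono.tendsto_rightLim 0)
  have bl := h.lim_mem hF nhdsWithin_le_nhds tl
  have br := h.lim_mem hF nhdsWithin_le_nhds tr
  have hbd : ∀ {γ : ℝ}, γ ∈ uIcc ρL ρR → ∀ t x, |rr ρL ρR m (t, x) - γ| ≤ R := by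
    intro γ hγ t x
    have h1 := h.rr_mem (t, x)
    have h2 := h.sub hγ
    rw [mem_Icc] at h1 h2
    rw [abs_le]; constructor <;> linarith
  refine ⟨_, _, fun φ hφ => ?_, fun φ hφ => ?_, bl, br⟩
  · refine trace_gen (ρ := fun t x => rr ρL ρR m (t, x)) (S := fun e => Ioo (-e) 0) h.rr_meas (hbd bl.1) (fun e => measurableSet_Ioo) (fun e he => by rw [Real.volume_Ioo]; simp) ?_ hφ
    intro t ht η hη
    rw [Metric.tendsto_nhdsWithin_nhds] at tl
    obtain ⟨δ, hδ, hd⟩ := tl η hη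
    refine ⟨δ * t, by positivity, fun e he hed x hx => ?_⟩
    simp only [rr, if_pos ht]
    have hx0 : x / t < 0 := div_neg_of_neg_of_pos hx.2 ht
    refine (hd hx0 ?_).le
    rw [dist_zero_right, Real.norm_of_nonpos hx0.le, ← neg_div, div_lt_iff₀ ht]
    linarith [hx.1]
  · refine trace_gen (ρ := fun t x => rr ρL ρR m (t, x)) (S := fun e => Ioo 0 e) h.rr_meas (hbd br.1) (fun e => measurableSet_Ioo) (fun e he => by rw [Real.volume_Ioo]; simp) ?_ hφ
    intro t ht η hη
    rw [Metric.tendsto_nhdsWithin_nhds] at tr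
    obtain ⟨δ, hδ, hd⟩ := tr η hη
    refine ⟨δ * t, by positivity, fun e he hed x hx => ?_⟩
    simp only [rr, if_pos ht]
    have hx0 : 0 < x / t := div_pos hx.1 ht
    refine (hd hx0 ?_).le
    rw [dist_zero_right, Real.norm_of_nonneg hx0.le, div_lt_iff₀ ht]
    linarith [hx.2]

/-- reduction of existence to conditions on the constant constraint level -/
lemma Sel.cei (h : Sel R f ε ρL ρR m) (hF : AF R ρb f) {q0 : ℝ} (hq : q0 ∈ Icc 0 (f ρb))
    (hq2 : ∀ γ ∈ uIcc ρL ρR, (∀ i ∈ uIcc ρL ρR, ε * f γ ≤ ε * f i) → f γ ≤ q0) (T : ℝ) :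
    ∃ γm γp : ℝ → ℝ, CEIOn R (f ρb) T f (fun _ => q0) (riem ρL ρR) (fun t x => rr ρL ρR m (t, x)) γm γp := by
  obtain ⟨γm, γp, h1, h2, h3, h4⟩ := h.traces hF
  exact ⟨_, _, h.reg hF, fun _ => hq, ent_on h hF (fun _ => hq) T, h1, h2,
    Eventually.of_forall fun t => ⟨hq2 _ h3.1 h3.2, hq2 _ h4.1 h4.2⟩⟩

end

section

variable {R ρb : ℝ} {f w p : ℝ → ℝ} {ε ρL ρR : ℝ} {m : ℝ → ℝ}

lemma Sel.ews (h : Sel R f ε ρL ρR m) (hF : AF R ρb f) {q0 : ℝ} (hq : q0 ∈ Icc 0 (f ρb))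
    (hq2 : ∀ γ ∈ uIcc ρL ρR, (∀ i ∈ uIcc ρL ρR, ε * f γ ≤ ε * f i) → f γ ≤ q0) {T : ℝ}
    (hA : ∀ t, 0 < t → t < T → q0 ∈ Icc (pplus R p (wAvg w (fun t x => rr ρL ρR m (t, x)) t))
      (pminus p (wAvg w (fun t x => rr ρL ρR m (t, x)) t))) :
    ∃ ρ γm γp, EWSolOn R (f ρb) T f w p (riem ρL ρR) ρ γm γp := by
  obtain ⟨γm, γp, h1⟩ := h.cei hF hq hq2 T
  refine ⟨_, _, _, _, h1, ?_⟩
  filter_upwards [ae_restrict_mem measurableSet_Ioo] with t ht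
  exact hA t ht.1 ht.2

lemma Sel.slice (h : Sel R f ε ρL ρR m) (t : ℝ) : Measurable (fun x => rr ρL ρR m (t, x)) :=
  h.rr_meas.comp measurable_prodMk_left

lemma Sel.slice_bd (h : Sel R f ε ρL ρR m) (t x : ℝ) : |rr ρL ρR m (t, x)| ≤ R := by
  have := h.rr_mem (t, x)
  rw [abs_of_nonneg this.1]; exact this.2

lemma Sel.slice_bd2 (h : Sel R f ε ρL ρR m) (t x : ℝ) : |rr ρL ρR m (t, x) - ρL| ≤ R := by
  have h1 := h.rr_mem (t, x)
  have h2 := h.hL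
  rw [mem_Icc] at h1 h2
  rw [abs_le]; constructor <;> linarith

lemma Sel.avg_eq (h : Sel R f ε ρL ρR m) (hW : AW w) (t : ℝ) :
    wAvg w (fun t x => rr ρL ρR m (t, x)) t = ρL + ∫ x in Iic (0:ℝ), w x * (rr ρL ρR m (t, x) - ρL) := by
  rw [hW.avg_sub (h.slice t) (h.slice_bd t)]
  unfold wAvg; ring

lemma Sel.avg_close (h : Sel R f ε ρL ρR m) (hW : AW w) {L : ℝ} (hL : 0 < L)
    (hLip : ∀ x ∈ Icc 0 R, ∀ y ∈ Icc 0 R, |f x - f y| ≤ L * |x - y|) {t : ℝ} (ht : 0 < t) :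
    |wAvg w (fun t x => rr ρL ρR m (t, x)) t - ρL| ≤ R * (L * t) * w 0 := by
  have hR0 : 0 ≤ R := h.hL.1.trans h.hL.2
  have key : ∀ a, 0 ≤ a → |∫ x in Ioc (-a) 0, (rr ρL ρR m (t, x) - ρL)| ≤ R * (L * t) := by
    intro a ha
    have e : ∫ x in Ioc (-a) 0, (rr ρL ρR m (t, x) - ρL) = ∫ x in Ioc (-a) 0 ∩ Icc (-(L * t)) 0, (rr ρL ρR m (t, x) - ρL) := by
      apply setIntegral_eq_of_subset_of_forall_sdiff_eq_zero measurableSet_Ioc inter_subset_left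
      intro x hx
      have hx1 : x < -(L * t) := by
        by_contra hc
        exact hx.2 ⟨hx.1, not_lt.1 hc, hx.1.2⟩
      simp only [rr, if_pos ht]
      rw [h.farL hLip (by rw [div_lt_iff₀ ht]; linarith)]; ring
    rw [e, ← Real.norm_eq_abs]
    have hfin : volume (Icc (-(L * t)) 0) < ⊤ := by rw [Real.volume_Icc]; exact ENNReal.ofReal_lt_top
    refine (norm_setIntegral_le_of_norm_le_const ((measure_mono inter_subset_right).trans_lt hfin) (C := R) fun x _ => h.slice_bd2 t x).trans ?_
    gcongr
    refine (measureReal_mono inter_subset_right hfin.ne).trans ?_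
    rw [Real.volume_real_Icc_of_le (by linarith [mul_pos hL ht])]; linarith
  have hg : Measurable (fun x => rr ρL ρR m (t, x) - ρL) := (h.slice t).sub_const _
  rw [h.avg_eq hW]
  have h1 := hW.int_le hg (h.slice_bd2 t) (fun a ha => (abs_le.1 (key a ha)).2)
  have h2 := hW.int_ge hg (h.slice_bd2 t) (fun a ha => (abs_le.1 (key a ha)).1)
  rw [abs_le]; constructor <;> linarith

lemma Sel.avg_sign (h : Sel R f ε ρL ρR m) (hW : AW w) (t : ℝ) :
    0 ≤ ε * (wAvg w (fun t x => rr ρL ρR m (t, x)) t - ρL) := by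
  rw [h.avg_eq hW, add_sub_cancel_left, ← integral_const_mul]
  apply setIntegral_nonneg measurableSet_Iic
  intro x hx
  have h1 := (h.mem_iff.1 (h.rr_mem' (t, x))).1
  have h2 := hW.1 x hx
  have : ε * (w x * (rr ρL ρR m (t, x) - ρL)) = w x * (ε * (rr ρL ρR m (t, x) - ρL)) := by ring
  rw [this]; positivity

/-- the average is the left state when the profile is constant on the left -/
lemma Sel.avg_const (h : Sel R f ε ρL ρR m) (hW : AW w) {t : ℝ} (ht : 0 < t) (hm : ∀ ξ < 0, m ξ = ρL) :
    wAvg w (fun t x => rr ρL ρR m (t, x)) t = ρL := by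
  rw [h.avg_eq hW, integral_Iic_eq_integral_Iio, setIntegral_eq_zero_of_forall_eq_zero, add_zero]
  intro x hx
  simp only [rr, if_pos ht]
  rw [hm _ (div_neg_of_neg_of_pos hx ht)]; ring

lemma Sel.avg_lt (h : Sel R f (-1) ρL ρR m) (hW : AW w) {t s : ℝ} (ht : 0 < t) (hs : 0 < s)
    (hm : ∀ ξ < 0, -s < ξ → m ξ ≠ ρL) : wAvg w (fun t x => rr ρL ρR m (t, x)) t < ρL := by
  obtain ⟨b, hb, hwb⟩ := hW.pos
  have hg : Measurable (fun x => rr ρL ρR m (t, x) - ρL) := (h.slice t).sub_const _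
  have hle : ∀ x, 0 ≤ -(rr ρL ρR m (t, x) - ρL) := by
    intro x
    have := (h.mem_iff.1 (h.rr_mem' (t, x))).1
    linarith
  have hint : ∀ a, IntegrableOn (fun x => -(rr ρL ρR m (t, x) - ρL)) (Ioc (-a) 0) := by
    intro a
    refine Measure.integrableOn_of_bounded (M := R) ?_ hg.neg.aestronglyMeasurable ?_
    · rw [Real.volume_Ioc]; exact ENNReal.ofReal_ne_top
    · filter_upwards with x
      rw [norm_neg]; exact h.slice_bd2 t x
  have hpos : 0 < ∫ x in Ioc (-b) 0, -(rr ρL ρR m (t, x) - ρL) := by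
    rw [setIntegral_pos_iff_support_of_nonneg_ae (by filter_upwards with x; exact hle x) (hint b)]
    have hmn : 0 < min b (s * t) := lt_min hb (by positivity)
    have hsub : Ioo (-(min b (s * t))) 0 ⊆ Function.support (fun x => -(rr ρL ρR m (t, x) - ρL)) ∩ Ioc (-b) 0 := by
      intro x hx
      have h1 := min_le_left b (s * t)
      have h2 := min_le_right b (s * t)
      have h3 := hx.1
      refine ⟨?_, by linarith, hx.2.le⟩
      rw [Function.mem_support]
      simp only [rr, if_pos ht]
      have := hm (x / t) (div_neg_of_neg_of_pos hx.2 ht) (by rw [lt_div_iff₀ ht]; linarith)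
      intro hc
      apply this; linarith
    refine lt_of_lt_of_le ?_ (measure_mono hsub)
    rw [Real.volume_Ioo]
    exact ENNReal.ofReal_pos.2 (by linarith)
  have hneg : ∀ a, ∫ x in Ioc (-a) 0, (rr ρL ρR m (t, x) - ρL) = -∫ x in Ioc (-a) 0, -(rr ρL ρR m (t, x) - ρL) := by
    intro a; rw [integral_neg, neg_neg]
  have := hW.int_neg hg (h.slice_bd2 t) hb.le hwb hpos (by
    intro a _
    rw [hneg]
    have := integral_nonneg (μ := volume.restrict (Ioc (-a) 0)) (f := fun x => -(rr ρL ρR m (t, x) - ρL)) hle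
    linarith) (by
    intro a ha
    rw [hneg]
    have := setIntegral_mono_set (hint a) (by filter_upwards with x; exact hle x)
      (Ioc_subset_Ioc_left (by linarith : -a ≤ -b)).eventuallyLE
    linarith)
  rw [h.avg_eq hW]; linarith

theorem existence (hF : AF R ρb f) (hW : AW w) (hP : AP2 R (f ρb) p) (hL : ρL ∈ Icc 0 R) (hR : ρR ∈ Icc 0 R)
    (hC : Cases R ρb f p ρL ρR) : ∃ T0 > 0, ∀ T, 0 < T → T ≤ T0 →
      ∃ ρ γm γp, EWSolOn R (f ρb) T f w p (riem ρL ρR) ρ γm γp := by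
  have hb : ρb ∈ Icc 0 R := Ioo_subset_Icc_self hF.2.2.2.2.2.1
  have hpm := hP.pplus_le_max hL
  obtain ⟨L, hL0, hLip⟩ := hF.lip
  have hR0 := hF.1
  have hw0 := hW.w0
  -- choice of the time
  have time : ∀ δ > 0, ∃ T0 > 0, ∀ T, 0 < T → T ≤ T0 → ∀ t, 0 < t → t < T → R * (L * t) * w 0 < δ := by
    intro δ hδ
    refine ⟨δ / (R * L * (w 0 + 1)), by positivity, fun T _ hT t ht htT => ?_⟩
    have h1 : t < δ / (R * L * (w 0 + 1)) := by linarith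
    rw [lt_div_iff₀ (by positivity)] at h1
    have : 0 < t * (R * L) := by positivity
    nlinarith
  have caseA : ρL ≤ ρR → (f ρL ≤ pplus R p ρL ∨ f ρR ≤ pplus R p ρL) → ∃ T0 > 0, ∀ T, 0 < T → T ≤ T0 →
      ∃ ρ γm γp, EWSolOn R (f ρb) T f w p (riem ρL ρR) ρ γm γp := by
    intro hle hor
    obtain ⟨m, h⟩ := exists_sel (ε := 1) hF hL hR (Or.inl rfl) (by linarith)
    obtain ⟨δ, hδ, hd⟩ := hP.pplus_spec hR0 hL
    obtain ⟨T0, hT0, hT⟩ := time δ hδ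
    refine ⟨T0, hT0, fun T h1 h2 => ?_⟩
    refine h.ews hF (q0 := pplus R p ρL) ⟨?_, hpm⟩ ?_ ?_
    · rcases hor with h | h
      · exact (hF.2.2.1 _ hL).trans h
      · exact (hF.2.2.1 _ hR).trans h
    · intro γ _ hγ
      rcases hor with h | h
      · linarith [hγ ρL left_mem_uIcc]
      · linarith [hγ ρR right_mem_uIcc]
    · intro t ht htT
      have a1 := h.avg_sign hW t
      have a2 := (abs_le.1 (h.avg_close hW hL0 hLip ht)).2
      have a3 := hT T h1 h2 t ht htT
      have a4 := wAvg_mem hW (h.reg hF).1 (h.reg hF).2.1 t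
      exact (hd _ a4).2 (by linarith) (by linarith)
  rcases hC with h | h | h | h | h
  · exact caseA h.1.le (Or.inr h.2.2)
  · exact caseA h.1.le (Or.inl h.2.2)
  · rcases h.1.eq_or_lt with e | hlt
    · exact caseA e.ge (Or.inl h.2.2)
    obtain ⟨m, hs⟩ := exists_sel (ε := -1) hF hL hR (Or.inr rfl) (by linarith)
    refine ⟨1, one_pos, fun T _ _ => hs.ews hF (q0 := pplus R p ρL) ⟨(hF.2.2.1 _ hL).trans h.2.2, hpm⟩ ?_ ?_⟩
    · intro γ hγ _
      rw [uIcc_of_ge h.1] at hγ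
      refine le_trans ?_ h.2.2
      exact hF.strictMonoOn.monotoneOn ⟨by linarith [hγ.1, hR.1], by linarith [hγ.2]⟩ ⟨hL.1, h.2.1⟩ hγ.2
    · intro t ht _
      rw [hs.avg_const hW ht]
      · obtain ⟨δ, hδ, hd⟩ := hP.pplus_spec hR0 hL
        exact (hd ρL hL).2 le_rfl (by linarith)
      · intro ξ hξ
        have hm := hs.mem ξ
        rw [uIcc_of_ge h.1] at hm
        have ho := hs.opt ξ ρL left_mem_uIcc
        have hf : f (m ξ) ≤ f ρL :=
          hF.strictMonoOn.monotoneOn ⟨by linarith [hm.1, hR.1], by linarith [hm.2]⟩ ⟨hL.1, h.2.1⟩ hm.2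
        by_contra hc
        have : m ξ < ρL := lt_of_le_of_ne hm.2 hc
        nlinarith
  · obtain ⟨m, hs⟩ := exists_sel (ε := -1) hF hL hR (Or.inr rfl) (by linarith)
    refine ⟨1, one_pos, fun T _ _ => hs.ews hF (q0 := pplus R p ρL) ⟨h.2.2 ▸ hF.fpos.le, hpm⟩ ?_ ?_⟩
    · intro γ hγ _
      rw [← h.2.2]
      exact hF.le_max (hs.sub hγ)
    · intro t ht _
      have a1 := hs.avg_sign hW t
      have a4 := wAvg_mem hW (hs.reg hF).1 (hs.reg hF).2.1 t
      set η := wAvg w (fun t x => rr ρL ρR m (t, x)) t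
      refine ⟨h.2.2 ▸ hP.pplus_le_max a4, AP2.le_pminus a4.1 fun y hy0 hy1 _ => ?_⟩
      refine hP.pplus_le hL.1 hL.2 fun y' hy' _ hyR => ?_
      exact hP.1 ⟨hy0, by linarith [a4.2]⟩ ⟨by linarith [hL.1], hyR⟩ (by linarith)
  · obtain ⟨h1, h2, h3, h4⟩ := h
    rcases h2.eq_or_lt with e | hlt
    · exact caseA e.ge (Or.inl h4.le)
    obtain ⟨m, hs⟩ := exists_sel (ε := -1) hF hL hR (Or.inr rfl) (by linarith)
    have hLp : 0 < ρL := by linarith [hb.1]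
    obtain ⟨δ, hδ, hd⟩ := hP.pminus_spec2 hL hLp
    obtain ⟨T0, hT0, hT⟩ := time δ hδ
    refine ⟨T0, hT0, fun T k1 k2 => hs.ews hF (q0 := pminus p ρL) ⟨(hF.2.2.1 _ hR).trans h3, ?_⟩ ?_ ?_⟩
    · exact (hP.pminus_le hL.2 le_rfl hLp).trans (hP.2.1 0 ⟨le_rfl, hR0.le⟩).2
    · intro γ hγ _
      rw [uIcc_of_ge h2] at hγ
      refine le_trans ?_ h3
      exact hF.strictAntiOn.antitoneOn ⟨h1.le, hR.2⟩ ⟨by linarith [hγ.1], by linarith [hγ.2, hL.2]⟩ hγ.1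
    · intro t ht htT
      have a2 := (abs_le.1 (hs.avg_close hW hL0 hLip ht)).1
      have a3 := hT T k1 k2 t ht htT
      have a4 := wAvg_mem hW (hs.reg hF).1 (hs.reg hF).2.1 t
      have hff : f ρL < f ρR := hF.strictAntiOn ⟨h1.le, hR.2⟩ ⟨by linarith, hL.2⟩ hlt
      have a5 := hs.avg_lt hW ht (s := (f ρR - f ρL) / (ρL - ρR)) (div_pos (by linarith) (by linarith)) (by
        intro ξ hξ0 hξ1 hc
        have ho := hs.opt ξ ρR right_mem_uIcc
        rw [hc] at ho
        rw [← neg_div, div_lt_iff₀ (by linarith)] at hξ1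
        linarith)
      exact hd _ a4 (by linarith) a5

end

/-- if `(ρL, ρR)` satisfies one of the conditions (C1)–(C5), then locally in
time the constrained Riemann problem with non-local constraint admits an entropy weak
solution and any two such solutions coincide a.e. -/
theorem stmt6 (R ρb : ℝ) (f w p : ℝ → ℝ) (hF : AF R ρb f) (hW : AW w)
    (hP : AP2 R (f ρb) p) (ρL ρR : ℝ) (hL : ρL ∈ Icc (0:ℝ) R) (hR' : ρR ∈ Icc (0:ℝ) R)
    (hC : -- (C1)
          (ρL < ρR ∧ f ρR < f ρL ∧ f ρR ≤ pplus R p ρL) ∨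
          -- (C2)
          (ρL < ρR ∧ f ρL ≤ f ρR ∧ f ρL ≤ pplus R p ρL) ∨
          -- (C3)
          (ρR ≤ ρL ∧ ρL ≤ ρb ∧ f ρL ≤ pplus R p ρL) ∨
          -- (C4)
          (ρR ≤ ρb ∧ ρb < ρL ∧ f ρb = pplus R p ρL) ∨
          -- (C5)
          (ρb < ρR ∧ ρR ≤ ρL ∧ f ρR ≤ pminus p ρL ∧ f ρL < pplus R p ρL)) :
    ∃ T > (0:ℝ),
      (∃ ρ : ℝ → ℝ → ℝ, ∃ γm γp : ℝ → ℝ,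
        EWSolOn R (f ρb) T f w p (riem ρL ρR) ρ γm γp) ∧
      ∀ (ρ1 ρ2 : ℝ → ℝ → ℝ) (γm1 γp1 γm2 γp2 : ℝ → ℝ),
        EWSolOn R (f ρb) T f w p (riem ρL ρR) ρ1 γm1 γp1 →
        EWSolOn R (f ρb) T f w p (riem ρL ρR) ρ2 γm2 γp2 →
        aeEqOn T ρ1 ρ2 := by
  obtain ⟨T1, hT1, hu⟩ := uniqueness hF hW hP hL hR' hC
  obtain ⟨T2, hT2, he⟩ := existence hF hW hP hL hR' hC
  have hT : 0 < min T1 T2 := lt_min hT1 hT2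
  exact ⟨min T1 T2, hT, he _ hT (min_le_right _ _), hu _ hT (min_le_left _ _)⟩

end

end CRP
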